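/- Let X ⊂ ℙⁿ_k be a global complete intersection of dimension ≥ 3 over a field k, and V a vector bundle on X. Then V is isomorphic to a direct sum of line bundles O_X(d_i) if and only if H¹(X, End(V)(i)) = 0 and H²(X, End(V)(i)) = 0 for all i ∈ ℤ. -/

import Mathlib

open IsLocalRing

/-- `depthGE R M n` : the `m`-depth of the `R`-module `M` is at least `n`. -/
def depthGE (R : Type*) [CommRing R] [IsLocalRing R]
    (M : Type*) [AddCommGroup M] [Module R M] (n : ℕ) : Prop :=
  ∃ rs : List R, rs.length = n ∧ (∀ r ∈ rs, r ∈ maximalIdeal R) ∧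
    RingTheory.Sequence.IsWeaklyRegular M rs

set_option linter.unusedSectionVars false

namespace VB

section QuasiRegular

open MvPolynomial

variable {P : Type*} [CommRing P] {σ : Type*}

/-- The monomials of `F` involve only variables in `s`. -/
def InVars (s : Set σ) (F : MvPolynomial σ P) : Prop :=
  ∀ β i, i ∉ s → β i ≠ 0 → coeff β F = 0

lemma InVars.add {s : Set σ} {F G : MvPolynomial σ P} (hF : InVars s F) (hG : InVars s G) :
    InVars s (F + G) := fun β i hi hβ => by
  rw [coeff_add, hF β i hi hβ, hG β i hi hβ, add_zero]

lemma InVars.C_mul {s : Set σ} {F : MvPolynomial σ P} (hF : InVars s F) (a : P) :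
    InVars s (C a * F) := fun β i hi hβ => by
  rw [coeff_C_mul, hF β i hi hβ, mul_zero]

lemma InVars.X_mul {s : Set σ} {F : MvPolynomial σ P} (hF : InVars s F) {j : σ} (hj : j ∈ s) :
    InVars s (X j * F) := fun β i hi hβ => by
  classical
  rw [coeff_X_mul']
  split_ifs with h
  · refine hF _ i hi ?_
    have : j ≠ i := fun h => hi (h ▸ hj)
    simpa [Finsupp.single_apply, this] using hβ
  · rfl

lemma mem_pow_span (f : σ → P) (s : Set σ) (j : ℕ) {z : P}
    (hz : z ∈ Ideal.span (f '' s) ^ j) :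
    ∃ F : MvPolynomial σ P, F.IsHomogeneous j ∧ InVars s F ∧ eval f F = z := by
  induction j generalizing z with
  | zero =>
    refine ⟨C z, isHomogeneous_C _ _, fun β i hi hβ => ?_, by simp⟩
    classical
    rw [coeff_C, if_neg]
    rintro rfl
    simp at hβ
  | succ j ih =>
    rw [pow_succ'] at hz
    refine Submodule.mul_induction_on hz (fun a ha b hb => ?_) ?_
    · obtain ⟨F, hF, hFs, rfl⟩ := ih hb
      refine Submodule.span_induction ?_ ?_ ?_ ?_ ha
      · rintro _ ⟨i, hi, rfl⟩
        refine ⟨X i * F, ?_, hFs.X_mul hi, by simp⟩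
        rw [add_comm]
        exact (isHomogeneous_X P i).mul hF
      · exact ⟨0, isHomogeneous_zero _ _ _, fun _ _ _ _ => by simp, by simp⟩
      · rintro x y _ _ ⟨A, hA, hA', hAe⟩ ⟨B, hB, hB', hBe⟩
        exact ⟨A + B, hA.add hB, hA'.add hB', by rw [map_add, hAe, hBe, add_mul]⟩
      · rintro x y _ ⟨A, hA, hA', hAe⟩
        refine ⟨C x * A, ?_, hA'.C_mul x, by simp [hAe, mul_assoc]⟩
        simpa using (isHomogeneous_C σ x).mul hA
    · rintro x y ⟨A, hA, hA', rfl⟩ ⟨B, hB, hB', rfl⟩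
      exact ⟨A + B, hA.add hB, hA'.add hB', by simp⟩

lemma mem_mul_pow_span (f : σ → P) (s : Set σ) (𝔞 : Ideal P) (j : ℕ) {z : P}
    (hz : z ∈ 𝔞 * Ideal.span (f '' s) ^ j) :
    ∃ F : MvPolynomial σ P, F.IsHomogeneous j ∧ InVars s F ∧ (∀ β, coeff β F ∈ 𝔞) ∧
      eval f F = z := by
  refine Submodule.mul_induction_on hz (fun a ha b hb => ?_) ?_
  · obtain ⟨F, hF, hFs, rfl⟩ := mem_pow_span f s j hb
    refine ⟨C a * F, ?_, hFs.C_mul a, fun β => ?_, by simp⟩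
    · simpa using (isHomogeneous_C σ a).mul hF
    · rw [coeff_C_mul]
      exact 𝔞.mul_mem_right _ ha
  · rintro x y ⟨A, hA, hA', hA'', rfl⟩ ⟨B, hB, hB', hB'', rfl⟩
    refine ⟨A + B, hA.add hB, hA'.add hB', fun β => ?_, by simp⟩
    rw [coeff_add]
    exact 𝔞.add_mem (hA'' β) (hB'' β)

lemma eval_mem_mul_pow (f : σ → P) (s : Set σ) (𝔞 : Ideal P) (j : ℕ) {F : MvPolynomial σ P}
    (hF : F.IsHomogeneous j) (hs : InVars s F) (hc : ∀ β, coeff β F ∈ 𝔞) :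
    eval f F ∈ 𝔞 * Ideal.span (f '' s) ^ j := by
  rw [eval_eq]
  refine Ideal.sum_mem _ fun β hβ => Ideal.mul_mem_mul (hc β) ?_
  have hβ' : coeff β F ≠ 0 := by simpa using hβ
  have hd : ∑ i ∈ β.support, β i = j := by
    have := hF hβ'
    simpa [Finsupp.weight_apply, Finsupp.sum] using this
  rw [← hd, ← Finset.prod_pow_eq_pow_sum]
  refine Ideal.prod_mem_prod fun i hi => Ideal.pow_mem_pow (Ideal.subset_span (Set.mem_image_of_mem f ?_)) _
  by_contra h
  exact hβ' (hs β i h (by simpa using hi))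

variable {c : ℕ} (f : Fin c → P)

lemma quasiRegular_aux (hreg : ∀ i : Fin c, ∀ z, f i * z ∈ Ideal.span (f '' {l | l < i}) →
      z ∈ Ideal.span (f '' {l | l < i})) (t : ℕ) :
    ∀ (j : ℕ) (F : MvPolynomial (Fin c) P), F.IsHomogeneous j → InVars {l | l.val < t} F →
      eval f F = 0 → ∀ β, coeff β F ∈ Ideal.span (f '' {l | l.val < t}) := by
  induction t with
  | zero =>
    intro j F _ hs hF β
    have : F = C (coeff 0 F) := by
      ext β
      classical
      rw [coeff_C]
      split_ifs with h
      · rw [h]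
      · obtain ⟨i, hi⟩ : ∃ i, β i ≠ 0 := by
          by_contra! h'
          exact h (Finsupp.ext fun i => by simp [h'])
        exact hs β i (by simp) hi
    rw [this, eval_C] at hF
    rw [this, hF]
    simp
  | succ t ih =>
    by_cases htc : c ≤ t
    · have : {l : Fin c | l.val < t + 1} = {l | l.val < t} := by
        ext l
        have := l.2
        simp only [Set.mem_ofPred_eq]
        omega
      rw [this]
      exact ih
    push Not at htc
    set i : Fin c := ⟨t, htc⟩ with hi
    set I' := Ideal.span (f '' {l : Fin c | l.val < t}) with hI'
    set I := Ideal.span (f '' {l : Fin c | l.val < t + 1}) with hI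
    have hII : I' ≤ I := Ideal.span_mono (Set.image_mono fun l (hl : l.val < t) => by
      change l.val < t + 1
      omega)
    have hfi : f i ∈ I := Ideal.subset_span ⟨i, by simp [hi], rfl⟩
    have hri : ∀ z, f i * z ∈ I' → z ∈ I' := hreg i
    have hpow : ∀ j z, f i * z ∈ I' ^ j → z ∈ I' ^ j := by
      intro j
      induction j with
      | zero => simp
      | succ j ihj =>
        intro z hz
        obtain ⟨G, hG, hGs, rfl⟩ := mem_pow_span f _ j (ihj z (Ideal.pow_le_pow_right (by omega) hz))
        have hz' : f i * eval f G ∈ I' * I' ^ j := by rwa [← pow_succ']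
        obtain ⟨H, hH, hHs, hHc, hHe⟩ := mem_mul_pow_span f _ _ j hz'
        have key := ih j (C (f i) * G - H)
          (by simpa using ((isHomogeneous_C _ (f i)).mul hG).sub (by simpa using hH))
          (fun β l hl hβ => by
            rw [coeff_sub, hGs.C_mul (f i) β l hl hβ, hHs β l hl hβ, sub_zero])
          (by rw [map_sub, hHe]; simp)
        rw [pow_succ']
        refine eval_mem_mul_pow f _ _ j hG hGs fun β => hri _ ?_
        have := I'.add_mem (key β) (hHc β)
        rwa [coeff_sub, sub_add_cancel, coeff_C_mul] at this
    intro j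
    induction j with
    | zero =>
      intro F hF _ hF0 β
      have : F = C (coeff 0 F) := totalDegree_eq_zero_iff_eq_C.mp
        (Nat.le_zero.mp hF.totalDegree_le)
      rw [this, eval_C] at hF0
      rw [this, hF0]
      simp
    | succ j ihj =>
      intro F hF hs hF0 β
      set H := F.divMonomial (Finsupp.single i 1) with hHdef
      set G := F.modMonomial (Finsupp.single i 1) with hGdef
      have hFGH : X i * H + G = F := divMonomial_add_modMonomial_single F i
      have hHhom : H.IsHomogeneous j := by
        intro d hd
        rw [hHdef, coeff_divMonomial] at hd
        have := hF hd
        rw [map_add, Finsupp.weight_single] at this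
        simp only [Pi.one_apply, smul_eq_mul, mul_one] at this
        omega
      have hGc : ∀ β, coeff β G = if β i = 0 then coeff β F else 0 := by
        intro β
        split_ifs with h
        · exact coeff_modMonomial_of_not_le _ fun hle => by
            have := hle i
            simp [h] at this
        · refine coeff_modMonomial_of_le _ ?_
          rw [Finsupp.single_le_iff]
          omega
      have hGhom : G.IsHomogeneous (j + 1) := by
        intro d hd
        rw [hGc] at hd
        split_ifs at hd with h
        · exact hF hd
        · exact absurd rfl hd
      have hGs : InVars {l : Fin c | l.val < t} G := by
        intro β l hl hβ
        rw [hGc]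
        split_ifs with h
        · refine hs β l ?_ hβ
          intro hl'
          simp only [Set.mem_ofPred_eq] at hl hl'
          have : l = i := Fin.ext (by simp [hi]; omega)
          exact hβ (this ▸ h)
        · rfl
      have hHs : InVars {l : Fin c | l.val < t + 1} H := by
        intro β l hl hβ
        rw [hHdef, coeff_divMonomial]
        refine hs _ l hl ?_
        simp [hβ]
      have hHe : f i * eval f H = - eval f G := by
        have := congrArg (eval f) hFGH
        rw [map_add, map_mul, eval_X, hF0] at this
        linear_combination this
      have hGe : eval f G ∈ I' ^ (j + 1) := by
        have := eval_mem_mul_pow f _ ⊤ (j + 1) hGhom hGs (fun _ => trivial)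
        rwa [Ideal.top_mul] at this
      have hHp : eval f H ∈ I' ^ (j + 1) := hpow _ _ (by rw [hHe]; exact neg_mem hGe)
      have hHp' : eval f H ∈ I * I ^ j := by
        rw [← pow_succ']
        exact Ideal.pow_right_mono hII _ hHp
      have hHcoef : ∀ β, coeff β H ∈ I := by
        intro β
        obtain ⟨H', hH', hH's, hH'c, hH'e⟩ := mem_mul_pow_span f _ _ j hHp'
        have := ihj (H - H') (hHhom.sub hH')
          (fun β l hl hβ => by rw [coeff_sub, hHs β l hl hβ, hH's β l hl hβ, sub_zero])
          (by rw [map_sub, hH'e, sub_self]) β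
        have := I.add_mem this (hH'c β)
        rwa [coeff_sub, sub_add_cancel] at this
      obtain ⟨h, hh, hhs, hhe⟩ := mem_pow_span f _ (j + 1) hHp
      have hGcoef : ∀ β, coeff β G ∈ I := by
        intro β
        have := hII (ih (j + 1) (G + C (f i) * h)
          (hGhom.add (by simpa using (isHomogeneous_C _ (f i)).mul hh))
          (hGs.add (hhs.C_mul _)) (by rw [map_add, map_mul, eval_C, hhe, hHe]; ring) β)
        rw [coeff_add, coeff_C_mul] at this
        exact (I.add_mem_iff_left (I.mul_mem_right _ hfi)).mp this
      rw [← hFGH, coeff_add]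
      refine I.add_mem ?_ (hGcoef β)
      rw [coeff_X_mul']
      split_ifs
      · exact hHcoef _
      · exact I.zero_mem

/-- Weakly regular sequences are quasi-regular. -/
theorem quasiRegular (hreg : RingTheory.Sequence.IsWeaklyRegular P (List.ofFn f)) (j : ℕ)
    (F : MvPolynomial (Fin c) P) (hF : F.IsHomogeneous j)
    (h : eval f F ∈ Ideal.span (Set.range f) ^ (j + 1)) (β : Fin c →₀ ℕ) :
    coeff β F ∈ Ideal.span (Set.range f) := by
  have hreg' : ∀ i : Fin c, ∀ z, f i * z ∈ Ideal.span (f '' {l | l < i}) →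
      z ∈ Ideal.span (f '' {l | l < i}) := by
    intro i z hz
    have hi := hreg.regular_mod_prev i (by simp)
    have hset : Ideal.ofList (List.take i (List.ofFn f)) = Ideal.span (f '' {l | l < i}) := by
      rw [Ideal.ofList]
      congr 1
      ext x
      simp only [List.mem_take_iff_getElem, List.length_ofFn, List.getElem_ofFn, Set.mem_ofPred_eq,
        Set.mem_image]
      constructor
      · rintro ⟨a, ha, rfl⟩
        exact ⟨⟨a, by omega⟩, Fin.lt_def.mpr (by simp only; omega), rfl⟩
      · rintro ⟨a, ha, rfl⟩
        exact ⟨a, by have := Fin.lt_def.mp ha; omega, rfl⟩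
    rw [hset, isSMulRegular_quotient_iff_mem_of_smul_mem] at hi
    have e : (Ideal.span (f '' {l | l < i}) • (⊤ : Submodule P P)) =
      Ideal.span (f '' {l | l < i}) := by simp
    rw [e] at hi
    exact hi z (by simpa using hz)
  have hall : {l : Fin c | l.val < c} = Set.univ := by ext l; simp
  have key := quasiRegular_aux f hreg' c
  rw [hall, Set.image_univ] at key
  rw [pow_succ', ← Set.image_univ] at h
  obtain ⟨H, hH, hHs, hHc, hHe⟩ := mem_mul_pow_span f _ _ j h
  rw [Set.image_univ] at hHc
  have := Ideal.add_mem _ (key j (F - H) (hF.sub hH) (fun _ _ h => absurd trivial h)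
    (by rw [map_sub, hHe, sub_self]) β) (hHc β)
  rwa [coeff_sub, sub_add_cancel] at this

end QuasiRegular

section Loc

variable {P K : Type} [CommRing P] [IsDomain P] [Field K] [Algebra P K] [IsFractionRing P K]

/-- The elements of `K` of the form `p / g ^ N` with `p ∈ 𝔞`. -/
def loc (K : Type) [Field K] [Algebra P K] (𝔞 : Ideal P) (g : P) : Submodule P K where
  carrier := {z | ∃ N : ℕ, ∃ p ∈ 𝔞, algebraMap P K (g ^ N) * z = algebraMap P K p}
  zero_mem' := ⟨0, 0, 𝔞.zero_mem, by simp⟩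
  add_mem' := by
    rintro x y ⟨N, p, hp, hx⟩ ⟨M, q, hq, hy⟩
    refine ⟨N + M, g ^ M * p + g ^ N * q,
      𝔞.add_mem (𝔞.mul_mem_left _ hp) (𝔞.mul_mem_left _ hq), ?_⟩
    rw [map_add, map_mul, map_mul, ← hx, ← hy, pow_add, map_mul]
    ring
  smul_mem' := by
    rintro c x ⟨N, p, hp, hx⟩
    refine ⟨N, c * p, 𝔞.mul_mem_left _ hp, ?_⟩
    rw [Algebra.smul_def, map_mul, ← hx]
    ring

lemma mem_loc {𝔞 : Ideal P} {g : P} {z : K} :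
    z ∈ loc K 𝔞 g ↔ ∃ N : ℕ, ∃ p ∈ 𝔞, algebraMap P K (g ^ N) * z = algebraMap P K p := Iff.rfl

lemma loc_mono {𝔞 𝔟 : Ideal P} (h : 𝔞 ≤ 𝔟) (g : P) : loc K 𝔞 g ≤ loc K 𝔟 g := by
  rintro z ⟨N, p, hp, hz⟩
  exact ⟨N, p, h hp, hz⟩

lemma loc_dvd (𝔞 : Ideal P) {g h : P} (hd : g ∣ h) : loc K 𝔞 g ≤ loc K 𝔞 h := by
  rintro z ⟨N, p, hp, hz⟩
  obtain ⟨t, rfl⟩ := hd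
  refine ⟨N, t ^ N * p, 𝔞.mul_mem_left _ hp, ?_⟩
  rw [map_mul, ← hz, mul_pow, map_mul]
  ring

lemma mul_mem_loc {𝔞 𝔟 : Ideal P} {g : P} {x y : K} (hx : x ∈ loc K 𝔞 g) (hy : y ∈ loc K 𝔟 g) :
    x * y ∈ loc K (𝔞 * 𝔟) g := by
  obtain ⟨N, p, hp, hx⟩ := hx
  obtain ⟨M, q, hq, hy⟩ := hy
  refine ⟨N + M, p * q, Ideal.mul_mem_mul hp hq, ?_⟩
  rw [map_mul, ← hx, ← hy, pow_add, map_mul]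
  ring

lemma algebraMap_mem_loc {𝔞 : Ideal P} {p : P} (hp : p ∈ 𝔞) (g : P) :
    algebraMap P K p ∈ loc K 𝔞 g := ⟨0, p, hp, by simp⟩

lemma one_mem_loc (g : P) : (1 : K) ∈ loc K ⊤ g := by
  simpa using algebraMap_mem_loc (K := K) (𝔞 := ⊤) (p := 1) trivial g

lemma mul_left_mem_loc {𝔞 : Ideal P} {g : P} {x y : K} (hx : x ∈ loc K ⊤ g)
    (hy : y ∈ loc K 𝔞 g) : x * y ∈ loc K 𝔞 g := by
  simpa using mul_mem_loc hx hy

lemma mul_right_mem_loc {𝔞 : Ideal P} {g : P} {x y : K} (hx : x ∈ loc K 𝔞 g)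
    (hy : y ∈ loc K ⊤ g) : x * y ∈ loc K 𝔞 g := by
  simpa using mul_mem_loc hx hy

lemma algebraMap_ne {g : P} (hg : g ≠ 0) : algebraMap P K g ≠ 0 := by
  simpa using hg

lemma inv_mem_loc {g : P} (hg : g ≠ 0) : (algebraMap P K g)⁻¹ ∈ loc K ⊤ g :=
  ⟨1, 1, trivial, by simp [algebraMap_ne hg]⟩

lemma inv_mem_loc_of_dvd {g h : P} (hg : g ≠ 0) (hd : g ∣ h) :
    (algebraMap P K g)⁻¹ ∈ loc K ⊤ h := loc_dvd _ hd (inv_mem_loc hg)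

lemma exists_pow_smul_mem_loc {𝔞 : Ideal P} {g h : P} {z : K} (hz : z ∈ loc K 𝔞 (g * h)) :
    ∃ N : ℕ, ∀ n ≥ N, algebraMap P K (h ^ n) * z ∈ loc K 𝔞 g := by
  obtain ⟨N, p, hp, hz⟩ := hz
  refine ⟨N, fun n hn => ⟨N, h ^ (n - N) * p, 𝔞.mul_mem_left _ hp, ?_⟩⟩
  obtain ⟨m, rfl⟩ := Nat.exists_eq_add_of_le hn
  rw [Nat.add_sub_cancel_left, map_mul, ← hz, mul_pow, pow_add]
  simp only [map_mul]
  ring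

lemma mem_of_algebraMap_mem_loc {𝔞 : Ideal P} {g p : P} (h : algebraMap P K p ∈ loc K 𝔞 g) :
    ∃ N : ℕ, g ^ N * p ∈ 𝔞 := by
  obtain ⟨N, q, hq, h⟩ := h
  rw [← map_mul] at h
  exact ⟨N, by rwa [IsFractionRing.injective P K h]⟩

lemma exists_common_den {g : P} {T : Type*} (S : Finset T) {𝔞 : Ideal P}
    (z : T → K) (hz : ∀ t, z t ∈ loc K 𝔞 g) :
    ∃ N : ℕ, ∃ p : T → P, (∀ t ∈ S, p t ∈ 𝔞) ∧
      ∀ t ∈ S, algebraMap P K (g ^ N) * z t = algebraMap P K (p t) := by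
  classical
  choose N p hp hz using fun t => mem_loc.1 (hz t)
  refine ⟨S.sup N, fun t => g ^ (S.sup N - N t) * p t, fun t _ => 𝔞.mul_mem_left _ (hp t),
    fun t ht => ?_⟩
  rw [map_mul, ← hz t, ← mul_assoc, ← map_mul, ← pow_add,
    Nat.sub_add_cancel (Finset.le_sup ht)]

variable {c : ℕ}

/-- The monomial `f ^ β`. -/
noncomputable def fm (f : Fin c → P) (β : Fin c →₀ ℕ) : P := ∏ i, f i ^ β i

/-- Exponents of total degree `s`. -/
abbrev expo (c s : ℕ) : Finset (Fin c →₀ ℕ) := Finset.finsuppAntidiag Finset.univ s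

lemma mem_expo {s : ℕ} {β : Fin c →₀ ℕ} : β ∈ expo c s ↔ β.degree = s := by
  simp [Finset.mem_finsuppAntidiag, Finsupp.degree_eq_sum]

lemma fm_mem (f : Fin c → P) (β : Fin c →₀ ℕ) {s : ℕ} (hβ : s ≤ β.degree) :
    fm f β ∈ Ideal.span (Set.range f) ^ s := by
  refine Ideal.pow_le_pow_right hβ ?_
  rw [Finsupp.degree_eq_sum, fm, ← Finset.prod_pow_eq_pow_sum]
  exact Ideal.prod_mem_prod fun i _ => Ideal.pow_mem_pow (Ideal.subset_span (Set.mem_range_self i)) _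

lemma eval_eq_sum_expo (f : Fin c → P) {s : ℕ} {F : MvPolynomial (Fin c) P}
    (hF : F.IsHomogeneous s) :
    MvPolynomial.eval f F = ∑ β ∈ expo c s, MvPolynomial.coeff β F * fm f β := by
  rw [MvPolynomial.eval_eq']
  refine Finset.sum_subset (fun β hβ => ?_) (fun β _ hβ => ?_)
  · rw [mem_expo]
    by_contra h
    exact MvPolynomial.mem_support_iff.1 hβ (hF.coeff_eq_zero h)
  · rw [MvPolynomial.notMem_support_iff.1 hβ, zero_mul]

lemma loc_expand (f : Fin c → P) {g : P} (hg : g ≠ 0) {s : ℕ} {𝔞 : Ideal P} {z : K}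
    (hz : z ∈ loc K (𝔞 * Ideal.span (Set.range f) ^ s) g) :
    ∃ w : (Fin c →₀ ℕ) → K, (∀ β, w β ∈ loc K 𝔞 g) ∧
      z = ∑ β ∈ expo c s, algebraMap P K (fm f β) * w β := by
  obtain ⟨N, p, hp, hz⟩ := hz
  rw [← Set.image_univ] at hp
  obtain ⟨F, hF, -, hc, rfl⟩ := mem_mul_pow_span f Set.univ 𝔞 s hp
  refine ⟨fun β => (algebraMap P K (g ^ N))⁻¹ * algebraMap P K (MvPolynomial.coeff β F),
    fun β => ⟨N, _, hc β, ?_⟩, ?_⟩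
  · rw [mul_inv_cancel_left₀ (algebraMap_ne (pow_ne_zero _ hg))]
  · refine mul_left_cancel₀ (algebraMap_ne (K := K) (pow_ne_zero N hg)) ?_
    rw [hz, eval_eq_sum_expo f hF, map_sum, Finset.mul_sum]
    refine Finset.sum_congr rfl fun β _ => ?_
    rw [mul_left_comm, mul_inv_cancel_left₀ (algebraMap_ne (pow_ne_zero _ hg)), map_mul, mul_comm]

lemma loc_qr (f : Fin c → P) (hreg : RingTheory.Sequence.IsWeaklyRegular P (List.ofFn f))
    {g : P} {s : ℕ} (w : (Fin c →₀ ℕ) → K) (hw : ∀ β, w β ∈ loc K ⊤ g)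
    (h : ∑ β ∈ expo c s, algebraMap P K (fm f β) * w β ∈
      loc K (Ideal.span (Set.range f) ^ (s + 1)) g) :
    ∀ β ∈ expo c s, w β ∈ loc K (Ideal.span (Set.range f)) g := by
  classical
  obtain ⟨N, p, -, hp⟩ := exists_common_den (expo c s) w hw
  obtain ⟨M, q, hq, h⟩ := h
  set F : MvPolynomial (Fin c) P := ∑ β ∈ expo c s, MvPolynomial.monomial β (g ^ M * p β)
  have hcoef : ∀ β ∈ expo c s, MvPolynomial.coeff β F = g ^ M * p β := fun β hβ => by
    simp only [F, MvPolynomial.coeff_sum, MvPolynomial.coeff_monomial]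
    rw [Finset.sum_ite_eq' , if_pos hβ]
  have hF : F.IsHomogeneous s := MvPolynomial.IsHomogeneous.sum _ _ _ fun β hβ =>
    MvPolynomial.isHomogeneous_monomial _ (mem_expo.1 hβ)
  have hev : MvPolynomial.eval f F = g ^ N * q := by
    apply IsFractionRing.injective P K
    rw [map_mul, ← h, eval_eq_sum_expo f hF, map_sum, Finset.mul_sum, Finset.mul_sum]
    refine Finset.sum_congr rfl fun β hβ => ?_
    rw [hcoef β hβ, map_mul, map_mul, ← hp β hβ]
    ring
  have := quasiRegular f hreg s F hF (hev ▸ Ideal.mul_mem_left _ _ hq)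
  intro β hβ
  refine ⟨M + N, _, hcoef β hβ ▸ this β, ?_⟩
  rw [map_mul, ← hp β hβ, pow_add, map_mul, mul_assoc]

end Loc

section ExtVanishing

open CategoryTheory Abelian

variable {S : Type} [CommRing S]

/-- `Ext^j(N, A) = 0` for `j < m`. -/
def EV (N : ModuleCat.{0} S) (m : ℕ) (A : Type) [AddCommGroup A] [Module S A] : Prop :=
  ∀ j < m, Subsingleton (Ext N (ModuleCat.of S A) j)

variable {N : ModuleCat.{0} S} {m : ℕ}
variable {A B C : Type} [AddCommGroup A] [Module S A] [AddCommGroup B] [Module S B]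
  [AddCommGroup C] [Module S C]

lemma EV.mono {m' : ℕ} (h : EV N m A) (hm : m' ≤ m) : EV N m' A :=
  fun j hj => h j (hj.trans_le hm)

lemma EV.ofEquiv (h : EV N m A) (e : A ≃ₗ[S] B) : EV N m B := by
  intro j hj
  have := h j hj
  refine subsingleton_of_forall_eq 0 fun x => ?_
  have h1 : x = (x.comp (Ext.mk₀ e.toModuleIso.inv) (add_zero j)).comp
      (Ext.mk₀ e.toModuleIso.hom) (add_zero j) := by
    rw [Ext.comp_assoc_of_second_deg_zero, Ext.mk₀_comp_mk₀, Iso.inv_hom_id, Ext.comp_mk₀_id]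
  rw [h1, Subsingleton.elim (x.comp (Ext.mk₀ e.toModuleIso.inv) (add_zero j)) 0, Ext.zero_comp]

/-- The short complex attached to an exact pair of linear maps. -/
lemma shortExact_of (f : A →ₗ[S] B) (g : B →ₗ[S] C) (hf : Function.Injective f)
    (hg : Function.Surjective g) (hfg : Function.Exact f g) :
    (ShortComplex.mk (ModuleCat.ofHom f) (ModuleCat.ofHom g) (by
      ext x; exact hfg.apply_apply_eq_zero x)).ShortExact where
  exact := by
    rw [ShortComplex.ShortExact.moduleCat_exact_iff_function_exact]
    exact hfg
  mono_f := (ModuleCat.mono_iff_injective _).2 hf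
  epi_g := (ModuleCat.epi_iff_surjective _).2 hg

lemma EV.quot (f : A →ₗ[S] B) (g : B →ₗ[S] C) (hf : Function.Injective f)
    (hg : Function.Surjective g) (hfg : Function.Exact f g) (hA : EV N (m + 1) A)
    (hB : EV N m B) : EV N m C := by
  intro j hj
  have h1 := hA (j + 1) (by omega)
  have h2 := hB j hj
  refine subsingleton_of_forall_eq 0 fun x => ?_
  obtain ⟨y, rfl⟩ := Ext.covariant_sequence_exact₃ _ (shortExact_of f g hf hg hfg) x rfl
    (@Subsingleton.elim _ h1 _ _)
  rw [@Subsingleton.elim _ h2 y 0, Ext.zero_comp]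

lemma EV.ofSMulRegular {p : S} (hp : p ∈ Module.annihilator S N) (hreg : IsSMulRegular A p)
    (h : EV N m (QuotSMulTop p A)) : EV N (m + 1) A := by
  intro i hi
  match i with
  | 0 =>
    have : Subsingleton (N →ₗ[S] A) := by
      refine subsingleton_of_forall_eq 0 fun φ => LinearMap.ext fun x => hreg ?_
      simp only [← map_smul, Module.mem_annihilator.1 hp x, map_zero, LinearMap.zero_apply,
        smul_zero]
    exact (Ext.addEquiv₀.trans ModuleCat.homAddEquiv).subsingleton
  | i + 1 =>
    have mono_g := (Ext.covariant_sequence_exact₁' N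
      (IsSMulRegular.smulShortComplex_shortExact (r := p) (M := ModuleCat.of S A) hreg) i (i + 1) rfl).mono_g
      ((AddCommGrpCat.isZero_of_iff_subsingleton.mpr (h i (by omega))).eq_zero_of_src _)
    have zero_g := Ext.postcomp_smul_id_eq_zero_of_mem_annihilator (M := ModuleCat.of S A) hp (i + 1)
    have mono_g' : Mono (AddCommGrpCat.ofHom ((Ext.mk₀ (p • 𝟙 (ModuleCat.of S A))).postcomp N
        (add_zero (i + 1)))) := by
      simp only [ModuleCat.smulShortComplex_f_eq_smul_id] at mono_g
      exact mono_g
    exact AddCommGrpCat.subsingleton_of_isZero (Limits.IsZero.of_mono_eq_zero _ zero_g)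

lemma EV.ofWeaklyRegular (rs : List S) (hrs : ∀ r ∈ rs, r ∈ Module.annihilator S N)
    (hreg : RingTheory.Sequence.IsWeaklyRegular A rs) : EV N rs.length A := by
  induction rs generalizing A with
  | nil => intro j hj; simp at hj
  | cons r rs ih =>
    rw [RingTheory.Sequence.isWeaklyRegular_cons_iff] at hreg
    exact EV.ofSMulRegular (hrs r (by simp)) hreg.1 (ih (fun x hx => hrs x (by simp [hx])) hreg.2)

lemma EV.acyclic {T : Type*} [Fintype T] (p : T → S) (hp : ∀ t, p t ∈ Module.annihilator S N)
    (θ : T → A →ₗ[S] A) (hθ : ∀ x, ∑ t, p t • θ t x = x) (m : ℕ) : EV N m A := by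
  intro j _
  refine subsingleton_of_forall_eq 0 fun x => ?_
  have h1 : (𝟙 (ModuleCat.of S A)) = ∑ t, p t • ModuleCat.ofHom (θ t) := by
    ext a
    simp only [ModuleCat.hom_id, LinearMap.id_coe, id_eq, ModuleCat.hom_sum, LinearMap.coe_sum,
      Finset.sum_apply, ModuleCat.hom_smul, LinearMap.smul_apply, ModuleCat.hom_ofHom]
    exact (hθ a).symm
  rw [← Ext.comp_mk₀_id x, h1, Ext.mk₀_sum, Ext.comp_sum]
  refine Finset.sum_eq_zero fun t _ => ?_
  have h2 : (p t • 𝟙 N) = 0 := by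
    simp [← ModuleCat.lsmul_eq_smul_id, Module.mem_annihilator_iff_lsmul_eq_zero.mp (hp t)]
  rw [Ext.mk₀_smul, Ext.comp_smul, ← Ext.smul_comp]
  have h3 : p t • x = (Ext.mk₀ (p t • 𝟙 N)).comp x (zero_add j) := by simp [Ext.mk₀_smul]
  rw [h3, h2, Ext.mk₀_zero, Ext.zero_comp, Ext.zero_comp]

lemma EV.eq_zero {𝔪 : Ideal S} (h : EV (ModuleCat.of S (S ⧸ 𝔪)) 1 A) {x : A}
    (hx : ∀ p ∈ 𝔪, p • x = 0) : x = 0 := by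
  have h0 := h 0 (by simp)
  have : Subsingleton ((S ⧸ 𝔪) →ₗ[S] A) :=
    (Ext.addEquiv₀.trans (ModuleCat.homAddEquiv (M := ModuleCat.of S (S ⧸ 𝔪))
      (N := ModuleCat.of S A))).symm.subsingleton
  have h1 : Submodule.liftQ 𝔪 (LinearMap.toSpanSingleton S A x) (fun p hp => by
    simpa using hx p hp) = 0 := Subsingleton.elim _ _
  have h2 := LinearMap.congr_fun h1 (Submodule.Quotient.mk 1)
  rw [Submodule.liftQ_apply] at h2
  simpa using h2

lemma EV.eq_zero_of_pow {𝔪 : Ideal S} (h : EV (ModuleCat.of S (S ⧸ 𝔪)) 1 A) {x : A} (n : ℕ)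
    (hx : ∀ p ∈ 𝔪 ^ n, p • x = 0) : x = 0 := by
  induction n with
  | zero => simpa using hx 1 (by simp)
  | succ n ih =>
    refine ih fun p hp => h.eq_zero fun q hq => ?_
    rw [← mul_smul]
    exact hx _ (by rw [pow_succ']; exact Ideal.mul_mem_mul hq hp)

lemma EV.eq_zero_of_torsion {𝔪 : Ideal S} (hfg : 𝔪.FG) (h : EV (ModuleCat.of S (S ⧸ 𝔪)) 1 A)
    {x : A} (hx : ∀ p ∈ 𝔪, ∃ n : ℕ, p ^ n • x = 0) : x = 0 := by
  have h1 : 𝔪 ≤ (Ideal.torsionOf S A x).radical := fun p hp => by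
    obtain ⟨n, hn⟩ := hx p hp
    exact ⟨n, by simpa [Ideal.mem_torsionOf_iff] using hn⟩
  obtain ⟨n, hn⟩ := Ideal.exists_pow_le_of_le_radical_of_fg h1 hfg
  exact h.eq_zero_of_pow n fun p hp => by simpa using hn hp

lemma EV.ofHom {𝔪 : Ideal S} (h0 : ∀ x : A, (∀ p ∈ 𝔪, p • x = 0) → x = 0)
    (h1 : ∀ θ : 𝔪 →ₗ[S] A, ∃ x : A, ∀ p, θ p = (p : S) • x) :
    EV (ModuleCat.of S (S ⧸ 𝔪)) 2 A := by
  have hS := shortExact_of 𝔪.subtype 𝔪.mkQ 𝔪.subtype_injective 𝔪.mkQ_surjective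
    (LinearMap.exact_subtype_mkQ 𝔪)
  intro j hj
  interval_cases j
  · have : Subsingleton ((S ⧸ 𝔪) →ₗ[S] A) := by
      refine subsingleton_of_forall_eq 0 fun φ => LinearMap.ext fun x => h0 _ fun p hp => ?_
      obtain ⟨y, rfl⟩ := 𝔪.mkQ_surjective x
      rw [← map_smul, ← map_smul]
      have : 𝔪.mkQ (p • y) = 0 := by
        rw [Submodule.mkQ_apply, Submodule.Quotient.mk_eq_zero]
        exact 𝔪.mul_mem_right _ hp
      rw [this, map_zero]
    exact (Ext.addEquiv₀.trans ModuleCat.homAddEquiv).subsingleton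
  · refine subsingleton_of_forall_eq 0 fun x => ?_
    have hproj : Projective (ModuleCat.of S S) := inferInstance
    obtain ⟨y, hy⟩ := Ext.contravariant_sequence_exact₃ hS (ModuleCat.of S A) x
      (have := hproj; Ext.eq_zero_of_projective _) (n₀ := 0) rfl
    obtain ⟨φ, rfl⟩ := Ext.addEquiv₀.symm.surjective y
    obtain ⟨a, ha⟩ := h1 φ.hom
    have hφ : φ = ModuleCat.ofHom 𝔪.subtype ≫ ModuleCat.ofHom (LinearMap.toSpanSingleton S A a) := by
      ext p
      exact ha p
    rw [← hy]
    change hS.extClass.comp (Ext.mk₀ φ) rfl = 0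
    rw [hφ, ← Ext.mk₀_comp_mk₀, ← Ext.comp_assoc_of_third_deg_zero]
    erw [hS.extClass_comp]
    rw [Ext.zero_comp]

end ExtVanishing

section Step

open CategoryTheory Abelian

variable {S : Type} [CommRing S] {E E' : Type} [AddCommGroup E] [Module S E]
  [AddCommGroup E'] [Module S E']

/-- The subquotient `T / N` (meaningful when `N ≤ T`). -/
abbrev SQ (T N : Submodule S E) : Type := T ⧸ N.submoduleOf T

lemma sq_mk_eq_zero {T N : Submodule S E} (x : T) :
    (Submodule.Quotient.mk x : SQ T N) = 0 ↔ (x : E) ∈ N := by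
  rw [Submodule.Quotient.mk_eq_zero]
  rfl

/-- The map of subquotients induced by a linear map. -/
def sqMap (d : E →ₗ[S] E') {T N : Submodule S E} {T' N' : Submodule S E'}
    (hT : ∀ x ∈ T, d x ∈ T') (hN : ∀ x ∈ N, d x ∈ N') : SQ T N →ₗ[S] SQ T' N' :=
  Submodule.mapQ _ _ (d.restrict hT) (fun _ hx => hN _ hx)

lemma sqMap_mk (d : E →ₗ[S] E') {T N : Submodule S E} {T' N' : Submodule S E'}
    (hT : ∀ x ∈ T, d x ∈ T') (hN : ∀ x ∈ N, d x ∈ N') (x : T) :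
    sqMap d hT hN (Submodule.Quotient.mk x) = Submodule.Quotient.mk ⟨d x, hT _ x.2⟩ := rfl

/-- One step in the comparison of the Čech complex with local cohomology. -/
theorem ext_step {𝔪 : Ideal S} (hfg : 𝔪.FG) (d : E →ₗ[S] E') {N B T : Submodule S E}
    {N' : Submodule S E'} (hNB : N ≤ B) (hBT : B ≤ T)  (hB : ∀ x ∈ B, d x ∈ N') {m : ℕ}
    (hac : ∀ m, EV (ModuleCat.of S (S ⧸ 𝔪)) m (SQ T N))
    (hEB : EV (ModuleCat.of S (S ⧸ 𝔪)) (m + 2) (SQ B N))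
    (htor : ∀ x ∈ T, d x ∈ N' → ∀ p ∈ 𝔪, ∃ n : ℕ, p ^ n • x ∈ B) :
    (∀ x ∈ T, d x ∈ N' → x ∈ B) ∧
      EV (ModuleCat.of S (S ⧸ 𝔪)) (m + 1) (SQ (T.map d ⊔ N') N') := by
  have hTB : EV (ModuleCat.of S (S ⧸ 𝔪)) (m + 1) (SQ T B) := by
    refine EV.quot (sqMap LinearMap.id (T := B) (N := N) hBT (fun x hx => hx))
      (sqMap LinearMap.id (T := T) (N := N) (fun x hx => hx) hNB) ?_ ?_ ?_ hEB (hac _)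
    · rw [injective_iff_map_eq_zero]
      intro a ha
      obtain ⟨x, rfl⟩ := Submodule.Quotient.mk_surjective _ a
      rw [sqMap_mk, sq_mk_eq_zero] at ha
      rw [sq_mk_eq_zero]
      exact ha
    · intro a
      obtain ⟨x, rfl⟩ := Submodule.Quotient.mk_surjective _ a
      exact ⟨Submodule.Quotient.mk x, rfl⟩
    · intro a
      obtain ⟨x, rfl⟩ := Submodule.Quotient.mk_surjective _ a
      rw [sqMap_mk, sq_mk_eq_zero]
      constructor
      · intro hx
        exact ⟨Submodule.Quotient.mk ⟨x, hx⟩, rfl⟩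
      · rintro ⟨b, hb⟩
        obtain ⟨y, rfl⟩ := Submodule.Quotient.mk_surjective _ b
        rw [sqMap_mk, Submodule.Quotient.eq] at hb
        have h1 : (y : E) - x ∈ N := hb
        have h2 := B.sub_mem y.2 (hNB h1)
        simpa using h2
  have hker : ∀ x ∈ T, d x ∈ N' → x ∈ B := by
    intro x hx hdx
    refine (sq_mk_eq_zero (T := T) (N := B) ⟨x, hx⟩).1 ?_
    refine (hTB.mono (by omega)).eq_zero_of_torsion hfg fun p hp => ?_
    obtain ⟨n, hn⟩ := htor x hx hdx p hp
    refine ⟨n, ?_⟩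
    rw [← Submodule.Quotient.mk_smul, sq_mk_eq_zero]
    exact hn
  refine ⟨hker, hTB.ofEquiv (LinearEquiv.ofBijective (sqMap d
    (fun x hx => Submodule.mem_sup_left (Submodule.mem_map_of_mem hx)) hB) ⟨?_, ?_⟩)⟩
  · rw [injective_iff_map_eq_zero]
    intro a ha
    obtain ⟨x, rfl⟩ := Submodule.Quotient.mk_surjective _ a
    rw [sqMap_mk, sq_mk_eq_zero] at ha
    rw [sq_mk_eq_zero]
    exact hker _ x.2 ha
  · intro a
    obtain ⟨⟨x, hx⟩, rfl⟩ := Submodule.Quotient.mk_surjective _ a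
    obtain ⟨_, ⟨y, hy, rfl⟩, z, hz, rfl⟩ := Submodule.mem_sup.1 hx
    refine ⟨Submodule.Quotient.mk ⟨y, hy⟩, ?_⟩
    rw [sqMap_mk, Submodule.Quotient.eq]
    change d y - (d y + z) ∈ N'
    simpa using hz

end Step

section Mat

variable {P K : Type} [CommRing P] [IsDomain P] [Field K] [Algebra P K] [IsFractionRing P K]
variable {m n l : Type*} [Fintype m] [Fintype n] [Fintype l]

/-- Matrices with entries in `loc K 𝔞 g`. -/
def ml (K : Type) [Field K] [Algebra P K] (m n : Type*) (𝔞 : Ideal P) (g : P) :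
    Submodule P (Matrix m n K) := (loc K 𝔞 g).matrix

lemma ml_mono {𝔞 𝔟 : Ideal P} (h : 𝔞 ≤ 𝔟) (g : P) : ml K m n 𝔞 g ≤ ml K m n 𝔟 g :=
  fun _ hA i j => loc_mono h g (hA i j)

lemma ml_dvd (𝔞 : Ideal P) {g h : P} (hd : g ∣ h) : ml K m n 𝔞 g ≤ ml K m n 𝔞 h :=
  fun _ hA i j => loc_dvd 𝔞 hd (hA i j)

lemma ml_mul' {𝔞 𝔟 : Ideal P} {g : P} {A : Matrix m n K} {B : Matrix n l K}
    (hA : A ∈ ml K m n 𝔞 g) (hB : B ∈ ml K n l 𝔟 g) : A * B ∈ ml K m l (𝔞 * 𝔟) g := fun i j => by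
  rw [Matrix.mul_apply]
  exact Submodule.sum_mem _ fun t _ => mul_mem_loc (hA i t) (hB t j)

lemma ml_mul_left {𝔞 : Ideal P} {g h h' : P} {A : Matrix m n K} {B : Matrix n l K}
    (hA : A ∈ ml K m n ⊤ h) (hB : B ∈ ml K n l 𝔞 h') (hd : h ∣ g) (hd' : h' ∣ g) :
    A * B ∈ ml K m l 𝔞 g := by
  simpa using ml_mul' (ml_dvd _ hd hA) (ml_dvd _ hd' hB)

lemma ml_mul_right {𝔞 : Ideal P} {g h h' : P} {A : Matrix m n K} {B : Matrix n l K}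
    (hA : A ∈ ml K m n 𝔞 h) (hB : B ∈ ml K n l ⊤ h') (hd : h ∣ g) (hd' : h' ∣ g) :
    A * B ∈ ml K m l 𝔞 g := by
  simpa using ml_mul' (ml_dvd _ hd hA) (ml_dvd _ hd' hB)

lemma one_mem_ml [DecidableEq m] (g : P) : (1 : Matrix m m K) ∈ ml K m m ⊤ g := fun i j => by
  rw [Matrix.one_apply]
  split_ifs
  · exact one_mem_loc g
  · exact zero_mem _

lemma ml_smul_ideal {𝔞 𝔟 : Ideal P} {g p : P} (hp : p ∈ 𝔟) {A : Matrix m n K}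
    (hA : A ∈ ml K m n 𝔞 g) : p • A ∈ ml K m n (𝔟 * 𝔞) g := fun i j => by
  rw [Matrix.smul_apply, Algebra.smul_def]
  exact mul_mem_loc (algebraMap_mem_loc hp g) (hA i j)

variable {c : ℕ}

lemma ml_expand (f : Fin c → P) {g : P} (hg : g ≠ 0) {s : ℕ} {𝔞 : Ideal P} {A : Matrix m n K}
    (hA : A ∈ ml K m n (𝔞 * Ideal.span (Set.range f) ^ s) g) :
    ∃ w : (Fin c →₀ ℕ) → Matrix m n K, (∀ β, w β ∈ ml K m n 𝔞 g) ∧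
      A = ∑ β ∈ expo c s, fm f β • w β := by
  choose w hw hA using fun i j => loc_expand f hg (hA i j)
  refine ⟨fun β => Matrix.of fun i j => w i j β, fun β i j => hw i j β, ?_⟩
  ext i j
  rw [hA, Matrix.sum_apply]
  exact Finset.sum_congr rfl fun β _ => by simp [Algebra.smul_def]

lemma ml_qr (f : Fin c → P) (hreg : RingTheory.Sequence.IsWeaklyRegular P (List.ofFn f))
    {g : P} {s : ℕ} (w : (Fin c →₀ ℕ) → Matrix m n K) (hw : ∀ β, w β ∈ ml K m n ⊤ g)
    (h : ∑ β ∈ expo c s, fm f β • w β ∈ ml K m n (Ideal.span (Set.range f) ^ (s + 1)) g) :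
    ∀ β ∈ expo c s, w β ∈ ml K m n (Ideal.span (Set.range f)) g := by
  intro β hβ i j
  refine loc_qr f hreg (fun β => w β i j) (fun β => hw β i j) ?_ β hβ
  have := h i j
  rw [Matrix.sum_apply] at this
  simpa [Algebra.smul_def] using this

/-- Families of matrices with entries in `loc K 𝔞 (gT t)`. -/
def Dt {T : Type} (K : Type) [Field K] [Algebra P K] (p q : T → ℕ) (𝔞 : Ideal P) (gT : T → P) :
    Submodule P (∀ t, Matrix (Fin (p t)) (Fin (q t)) K) :=
  Submodule.pi Set.univ fun t => ml K (Fin (p t)) (Fin (q t)) 𝔞 (gT t)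

variable {T : Type} {p q : T → ℕ} {𝔞 : Ideal P} {gT : T → P}

lemma mem_Dt {x : ∀ t, Matrix (Fin (p t)) (Fin (q t)) K} :
    x ∈ Dt K p q 𝔞 gT ↔ ∀ t, x t ∈ ml K _ _ 𝔞 (gT t) := by
  simp [Dt, Submodule.mem_pi]

lemma Dt_mono {𝔟 : Ideal P} (h : 𝔞 ≤ 𝔟) : Dt K p q 𝔞 gT ≤ Dt K p q 𝔟 gT := fun _ hx =>
  mem_Dt.2 fun t => ml_mono h _ (mem_Dt.1 hx t)

lemma Dt_ideal_smul {a : P} (ha : a ∈ 𝔞) {x : ∀ t, Matrix (Fin (p t)) (Fin (q t)) K}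
    (hx : x ∈ Dt K p q ⊤ gT) : a • x ∈ Dt K p q 𝔞 gT := mem_Dt.2 fun t => by
  simpa using ml_smul_ideal ha (mem_Dt.1 hx t)

lemma Dt_descend [Fintype T] {h : P} {x : ∀ t, Matrix (Fin (p t)) (Fin (q t)) K}
    (hx : x ∈ Dt K p q 𝔞 fun t => gT t * h) :
    ∃ N : ℕ, ∀ n ≥ N, h ^ n • x ∈ Dt K p q 𝔞 gT := by
  choose N hN using fun t i j => exists_pow_smul_mem_loc (mem_Dt.1 hx t i j)
  refine ⟨∑ t, ∑ i, ∑ j, N t i j, fun n hn => mem_Dt.2 fun t i j => ?_⟩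
  have h1 : N t i j ≤ n := by
    refine le_trans ?_ hn
    refine le_trans ?_ (Finset.single_le_sum (f := fun t => ∑ i, ∑ j, N t i j)
      (fun _ _ => Nat.zero_le _) (Finset.mem_univ t))
    refine le_trans ?_ (Finset.single_le_sum (f := fun i => ∑ j, N t i j)
      (fun _ _ => Nat.zero_le _) (Finset.mem_univ i))
    exact Finset.single_le_sum (f := fun j => N t i j)
      (fun _ _ => Nat.zero_le _) (Finset.mem_univ j)
  have := hN t i j n h1
  rwa [← Algebra.smul_def] at this

lemma Dt_acyclic {ι : Type} [Fintype ι] [DecidableEq ι] (g : ι → P) (hg : ∀ a, g a ≠ 0)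
    {N : ModuleCat.{0} P} (hgN : ∀ a, g a ∈ Module.annihilator P N) (π : T → ι)
    (hπ : ∀ t, g (π t) ∣ gT t) (k : ℕ) :
    EV N k (SQ (Dt K p q ⊤ gT) (Dt K p q 𝔞 gT)) := by
  let θ : ι → (∀ t, Matrix (Fin (p t)) (Fin (q t)) K) →ₗ[P] ∀ t, Matrix (Fin (p t)) (Fin (q t)) K :=
    fun a => LinearMap.pi fun t =>
      (if π t = a then (LinearMap.lsmul K (Matrix (Fin (p t)) (Fin (q t)) K)
        (algebraMap P K (g a))⁻¹).restrictScalars P else 0) ∘ₗ LinearMap.proj t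
  have hθ : ∀ (𝔟 : Ideal P) a, ∀ x ∈ Dt K p q 𝔟 gT, θ a x ∈ Dt K p q 𝔟 gT := by
    intro 𝔟 a x hx
    refine mem_Dt.2 fun t => ?_
    simp only [θ, LinearMap.pi_apply, LinearMap.comp_apply, LinearMap.proj_apply]
    split_ifs with h
    · subst h
      exact fun i j => mul_left_mem_loc (inv_mem_loc_of_dvd (hg _) (hπ t)) (mem_Dt.1 hx t i j)
    · exact zero_mem _
  refine EV.acyclic g hgN (fun a => sqMap (θ a) (hθ ⊤ a) (hθ 𝔞 a)) (fun x => ?_) k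
  obtain ⟨x, rfl⟩ := Submodule.Quotient.mk_surjective _ x
  simp only [sqMap_mk, ← Submodule.Quotient.mk_smul]
  simp only [← Submodule.mkQ_apply, ← map_sum]
  congr 1
  ext t i j
  simp only [AddSubmonoidClass.coe_finsetSum, Submodule.coe_smul, Finset.sum_apply, Pi.smul_apply]
  have key : ∀ a (z : K), g a • ((algebraMap P K (g a))⁻¹ * z) = z := fun a z => by
    rw [Algebra.smul_def, mul_inv_cancel_left₀ (algebraMap_ne (hg a))]
  rw [Finset.sum_eq_single (π t)]
  · simp only [θ, LinearMap.pi_apply, LinearMap.comp_apply, LinearMap.proj_apply, if_true]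
    exact key _ _
  · intro a _ ha
    simp only [θ, LinearMap.pi_apply, LinearMap.comp_apply, if_neg ha.symm, LinearMap.zero_apply,
      smul_zero]
  · simp

end Mat

section Cech

variable {P K : Type} [CommRing P] [IsDomain P] [Field K] [Algebra P K] [IsFractionRing P K]
variable {ι : Type} [Fintype ι] [DecidableEq ι]

/-- `γ` is a matrix-valued cocycle modulo `𝔞` for the covering `g`. -/
structure IsCoc (g : ι → P) (r : ι → ℕ) (γ : ∀ a b, Matrix (Fin (r a)) (Fin (r b)) K)
    (𝔞 : Ideal P) : Prop where
  mem : ∀ a b, γ a b ∈ ml K _ _ ⊤ (g a * g b)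
  coc : ∀ a b c, γ a b * γ b c - γ a c ∈ ml K _ _ 𝔞 (g a * g b * g c)

variable {r s : ι → ℕ} (γ : ∀ a b, Matrix (Fin (r a)) (Fin (r b)) K)
  (δ : ∀ a b, Matrix (Fin (s a)) (Fin (s b)) K)

/-- Čech `0`-cochains. -/
abbrev C0 (K : Type) (s r : ι → ℕ) : Type := ∀ a : ι, Matrix (Fin (s a)) (Fin (r a)) K

/-- Čech `1`-cochains. -/
abbrev C1 (K : Type) (s r : ι → ℕ) : Type :=
  ∀ t : ι × ι, Matrix (Fin (s t.1)) (Fin (r t.2)) K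

/-- Čech `2`-cochains. -/
abbrev C2 (K : Type) (s r : ι → ℕ) : Type :=
  ∀ t : ι × ι × ι, Matrix (Fin (s t.1)) (Fin (r t.2.2)) K

/-- Čech `3`-cochains. -/
abbrev C3 (K : Type) (s r : ι → ℕ) : Type :=
  ∀ t : ι × ι × ι × ι, Matrix (Fin (s t.1)) (Fin (r t.2.2.2)) K

/-- The twisted Čech differential on `0`-cochains. -/
def d0 (P : Type) [CommRing P] [Algebra P K] (γ : ∀ a b, Matrix (Fin (r a)) (Fin (r b)) K)
    (δ : ∀ a b, Matrix (Fin (s a)) (Fin (s b)) K) : C0 K s r →ₗ[P] C1 K s r where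
  toFun κ t := δ t.1 t.2 * κ t.2 - κ t.1 * γ t.1 t.2
  map_add' x y := by ext1 t; simp only [Pi.add_apply, Matrix.mul_add, Matrix.add_mul]; abel
  map_smul' p x := by
    ext1 t; simp only [Pi.smul_apply, Matrix.mul_smul, Matrix.smul_mul, smul_sub, RingHom.id_apply]

/-- The twisted Čech differential on `1`-cochains. -/
def d1 (P : Type) [CommRing P] [Algebra P K] (γ : ∀ a b, Matrix (Fin (r a)) (Fin (r b)) K)
    (δ : ∀ a b, Matrix (Fin (s a)) (Fin (s b)) K) : C1 K s r →ₗ[P] C2 K s r where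
  toFun κ t := δ t.1 t.2.1 * κ (t.2.1, t.2.2) - κ (t.1, t.2.2) + κ (t.1, t.2.1) * γ t.2.1 t.2.2
  map_add' x y := by ext1 t; simp only [Pi.add_apply, Matrix.mul_add, Matrix.add_mul]; abel
  map_smul' p x := by
    ext1 t
    simp only [Pi.smul_apply, Matrix.mul_smul, Matrix.smul_mul, smul_sub, smul_add,
      RingHom.id_apply]

/-- The twisted Čech differential on `2`-cochains. -/
def d2 (P : Type) [CommRing P] [Algebra P K] (γ : ∀ a b, Matrix (Fin (r a)) (Fin (r b)) K)
    (δ : ∀ a b, Matrix (Fin (s a)) (Fin (s b)) K) : C2 K s r →ₗ[P] C3 K s r where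
  toFun κ t := δ t.1 t.2.1 * κ (t.2.1, t.2.2.1, t.2.2.2) - κ (t.1, t.2.2.1, t.2.2.2) +
    κ (t.1, t.2.1, t.2.2.2) - κ (t.1, t.2.1, t.2.2.1) * γ t.2.2.1 t.2.2.2
  map_add' x y := by ext1 t; simp only [Pi.add_apply, Matrix.mul_add, Matrix.add_mul]; abel
  map_smul' p x := by
    ext1 t
    simp only [Pi.smul_apply, Matrix.mul_smul, Matrix.smul_mul, smul_sub, smul_add,
      RingHom.id_apply]

lemma d0_apply (κ : C0 K s r) (a b : ι) :
    d0 P γ δ κ (a, b) = δ a b * κ b - κ a * γ a b := rfl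

lemma d1_apply (κ : C1 K s r) (a b c : ι) :
    d1 P γ δ κ (a, b, c) = δ a b * κ (b, c) - κ (a, c) + κ (a, b) * γ b c := rfl

lemma d2_apply (κ : C2 K s r) (a b c e : ι) :
    d2 P γ δ κ (a, b, c, e) = δ a b * κ (b, c, e) - κ (a, c, e) + κ (a, b, e) -
      κ (a, b, c) * γ c e := rfl

/-- Čech `0`-cochains with values in `𝔞`. -/
abbrev Z0 (K : Type) [Field K] [Algebra P K] (g : ι → P) (s r : ι → ℕ) (𝔞 : Ideal P) :
    Submodule P (C0 K s r) := Dt K s r 𝔞 g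

/-- Čech `1`-cochains with values in `𝔞`. -/
abbrev Z1 (K : Type) [Field K] [Algebra P K] (g : ι → P) (s r : ι → ℕ) (𝔞 : Ideal P) :
    Submodule P (C1 K s r) :=
  Dt K (fun t : ι × ι => s t.1) (fun t => r t.2) 𝔞 fun t => g t.1 * g t.2

/-- Čech `2`-cochains with values in `𝔞`. -/
abbrev Z2 (K : Type) [Field K] [Algebra P K] (g : ι → P) (s r : ι → ℕ) (𝔞 : Ideal P) :
    Submodule P (C2 K s r) :=
  Dt K (fun t : ι × ι × ι => s t.1) (fun t => r t.2.2) 𝔞 fun t => g t.1 * g t.2.1 * g t.2.2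

/-- Čech `3`-cochains with values in `𝔞`. -/
abbrev Z3 (K : Type) [Field K] [Algebra P K] (g : ι → P) (s r : ι → ℕ) (𝔞 : Ideal P) :
    Submodule P (C3 K s r) :=
  Dt K (fun t : ι × ι × ι × ι => s t.1) (fun t => r t.2.2.2) 𝔞
    fun t => g t.1 * g t.2.1 * g t.2.2.1 * g t.2.2.2

variable {γ δ} {g : ι → P} {𝔞 : Ideal P}

lemma mem_Z0 {κ : C0 K s r} : κ ∈ Z0 K g s r 𝔞 ↔ ∀ a, κ a ∈ ml K _ _ 𝔞 (g a) := mem_Dt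

lemma mem_Z1 {κ : C1 K s r} :
    κ ∈ Z1 K g s r 𝔞 ↔ ∀ a b, κ (a, b) ∈ ml K _ _ 𝔞 (g a * g b) :=
  mem_Dt.trans Prod.forall

lemma mem_Z2 {κ : C2 K s r} :
    κ ∈ Z2 K g s r 𝔞 ↔ ∀ a b c, κ (a, b, c) ∈ ml K _ _ 𝔞 (g a * g b * g c) :=
  mem_Dt.trans (by simp only [Prod.forall])

lemma mem_Z3 {κ : C3 K s r} :
    κ ∈ Z3 K g s r 𝔞 ↔ ∀ a b c e, κ (a, b, c, e) ∈ ml K _ _ 𝔞 (g a * g b * g c * g e) :=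
  mem_Dt.trans (by simp only [Prod.forall])

lemma d0_mem (hγ : ∀ a b, γ a b ∈ ml K _ _ ⊤ (g a * g b))
    (hδ : ∀ a b, δ a b ∈ ml K _ _ ⊤ (g a * g b)) {κ : C0 K s r} (hκ : κ ∈ Z0 K g s r 𝔞) :
    d0 P γ δ κ ∈ Z1 K g s r 𝔞 := mem_Z1.2 fun a b => by
  rw [mem_Z0] at hκ
  rw [d0_apply]
  exact sub_mem (ml_mul_left (hδ a b) (hκ b) dvd_rfl ⟨g a, by ring⟩)
    (ml_mul_right (hκ a) (hγ a b) ⟨g b, by ring⟩ dvd_rfl)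

lemma d1_mem (hγ : ∀ a b, γ a b ∈ ml K _ _ ⊤ (g a * g b))
    (hδ : ∀ a b, δ a b ∈ ml K _ _ ⊤ (g a * g b)) {κ : C1 K s r} (hκ : κ ∈ Z1 K g s r 𝔞) :
    d1 P γ δ κ ∈ Z2 K g s r 𝔞 := mem_Z2.2 fun a b c => by
  rw [mem_Z1] at hκ
  rw [d1_apply]
  exact add_mem (sub_mem (ml_mul_left (hδ a b) (hκ b c) ⟨g c, by ring⟩ ⟨g a, by ring⟩)
    (ml_dvd _ ⟨g b, by ring⟩ (hκ a c)))
    (ml_mul_right (hκ a b) (hγ b c) ⟨g c, by ring⟩ ⟨g a, by ring⟩)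

lemma d2_mem (hγ : ∀ a b, γ a b ∈ ml K _ _ ⊤ (g a * g b))
    (hδ : ∀ a b, δ a b ∈ ml K _ _ ⊤ (g a * g b)) {κ : C2 K s r} (hκ : κ ∈ Z2 K g s r 𝔞) :
    d2 P γ δ κ ∈ Z3 K g s r 𝔞 := mem_Z3.2 fun a b c e => by
  rw [mem_Z2] at hκ
  rw [d2_apply]
  exact sub_mem (add_mem (sub_mem
    (ml_mul_left (hδ a b) (hκ b c e) ⟨g c * g e, by ring⟩ ⟨g a, by ring⟩)
    (ml_dvd _ ⟨g b, by ring⟩ (hκ a c e))) (ml_dvd _ ⟨g c, by ring⟩ (hκ a b e)))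
    (ml_mul_right (hκ a b c) (hγ c e) ⟨g e, by ring⟩ ⟨g a * g b, by ring⟩)

lemma d1_d0 (hγ : IsCoc g r γ 𝔞) (hδ : IsCoc g s δ 𝔞) {κ : C0 K s r}
    (hκ : κ ∈ Z0 K g s r ⊤) : d1 P γ δ (d0 P γ δ κ) ∈ Z2 K g s r 𝔞 := mem_Z2.2 fun a b c => by
  rw [mem_Z0] at hκ
  have e : d1 P γ δ (d0 P γ δ κ) (a, b, c) =
      (δ a b * δ b c - δ a c) * κ c - κ a * (γ a b * γ b c - γ a c) := by
    simp only [d1_apply, d0_apply, Matrix.mul_sub, Matrix.sub_mul, Matrix.mul_assoc]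
    abel
  rw [e]
  exact sub_mem (ml_mul_right (hδ.coc a b c) (hκ c) dvd_rfl ⟨g a * g b, by ring⟩)
    (ml_mul_left (hκ a) (hγ.coc a b c) ⟨g b * g c, by ring⟩ dvd_rfl)

lemma d2_d1 (hγ : IsCoc g r γ 𝔞) (hδ : IsCoc g s δ 𝔞) {κ : C1 K s r}
    (hκ : κ ∈ Z1 K g s r ⊤) : d2 P γ δ (d1 P γ δ κ) ∈ Z3 K g s r 𝔞 := mem_Z3.2 fun a b c e => by
  rw [mem_Z1] at hκ
  have e : d2 P γ δ (d1 P γ δ κ) (a, b, c, e) =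
      (δ a b * δ b c - δ a c) * κ (c, e) + κ (a, b) * (γ b e - γ b c * γ c e) := by
    simp only [d2_apply, d1_apply, Matrix.mul_sub, Matrix.sub_mul, Matrix.mul_assoc,
      Matrix.mul_add, Matrix.add_mul]
    abel
  rw [e, ← neg_sub (γ b c * γ c _), Matrix.mul_neg]
  exact add_mem (ml_mul_right (hδ.coc a b c) (hκ c _) ⟨g ‹_›, by ring⟩ ⟨g a * g b, by ring⟩)
    (neg_mem (ml_mul_left (hκ a b) (hγ.coc b c _) ⟨g c * g ‹_›, by ring⟩ ⟨g a, by ring⟩))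

/-- Torsion of Čech cohomology, in degree one. -/
lemma tors1 (hγ : IsCoc g r γ 𝔞) (hdiag : ∀ a, γ a a - 1 ∈ ml K _ _ 𝔞 (g a))
    {κ : C1 K s r} (hκ : κ ∈ Z1 K g s r ⊤) (hd : d1 P γ δ κ ∈ Z2 K g s r 𝔞) (e : ι) :
    ∃ n : ℕ, g e ^ n • κ ∈ (Z0 K g s r ⊤).map (d0 P γ δ) ⊔ Z1 K g s r 𝔞 := by
  rw [mem_Z1] at hκ
  rw [mem_Z2] at hd
  let y : C0 K s r := fun a => - (κ (a, e) * γ e a)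
  have hy : y ∈ Dt K s r ⊤ fun a => g a * g e := mem_Dt.2 fun a =>
    neg_mem (ml_mul_left (hκ a e) (hγ.mem e a) dvd_rfl ⟨1, by ring⟩)
  have hdy : d0 P γ δ y - κ ∈ Dt K (fun t : ι × ι => s t.1) (fun t => r t.2) 𝔞
      fun t => g t.1 * g t.2 * g e := mem_Dt.2 fun ⟨a, b⟩ => by
    have E : (d0 P γ δ y - κ) (a, b) =
      -((δ a b * κ (b, e) - κ (a, e) + κ (a, b) * γ b e) * γ e b)
        + κ (a, e) * (γ e a * γ a b - γ e b) + κ (a, b) * (γ b e * γ e b - γ b b)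
        + κ (a, b) * (γ b b - 1) := by
      simp only [Pi.sub_apply, d0_apply, y, Matrix.mul_sub, Matrix.sub_mul, Matrix.mul_assoc,
        Matrix.add_mul, Matrix.mul_neg, Matrix.neg_mul, Matrix.mul_one]
      abel
    rw [E]
    refine add_mem (add_mem (add_mem (neg_mem ?_) ?_) ?_) ?_
    · exact ml_mul_right (hd a b e) (hγ.mem e b) dvd_rfl ⟨g a, by ring⟩
    · exact ml_mul_left (hκ a e) (hγ.coc e a b) ⟨g b, by ring⟩ ⟨1, by ring⟩
    · have := hγ.coc b e b
      have h2 : γ b e * γ e b - γ b b ∈ ml K _ _ 𝔞 (g b * g e) := fun i j => by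
        obtain ⟨N, p, hp, hz⟩ := this i j
        refine ⟨N + N, (g e) ^ N * p, 𝔞.mul_mem_left _ hp, ?_⟩
        rw [map_mul, ← hz]
        simp only [map_mul, mul_pow, pow_add]
        ring
      exact ml_mul_left (hκ a b) h2 ⟨g e, by ring⟩ ⟨g a, by ring⟩
    · exact ml_mul_left (hκ a b) (hdiag b) ⟨g e, by ring⟩ ⟨g a * g e, by ring⟩
  obtain ⟨N, hN⟩ := Dt_descend hy
  obtain ⟨N', hN'⟩ := Dt_descend hdy
  refine ⟨N + N', ?_⟩
  have h1 := hN (N + N') (by omega)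
  have h2 := hN' (N + N') (by omega)
  rw [smul_sub, ← map_smul] at h2
  have := sub_mem (Submodule.mem_sup_left (T := Z1 K g s r 𝔞) (Submodule.mem_map_of_mem
    (f := d0 P γ δ) h1)) (Submodule.mem_sup_right h2)
  simpa using this

/-- Torsion of Čech cohomology, in degree two. -/
lemma tors2 (hγ : IsCoc g r γ 𝔞) (hdiag : ∀ a, γ a a - 1 ∈ ml K _ _ 𝔞 (g a))
    {κ : C2 K s r} (hκ : κ ∈ Z2 K g s r ⊤) (hd : d2 P γ δ κ ∈ Z3 K g s r 𝔞) (e : ι) :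
    ∃ n : ℕ, g e ^ n • κ ∈ (Z1 K g s r ⊤).map (d1 P γ δ) ⊔ Z2 K g s r 𝔞 := by
  rw [mem_Z2] at hκ
  rw [mem_Z3] at hd
  let y : C1 K s r := fun t => κ (t.1, t.2, e) * γ e t.2
  have hy : y ∈ Dt K (fun t : ι × ι => s t.1) (fun t => r t.2) ⊤
      fun t => g t.1 * g t.2 * g e := mem_Dt.2 fun ⟨a, b⟩ =>
    ml_mul_left (hκ a b e) (hγ.mem e b) dvd_rfl ⟨g a, by ring⟩
  have hdy : d1 P γ δ y - κ ∈ Dt K (fun t : ι × ι × ι => s t.1) (fun t => r t.2.2) 𝔞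
      fun t => g t.1 * g t.2.1 * g t.2.2 * g e := mem_Dt.2 fun ⟨a, b, c⟩ => by
    have E : (d1 P γ δ y - κ) (a, b, c) =
      (δ a b * κ (b, c, e) - κ (a, c, e) + κ (a, b, e) - κ (a, b, c) * γ c e) * γ e c
        + κ (a, b, e) * (γ e b * γ b c - γ e c) + κ (a, b, c) * (γ c e * γ e c - γ c c)
        + κ (a, b, c) * (γ c c - 1) := by
      simp only [Pi.sub_apply, d1_apply, y, Matrix.mul_sub, Matrix.sub_mul, Matrix.mul_assoc,
        Matrix.add_mul, Matrix.mul_one]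
      abel
    rw [E]
    refine add_mem (add_mem (add_mem ?_ ?_) ?_) ?_
    · exact ml_mul_right (hd a b c e) (hγ.mem e c) dvd_rfl ⟨g a * g b, by ring⟩
    · exact ml_mul_left (hκ a b e) (hγ.coc e b c) ⟨g c, by ring⟩ ⟨g a, by ring⟩
    · have := hγ.coc c e c
      have h2 : γ c e * γ e c - γ c c ∈ ml K _ _ 𝔞 (g c * g e) := fun i j => by
        obtain ⟨N, p, hp, hz⟩ := this i j
        refine ⟨N + N, (g e) ^ N * p, 𝔞.mul_mem_left _ hp, ?_⟩
        rw [map_mul, ← hz]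
        simp only [map_mul, mul_pow, pow_add]
        ring
      exact ml_mul_left (hκ a b c) h2 ⟨g e, by ring⟩ ⟨g a * g b, by ring⟩
    · exact ml_mul_left (hκ a b c) (hdiag c) ⟨g e, by ring⟩ ⟨g a * g b * g e, by ring⟩
  obtain ⟨N, hN⟩ := Dt_descend hy
  obtain ⟨N', hN'⟩ := Dt_descend hdy
  refine ⟨N + N', ?_⟩
  have h1 := hN (N + N') (by omega)
  have h2 := hN' (N + N') (by omega)
  rw [smul_sub, ← map_smul] at h2
  have := sub_mem (Submodule.mem_sup_left (T := Z2 K g s r 𝔞) (Submodule.mem_map_of_mem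
    (f := d1 P γ δ) h1)) (Submodule.mem_sup_right h2)
  simpa using this

lemma torsion_of_gens {E : Type} [AddCommGroup E] [Module P E] {B : Submodule P E} {x : E}
    {I 𝔪 : Ideal P} (hrad : 𝔪 ≤ (I ⊔ Ideal.span (Set.range g)).radical)
    (hI : ∀ p ∈ I, p • x ∈ B) (hg : ∀ e, ∃ n : ℕ, g e ^ n • x ∈ B) :
    ∀ p ∈ 𝔪, ∃ n : ℕ, p ^ n • x ∈ B := by
  let 𝔟 : Ideal P := B.comap (LinearMap.toSpanSingleton P E x)
  have h1 : (I ⊔ Ideal.span (Set.range g)).radical ≤ 𝔟.radical := by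
    rw [← Ideal.radical_idem 𝔟]
    refine Ideal.radical_mono (sup_le (fun p hp => Ideal.le_radical (hI p hp)) ?_)
    rw [Ideal.span_le]
    rintro _ ⟨e, rfl⟩
    exact hg e
  exact fun p hp => h1 (hrad hp)

/-- Vanishing of the Čech cohomology in degrees `0`, `1` and `2`. -/
theorem cech_vanish (hγ : IsCoc g r γ 𝔞) (hδ : IsCoc g s δ 𝔞)
    (hdiag : ∀ a, γ a a - 1 ∈ ml K _ _ 𝔞 (g a)) (hg : ∀ a, g a ≠ 0) {𝔪 : Ideal P} (hfg : 𝔪.FG)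
    (hgm : ∀ a, g a ∈ 𝔪) (hrad : 𝔪 ≤ (𝔞 ⊔ Ideal.span (Set.range g)).radical)
    {B : Submodule P (C0 K s r)} (hNB : Z0 K g s r 𝔞 ≤ B) (hBT : B ≤ Z0 K g s r ⊤)
    (hB : ∀ x ∈ B, d0 P γ δ x ∈ Z1 K g s r 𝔞)
    (htor : ∀ x ∈ Z0 K g s r ⊤, d0 P γ δ x ∈ Z1 K g s r 𝔞 → ∀ e, ∃ n : ℕ, g e ^ n • x ∈ B)
    {m : ℕ} (hEB : EV (ModuleCat.of P (P ⧸ 𝔪)) (m + 2) (SQ B (Z0 K g s r 𝔞))) :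
    (∀ x ∈ Z0 K g s r ⊤, d0 P γ δ x ∈ Z1 K g s r 𝔞 → x ∈ B) ∧
    (1 ≤ m → ∀ x ∈ Z1 K g s r ⊤, d1 P γ δ x ∈ Z2 K g s r 𝔞 →
      x ∈ (Z0 K g s r ⊤).map (d0 P γ δ) ⊔ Z1 K g s r 𝔞) ∧
    (2 ≤ m → ∀ x ∈ Z2 K g s r ⊤, d2 P γ δ x ∈ Z3 K g s r 𝔞 →
      x ∈ (Z1 K g s r ⊤).map (d1 P γ δ) ⊔ Z2 K g s r 𝔞) := by
  have hgN : ∀ a, g a ∈ Module.annihilator P (ModuleCat.of P (P ⧸ 𝔪)) := fun a => by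
    change g a ∈ Module.annihilator P (P ⧸ 𝔪)
    rw [Ideal.annihilator_quotient]
    exact hgm a
  have s0 := ext_step hfg (d0 P γ δ) hNB hBT hB
    (fun m => Dt_acyclic g hg hgN (fun a => a) (fun a => dvd_rfl) m) hEB
    (fun x hx hdx => torsion_of_gens hrad
      (fun p hp => hNB (Dt_ideal_smul hp hx)) (htor x hx hdx))
  have a1 : ∀ m, EV (ModuleCat.of P (P ⧸ 𝔪)) m (SQ (Z1 K g s r ⊤) (Z1 K g s r 𝔞)) :=
    Dt_acyclic g hg hgN (fun t => t.1) (fun t => ⟨_, rfl⟩)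
  have a2 : ∀ m, EV (ModuleCat.of P (P ⧸ 𝔪)) m (SQ (Z2 K g s r ⊤) (Z2 K g s r 𝔞)) :=
    Dt_acyclic g hg hgN (fun t => t.1) (fun t => ⟨g t.2.1 * g t.2.2, by ring⟩)
  have b1 : (Z0 K g s r ⊤).map (d0 P γ δ) ⊔ Z1 K g s r 𝔞 ≤ Z1 K g s r ⊤ :=
    sup_le (Submodule.map_le_iff_le_comap.2 fun x hx => d0_mem hγ.mem hδ.mem hx) (Dt_mono le_top)
  have b2 : (Z1 K g s r ⊤).map (d1 P γ δ) ⊔ Z2 K g s r 𝔞 ≤ Z2 K g s r ⊤ :=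
    sup_le (Submodule.map_le_iff_le_comap.2 fun x hx => d1_mem hγ.mem hδ.mem hx) (Dt_mono le_top)
  have c1 : ∀ x ∈ (Z0 K g s r ⊤).map (d0 P γ δ) ⊔ Z1 K g s r 𝔞,
      d1 P γ δ x ∈ Z2 K g s r 𝔞 := fun x hx => by
    obtain ⟨_, ⟨y, hy, rfl⟩, z, hz, rfl⟩ := Submodule.mem_sup.1 hx
    rw [map_add]
    exact add_mem (d1_d0 hγ hδ hy) (d1_mem hγ.mem hδ.mem hz)
  have c2 : ∀ x ∈ (Z1 K g s r ⊤).map (d1 P γ δ) ⊔ Z2 K g s r 𝔞,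
      d2 P γ δ x ∈ Z3 K g s r 𝔞 := fun x hx => by
    obtain ⟨_, ⟨y, hy, rfl⟩, z, hz, rfl⟩ := Submodule.mem_sup.1 hx
    rw [map_add]
    exact add_mem (d2_d1 hγ hδ hy) (d2_mem hγ.mem hδ.mem hz)
  have t1 : ∀ x ∈ Z1 K g s r ⊤, d1 P γ δ x ∈ Z2 K g s r 𝔞 → ∀ p ∈ 𝔪, ∃ n : ℕ,
      p ^ n • x ∈ (Z0 K g s r ⊤).map (d0 P γ δ) ⊔ Z1 K g s r 𝔞 := fun x hx hdx =>
    torsion_of_gens hrad (fun p hp => Submodule.mem_sup_right (Dt_ideal_smul hp hx))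
      (tors1 hγ hdiag hx hdx)
  have t2 : ∀ x ∈ Z2 K g s r ⊤, d2 P γ δ x ∈ Z3 K g s r 𝔞 → ∀ p ∈ 𝔪, ∃ n : ℕ,
      p ^ n • x ∈ (Z1 K g s r ⊤).map (d1 P γ δ) ⊔ Z2 K g s r 𝔞 := fun x hx hdx =>
    torsion_of_gens hrad (fun p hp => Submodule.mem_sup_right (Dt_ideal_smul hp hx))
      (tors2 hγ hdiag hx hdx)
  refine ⟨s0.1, fun hm => ?_, fun hm => ?_⟩
  · obtain ⟨m, rfl⟩ := Nat.exists_eq_add_of_le' hm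
    exact (ext_step hfg (d1 P γ δ) le_sup_right b1 c1 a1 s0.2 t1).1
  · obtain ⟨m, rfl⟩ := Nat.exists_eq_add_of_le' hm
    have s1 := (ext_step (m := m + 1) hfg (d1 P γ δ) le_sup_right b1 c1 a1 s0.2 t1).2
    exact (ext_step hfg (d2 P γ δ) le_sup_right b2 c2 a2 s1 t2).1

end Cech

section Leading

variable {P K : Type} [CommRing P] [IsDomain P] [Field K] [Algebra P K] [IsFractionRing P K]
variable {T T' T'' : Type} {p q : T → ℕ} {p' q' : T' → ℕ} {p'' q'' : T'' → ℕ}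
  {gT : T → P} {gT' : T' → P} {gT'' : T'' → P} {c : ℕ}

lemma Dt_expand (f : Fin c → P) (hg : ∀ t, gT t ≠ 0) {s : ℕ}
    {x : ∀ t, Matrix (Fin (p t)) (Fin (q t)) K}
    (hx : x ∈ Dt K p q (Ideal.span (Set.range f) ^ s) gT) :
    ∃ w : (Fin c →₀ ℕ) → ∀ t, Matrix (Fin (p t)) (Fin (q t)) K, (∀ β, w β ∈ Dt K p q ⊤ gT) ∧
      x = ∑ β ∈ expo c s, fm f β • w β := by
  choose w hw hx using fun t => ml_expand (𝔞 := ⊤) f (hg t) (s := s) (A := x t)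
    (by rw [Ideal.top_mul]; exact mem_Dt.1 hx t)
  refine ⟨fun β t => w t β, fun β => mem_Dt.2 fun t => hw t β, ?_⟩
  ext1 t
  rw [hx, Finset.sum_apply]
  rfl

lemma Dt_qr (f : Fin c → P) (hreg : RingTheory.Sequence.IsWeaklyRegular P (List.ofFn f))
    {s : ℕ} (w : (Fin c →₀ ℕ) → ∀ t, Matrix (Fin (p t)) (Fin (q t)) K)
    (hw : ∀ β, w β ∈ Dt K p q ⊤ gT)
    (h : ∑ β ∈ expo c s, fm f β • w β ∈ Dt K p q (Ideal.span (Set.range f) ^ (s + 1)) gT) :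
    ∀ β ∈ expo c s, w β ∈ Dt K p q (Ideal.span (Set.range f)) gT := fun β hβ =>
  mem_Dt.2 fun t => ml_qr f hreg (fun β => w β t) (fun β => mem_Dt.1 (hw β) t)
    (by simpa [Finset.sum_apply] using mem_Dt.1 h t) β hβ

lemma Dt_sum_mem (f : Fin c → P) {s t : ℕ} {w : (Fin c →₀ ℕ) → ∀ t, Matrix (Fin (p t)) (Fin (q t)) K}
    (hw : ∀ β ∈ expo c s, w β ∈ Dt K p q (Ideal.span (Set.range f) ^ t) gT) :
    ∑ β ∈ expo c s, fm f β • w β ∈ Dt K p q (Ideal.span (Set.range f) ^ (s + t)) gT :=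
  sum_mem fun β hβ => mem_Dt.2 fun i => by
    rw [pow_add]
    exact ml_smul_ideal (fm_mem f β (mem_expo.1 hβ).ge) (mem_Dt.1 (hw β hβ) i)

lemma lead_ker (f : Fin c → P) (hreg : RingTheory.Sequence.IsWeaklyRegular P (List.ofFn f))
    (d : (∀ t, Matrix (Fin (p t)) (Fin (q t)) K) →ₗ[P] ∀ t, Matrix (Fin (p' t)) (Fin (q' t)) K)
    (hd : ∀ x ∈ Dt K p q ⊤ gT, d x ∈ Dt K p' q' ⊤ gT') (hg : ∀ t, gT t ≠ 0) {s : ℕ}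
    {x : ∀ t, Matrix (Fin (p t)) (Fin (q t)) K}
    (hx : x ∈ Dt K p q (Ideal.span (Set.range f) ^ s) gT)
    (hdx : d x ∈ Dt K p' q' (Ideal.span (Set.range f) ^ (s + 1)) gT') :
    ∃ w : (Fin c →₀ ℕ) → ∀ t, Matrix (Fin (p t)) (Fin (q t)) K, (∀ β, w β ∈ Dt K p q ⊤ gT) ∧
      x = ∑ β ∈ expo c s, fm f β • w β ∧
      ∀ β ∈ expo c s, d (w β) ∈ Dt K p' q' (Ideal.span (Set.range f)) gT' := by
  obtain ⟨w, hw, rfl⟩ := Dt_expand f hg hx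
  refine ⟨w, hw, rfl, Dt_qr f hreg (fun β => d (w β)) (fun β => hd _ (hw β)) ?_⟩
  simpa using hdx

lemma lead_exact (f : Fin c → P) (hreg : RingTheory.Sequence.IsWeaklyRegular P (List.ofFn f))
    (d' : (∀ t, Matrix (Fin (p'' t)) (Fin (q'' t)) K) →ₗ[P] ∀ t, Matrix (Fin (p t)) (Fin (q t)) K)
    (d : (∀ t, Matrix (Fin (p t)) (Fin (q t)) K) →ₗ[P] ∀ t, Matrix (Fin (p' t)) (Fin (q' t)) K)
    (hd : ∀ x ∈ Dt K p q ⊤ gT, d x ∈ Dt K p' q' ⊤ gT') (hg : ∀ t, gT t ≠ 0)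
    (hex : ∀ x ∈ Dt K p q ⊤ gT, d x ∈ Dt K p' q' (Ideal.span (Set.range f)) gT' →
      x ∈ (Dt K p'' q'' ⊤ gT'').map d' ⊔ Dt K p q (Ideal.span (Set.range f)) gT) {s : ℕ}
    {x : ∀ t, Matrix (Fin (p t)) (Fin (q t)) K}
    (hx : x ∈ Dt K p q (Ideal.span (Set.range f) ^ s) gT)
    (hdx : d x ∈ Dt K p' q' (Ideal.span (Set.range f) ^ (s + 1)) gT') :
    ∃ y ∈ Dt K p'' q'' (Ideal.span (Set.range f) ^ s) gT'',
      x - d' y ∈ Dt K p q (Ideal.span (Set.range f) ^ (s + 1)) gT := by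
  obtain ⟨w, hw, rfl, hdw⟩ := lead_ker f hreg d hd hg hx hdx
  have : ∀ β, ∃ y ∈ Dt K p'' q'' ⊤ gT'', β ∈ expo c s →
      w β - d' y ∈ Dt K p q (Ideal.span (Set.range f)) gT := fun β => by
    by_cases hβ : β ∈ expo c s
    · obtain ⟨_, ⟨y, hy, rfl⟩, z, hz, h⟩ := Submodule.mem_sup.1 (hex _ (hw β) (hdw β hβ))
      exact ⟨y, hy, fun _ => by rw [← h]; simpa using hz⟩
    · exact ⟨0, zero_mem _, fun h => absurd h hβ⟩
  choose y hy hwy using this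
  refine ⟨∑ β ∈ expo c s, fm f β • y β, ?_, ?_⟩
  · have := Dt_sum_mem (s := s) (t := 0) (gT := gT'') f (w := y)
      (fun β _ => by simpa using hy β)
    simpa using this
  · rw [map_sum, ← Finset.sum_sub_distrib]
    simp only [map_smul, ← smul_sub]
    exact Dt_sum_mem (t := 1) f (fun β hβ => by simpa using hwy β hβ)

end Leading

section Van

variable {P K : Type} [CommRing P] [IsDomain P] [Field K] [Algebra P K] [IsFractionRing P K]
variable {ι : Type} [Fintype ι] [DecidableEq ι] {r s : ι → ℕ}
  {γ : ∀ a b, Matrix (Fin (r a)) (Fin (r b)) K}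
  {δ : ∀ a b, Matrix (Fin (s a)) (Fin (s b)) K} {g : ι → P}

/-- Vanishing of the first Čech cohomology of `Hom(V, W)`. -/
def H1Van (g : ι → P) (𝔞 : Ideal P) (γ : ∀ a b, Matrix (Fin (r a)) (Fin (r b)) K)
    (δ : ∀ a b, Matrix (Fin (s a)) (Fin (s b)) K) : Prop :=
  ∀ x ∈ Z1 K g s r ⊤, d1 P γ δ x ∈ Z2 K g s r 𝔞 →
      x ∈ (Z0 K g s r ⊤).map (d0 P γ δ) ⊔ Z1 K g s r 𝔞

/-- Vanishing of the second Čech cohomology of `Hom(V, W)`. -/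
def H2Van (g : ι → P) (𝔞 : Ideal P) (γ : ∀ a b, Matrix (Fin (r a)) (Fin (r b)) K)
    (δ : ∀ a b, Matrix (Fin (s a)) (Fin (s b)) K) : Prop :=
  ∀ x ∈ Z2 K g s r ⊤, d2 P γ δ x ∈ Z3 K g s r 𝔞 →
      x ∈ (Z1 K g s r ⊤).map (d1 P γ δ) ⊔ Z2 K g s r 𝔞

lemma H1Van.exact {c : ℕ} {f : Fin c → P}
    (hreg : RingTheory.Sequence.IsWeaklyRegular P (List.ofFn f))
    (h : H1Van g (Ideal.span (Set.range f)) γ δ) (hg : ∀ a, g a ≠ 0)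
    (hγ : ∀ a b, γ a b ∈ ml K _ _ ⊤ (g a * g b))
    (hδ : ∀ a b, δ a b ∈ ml K _ _ ⊤ (g a * g b)) {j : ℕ} {x : C1 K s r}
    (hx : x ∈ Z1 K g s r (Ideal.span (Set.range f) ^ j))
    (hdx : d1 P γ δ x ∈ Z2 K g s r (Ideal.span (Set.range f) ^ (j + 1))) :
    ∃ y ∈ Z0 K g s r (Ideal.span (Set.range f) ^ j),
      x - d0 P γ δ y ∈ Z1 K g s r (Ideal.span (Set.range f) ^ (j + 1)) :=
  lead_exact f hreg (d0 P γ δ) (d1 P γ δ) (fun _ hx => d1_mem hγ hδ hx)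
    (fun _ => mul_ne_zero (hg _) (hg _)) h hx hdx

lemma H2Van.exact {c : ℕ} {f : Fin c → P}
    (hreg : RingTheory.Sequence.IsWeaklyRegular P (List.ofFn f))
    (h : H2Van g (Ideal.span (Set.range f)) γ δ) (hg : ∀ a, g a ≠ 0)
    (hγ : ∀ a b, γ a b ∈ ml K _ _ ⊤ (g a * g b))
    (hδ : ∀ a b, δ a b ∈ ml K _ _ ⊤ (g a * g b)) {j : ℕ} {x : C2 K s r}
    (hx : x ∈ Z2 K g s r (Ideal.span (Set.range f) ^ j))
    (hdx : d2 P γ δ x ∈ Z3 K g s r (Ideal.span (Set.range f) ^ (j + 1))) :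
    ∃ y ∈ Z1 K g s r (Ideal.span (Set.range f) ^ j),
      x - d1 P γ δ y ∈ Z2 K g s r (Ideal.span (Set.range f) ^ (j + 1)) :=
  lead_exact f hreg (d1 P γ δ) (d2 P γ δ) (fun _ hx => d2_mem hγ hδ hx)
    (fun _ => mul_ne_zero (mul_ne_zero (hg _) (hg _)) (hg _)) h hx hdx

lemma d0_congr {γ' : ∀ a b, Matrix (Fin (r a)) (Fin (r b)) K}
    {δ' : ∀ a b, Matrix (Fin (s a)) (Fin (s b)) K} {𝔞 𝔟 : Ideal P}
    (hγ : ∀ a b, γ' a b - γ a b ∈ ml K _ _ 𝔞 (g a * g b))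
    (hδ : ∀ a b, δ' a b - δ a b ∈ ml K _ _ 𝔞 (g a * g b)) {x : C0 K s r}
    (hx : x ∈ Z0 K g s r 𝔟) : d0 P γ' δ' x - d0 P γ δ x ∈ Z1 K g s r (𝔞 * 𝔟) := by
  rw [mem_Z0] at hx
  refine mem_Z1.2 fun a b => ?_
  have : (d0 P γ' δ' x - d0 P γ δ x) (a, b) =
      (δ' a b - δ a b) * x b - x a * (γ' a b - γ a b) := by
    simp only [Pi.sub_apply, d0_apply, Matrix.mul_sub, Matrix.sub_mul]; abel
  rw [this]
  refine sub_mem (ml_mul' (hδ a b) (ml_dvd _ ⟨g a, by ring⟩ (hx b))) ?_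
  rw [mul_comm 𝔞]
  exact ml_mul' (ml_dvd _ ⟨g b, by ring⟩ (hx a)) (hγ a b)

lemma d1_congr {γ' : ∀ a b, Matrix (Fin (r a)) (Fin (r b)) K}
    {δ' : ∀ a b, Matrix (Fin (s a)) (Fin (s b)) K} {𝔞 𝔟 : Ideal P}
    (hγ : ∀ a b, γ' a b - γ a b ∈ ml K _ _ 𝔞 (g a * g b))
    (hδ : ∀ a b, δ' a b - δ a b ∈ ml K _ _ 𝔞 (g a * g b)) {x : C1 K s r}
    (hx : x ∈ Z1 K g s r 𝔟) : d1 P γ' δ' x - d1 P γ δ x ∈ Z2 K g s r (𝔞 * 𝔟) := by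
  rw [mem_Z1] at hx
  refine mem_Z2.2 fun a b c => ?_
  have : (d1 P γ' δ' x - d1 P γ δ x) (a, b, c) =
      (δ' a b - δ a b) * x (b, c) + x (a, b) * (γ' b c - γ b c) := by
    simp only [Pi.sub_apply, d1_apply, Matrix.mul_sub, Matrix.sub_mul]; abel
  rw [this]
  refine add_mem (ml_mul' (ml_dvd _ ⟨g c, by ring⟩ (hδ a b)) (ml_dvd _ ⟨g a, by ring⟩ (hx b c))) ?_
  rw [mul_comm 𝔞]
  exact ml_mul' (ml_dvd _ ⟨g c, by ring⟩ (hx a b)) (ml_dvd _ ⟨g a, by ring⟩ (hγ b c))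

lemma d2_congr {γ' : ∀ a b, Matrix (Fin (r a)) (Fin (r b)) K}
    {δ' : ∀ a b, Matrix (Fin (s a)) (Fin (s b)) K} {𝔞 𝔟 : Ideal P}
    (hγ : ∀ a b, γ' a b - γ a b ∈ ml K _ _ 𝔞 (g a * g b))
    (hδ : ∀ a b, δ' a b - δ a b ∈ ml K _ _ 𝔞 (g a * g b)) {x : C2 K s r}
    (hx : x ∈ Z2 K g s r 𝔟) : d2 P γ' δ' x - d2 P γ δ x ∈ Z3 K g s r (𝔞 * 𝔟) := by
  rw [mem_Z2] at hx
  refine mem_Z3.2 fun a b c e => ?_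
  have : (d2 P γ' δ' x - d2 P γ δ x) (a, b, c, e) =
      (δ' a b - δ a b) * x (b, c, e) - x (a, b, c) * (γ' c e - γ c e) := by
    simp only [Pi.sub_apply, d2_apply, Matrix.mul_sub, Matrix.sub_mul]; abel
  rw [this]
  refine sub_mem (ml_mul' (ml_dvd _ ⟨g c * g e, by ring⟩ (hδ a b))
    (ml_dvd _ ⟨g a, by ring⟩ (hx b c e))) ?_
  rw [mul_comm 𝔞]
  exact ml_mul' (ml_dvd _ ⟨g e, by ring⟩ (hx a b c)) (ml_dvd _ ⟨g a * g b, by ring⟩ (hγ c e))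

end Van

section Lift

variable {P K : Type} [CommRing P] [IsDomain P] [Field K] [Algebra P K] [IsFractionRing P K]
variable {ι : Type} [Fintype ι] [DecidableEq ι] {r : ι → ℕ}
  {γ : ∀ a b, Matrix (Fin (r a)) (Fin (r b)) K} {g : ι → P} {c : ℕ} {f : Fin c → P}

/-- One step of the formal deformation of a cocycle. -/
lemma lift_step (hreg : RingTheory.Sequence.IsWeaklyRegular P (List.ofFn f))
    (hg : ∀ a, g a ≠ 0) (hγ : ∀ a b, γ a b ∈ ml K _ _ ⊤ (g a * g b))
    (h2 : H2Van g (Ideal.span (Set.range f)) γ γ) {j : ℕ}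
    {Γ : ∀ a b, Matrix (Fin (r a)) (Fin (r b)) K}
    (hΓ : IsCoc g r Γ (Ideal.span (Set.range f) ^ (j + 1)))
    (hΓγ : ∀ a b, Γ a b - γ a b ∈ ml K _ _ (Ideal.span (Set.range f)) (g a * g b)) :
    ∃ Γ' : ∀ a b, Matrix (Fin (r a)) (Fin (r b)) K,
      IsCoc g r Γ' (Ideal.span (Set.range f) ^ (j + 2)) ∧
      ∀ a b, Γ' a b - Γ a b ∈ ml K _ _ (Ideal.span (Set.range f) ^ (j + 1)) (g a * g b) := by
  set I := Ideal.span (Set.range f) with hI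
  let ob : C2 K r r := fun t => Γ t.1 t.2.1 * Γ t.2.1 t.2.2 - Γ t.1 t.2.2
  have hob : ob ∈ Z2 K g r r (I ^ (j + 1)) := mem_Z2.2 hΓ.coc
  have hdob : d2 P γ γ ob ∈ Z3 K g r r (I ^ (j + 1 + 1)) := by
    have h0 : d2 P Γ Γ ob = 0 := by
      ext1 ⟨a, b, c, e⟩
      simp only [d2_apply, ob, Matrix.mul_sub, Matrix.sub_mul, Matrix.mul_assoc, Pi.zero_apply]
      abel
    have := d2_congr hΓγ hΓγ hob
    rw [h0, zero_sub, Submodule.neg_mem_iff] at this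
    rwa [pow_succ' I (j + 1)]
  obtain ⟨y, hy, hyo⟩ := h2.exact hreg hg hγ hγ hob hdob
  have hy' := mem_Z1.1 hy
  refine ⟨fun a b => Γ a b - y (a, b), ⟨fun a b => sub_mem (hΓ.mem a b)
    (ml_mono le_top _ (hy' a b)), fun a b c => ?_⟩, fun a b => by simpa using hy' a b⟩
  have e : (Γ a b - y (a, b)) * (Γ b c - y (b, c)) - (Γ a c - y (a, c)) =
      (ob - d1 P γ γ y) (a, b, c) - (d1 P Γ Γ y - d1 P γ γ y) (a, b, c)
        + y (a, b) * y (b, c) := by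
    simp only [Pi.sub_apply, d1_apply, ob, Matrix.mul_sub, Matrix.sub_mul]
    abel
  rw [e]
  refine add_mem (sub_mem (mem_Z2.1 hyo a b c) ?_) ?_
  · have := mem_Z2.1 (d1_congr hΓγ hΓγ hy) a b c
    rwa [← pow_succ' I (j + 1)] at this
  · refine ml_mono ?_ _ (ml_mul' (ml_dvd _ ⟨g c, by ring⟩ (hy' a b))
      (ml_dvd _ ⟨g a, by ring⟩ (hy' b c)))
    rw [← pow_add]
    exact Ideal.pow_le_pow_right (by omega)

/-- A cocycle with unobstructed deformations lifts compatibly modulo all powers of the ideal. -/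
theorem exists_lift (hreg : RingTheory.Sequence.IsWeaklyRegular P (List.ofFn f))
    (hg : ∀ a, g a ≠ 0) (hγ : IsCoc g r γ (Ideal.span (Set.range f)))
    (h2 : H2Van g (Ideal.span (Set.range f)) γ γ) :
    ∃ Γ : ℕ → ∀ a b, Matrix (Fin (r a)) (Fin (r b)) K,
      (∀ j, IsCoc g r (Γ j) (Ideal.span (Set.range f) ^ (j + 1))) ∧
      (∀ j a b, Γ j a b - γ a b ∈ ml K _ _ (Ideal.span (Set.range f)) (g a * g b)) ∧
      ∀ j a b, Γ (j + 1) a b - Γ j a b ∈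
        ml K _ _ (Ideal.span (Set.range f) ^ (j + 1)) (g a * g b) := by
  set I := Ideal.span (Set.range f) with hI
  let S : ℕ → Type := fun j => {Γ : ∀ a b, Matrix (Fin (r a)) (Fin (r b)) K //
    IsCoc g r Γ (I ^ (j + 1)) ∧ ∀ a b, Γ a b - γ a b ∈ ml K _ _ I (g a * g b)}
  have step : ∀ j, ∀ Γ : S j, ∃ Γ' : S (j + 1), ∀ a b, Γ'.1 a b - Γ.1 a b ∈
      ml K _ _ (I ^ (j + 1)) (g a * g b) := by
    rintro j ⟨Γ, h1, h1'⟩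
    obtain ⟨Γ', h3, h4⟩ := lift_step hreg hg hγ.mem h2 h1 h1'
    refine ⟨⟨Γ', h3, fun a b => ?_⟩, h4⟩
    rw [← sub_add_sub_cancel (Γ' a b) (Γ a b)]
    exact add_mem (ml_mono (Ideal.pow_le_self (by omega)) _ (h4 a b)) (h1' a b)
  choose F hF using step
  let s : ∀ j, S j := fun j => Nat.rec ⟨γ, by simpa using hγ, by simp⟩ F j
  exact ⟨fun j => (s j).1, fun j => (s j).2.1, fun j => (s j).2.2, fun j => hF j (s j)⟩

end Lift

section Taylor

variable {k : Type} [Field k] {ν : Type} [Finite ν] {K : Type} [Field K]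
  [Algebra (MvPolynomial ν k) K] [IsFractionRing (MvPolynomial ν k) K]

/-- The Taylor expansion of a polynomial at the generic point. -/
noncomputable def tay (K : Type) [Field K] [Algebra (MvPolynomial ν k) K] : (MvPolynomial ν k) →+* MvPowerSeries ν K :=
  MvPolynomial.eval₂Hom ((MvPowerSeries.C).comp ((algebraMap (MvPolynomial ν k) K).comp MvPolynomial.C))
    fun i => MvPowerSeries.C (algebraMap (MvPolynomial ν k) K (MvPolynomial.X i)) + MvPowerSeries.X i

lemma constantCoeff_tay (p : (MvPolynomial ν k)) :
    MvPowerSeries.constantCoeff (tay K p) = algebraMap (MvPolynomial ν k) K p := by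
  have : (MvPowerSeries.constantCoeff).comp (tay (ν := ν) (k := k) K) = algebraMap (MvPolynomial ν k) K := by
    apply MvPolynomial.ringHom_ext <;> intro <;> simp [tay]
  exact DFunLike.congr_fun this p

/-- The Taylor expansion of a rational function at the generic point. -/
noncomputable def sig (k ν : Type) [Field k] [Finite ν] (K : Type) [Field K]
    [Algebra (MvPolynomial ν k) K] [IsFractionRing (MvPolynomial ν k) K] :
    K →+* MvPowerSeries ν K :=
  IsLocalization.lift (M := nonZeroDivisors (MvPolynomial ν k)) (g := tay K) fun y => by
    rw [MvPowerSeries.isUnit_iff_constantCoeff, constantCoeff_tay]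
    exact (algebraMap_ne (nonZeroDivisors.ne_zero y.2)).isUnit

lemma sig_algebraMap (p : (MvPolynomial ν k)) : sig k ν K (algebraMap (MvPolynomial ν k) K p) = tay K p :=
  IsLocalization.lift_eq _ _

lemma constantCoeff_sig (z : K) : MvPowerSeries.constantCoeff (sig k ν K z) = z := by
  have : (MvPowerSeries.constantCoeff).comp (sig k ν K) = RingHom.id K := by
    refine IsLocalization.ringHom_ext (nonZeroDivisors (MvPolynomial ν k)) ?_
    exact RingHom.ext fun p => by simp [sig_algebraMap, constantCoeff_tay]
  exact DFunLike.congr_fun this z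

/-- Power series whose coefficient at `α` lies in `I ^ (j - |α|)` after inverting `g`. -/
def Fl (K : Type) [Field K] [Algebra (MvPolynomial ν k) K] (I : Ideal (MvPolynomial ν k)) (g : (MvPolynomial ν k)) (j : ℕ) :
    AddSubgroup (MvPowerSeries ν K) where
  carrier := {s | ∀ α, MvPowerSeries.coeff α s ∈ loc K (I ^ (j - α.degree)) g}
  zero_mem' α := by simp
  add_mem' hx hy α := by rw [map_add]; exact add_mem (hx α) (hy α)
  neg_mem' hx α := by rw [map_neg]; exact neg_mem (hx α)

variable {I : Ideal (MvPolynomial ν k)} {g : (MvPolynomial ν k)}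

lemma Fl_mono {i j : ℕ} (h : i ≤ j) : Fl K I g j ≤ Fl K I g i := fun _ hs α =>
  loc_mono (Ideal.pow_le_pow_right (by omega)) g (hs α)

lemma Fl_dvd {g h : (MvPolynomial ν k)} (hd : g ∣ h) (j : ℕ) : Fl K I g j ≤ Fl K I h j := fun _ hs α =>
  loc_dvd _ hd (hs α)

lemma Fl_mul {i j : ℕ} {s t : MvPowerSeries ν K} (hs : s ∈ Fl K I g i) (ht : t ∈ Fl K I g j) :
    s * t ∈ Fl K I g (i + j) := fun α => by
  classical
  rw [MvPowerSeries.coeff_mul]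
  refine sum_mem fun p hp => ?_
  refine loc_mono ?_ g (mul_mem_loc (hs p.1) (ht p.2))
  rw [← pow_add]
  refine Ideal.pow_le_pow_right ?_
  rw [Finset.HasAntidiagonal.mem_antidiagonal] at hp
  rw [← hp, map_add]
  omega

lemma C_mem_Fl {j : ℕ} {z : K} (hz : z ∈ loc K (I ^ j) g) : MvPowerSeries.C z ∈ Fl K I g j := by
  classical
  intro α
  rw [MvPowerSeries.coeff_C]
  split_ifs with h
  · subst h; simpa using hz
  · exact zero_mem _

lemma one_mem_Fl : (1 : MvPowerSeries ν K) ∈ Fl K I g 0 := by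
  rw [← map_one (MvPowerSeries.C)]
  exact C_mem_Fl (by simpa using one_mem_loc g)

lemma mem_Fl_one {s : MvPowerSeries ν K} (h0 : MvPowerSeries.constantCoeff s ∈ loc K I g)
    (hs : s ∈ Fl K I g 0) : s ∈ Fl K I g 1 := fun α => by
  by_cases h : α = 0
  · subst h; simpa using h0
  · have : α.degree ≠ 0 := by rwa [Ne, Finsupp.degree_eq_zero_iff]
    have e : 1 - α.degree = 0 - α.degree := by omega
    rw [e]; exact hs α

lemma X_mem_Fl (i : ν) : (MvPowerSeries.X i : MvPowerSeries ν K) ∈ Fl K I g 0 := by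
  classical
  intro α
  rw [MvPowerSeries.coeff_X]
  split_ifs
  · simpa using one_mem_loc g
  · exact zero_mem _

lemma tay_mem_Fl_zero (p : (MvPolynomial ν k)) : tay K p ∈ Fl K I g 0 := by
  induction p using MvPolynomial.induction_on with
  | C a =>
    simp only [tay, MvPolynomial.coe_eval₂Hom, MvPolynomial.eval₂_C, RingHom.comp_apply]
    exact C_mem_Fl (by simpa using algebraMap_mem_loc (𝔞 := ⊤) (Submodule.mem_top) g)
  | add p q hp hq => rw [map_add]; exact add_mem hp hq
  | mul_X p i hp =>
    rw [map_mul]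
    refine Fl_mul (i := 0) (j := 0) hp ?_
    simp only [tay, MvPolynomial.coe_eval₂Hom, MvPolynomial.eval₂_X]
    exact add_mem (C_mem_Fl (by simpa using algebraMap_mem_loc (𝔞 := ⊤) (Submodule.mem_top) g)) (X_mem_Fl i)

lemma tay_mem_Fl {j : ℕ} {p : (MvPolynomial ν k)} (hp : p ∈ I ^ j) : tay K p ∈ Fl K I g j := by
  have h1 : ∀ p ∈ I, tay K p ∈ Fl K I g 1 := fun p hp =>
    mem_Fl_one (by rw [constantCoeff_tay]; exact algebraMap_mem_loc hp g) (tay_mem_Fl_zero p)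
  induction j generalizing p with
  | zero => exact tay_mem_Fl_zero p
  | succ j ih =>
    rw [pow_succ] at hp
    refine Submodule.mul_induction_on hp (fun a ha b hb => ?_) (fun a b ha hb => ?_)
    · rw [map_mul]; exact Fl_mul (ih ha) (h1 b hb)
    · rw [map_add]; exact add_mem ha hb

lemma Fl_cancel {j : ℕ} {w v : MvPowerSeries ν K} (hw : w ∈ Fl K I g 0)
    (hw0 : (MvPowerSeries.constantCoeff w)⁻¹ ∈ loc K ⊤ g)
    (hw0' : MvPowerSeries.constantCoeff w ≠ 0) (h : w * v ∈ Fl K I g j) : v ∈ Fl K I g j := by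
  classical
  suffices H : ∀ n α, Finsupp.degree α = n →
      MvPowerSeries.coeff α v ∈ loc K (I ^ (j - α.degree)) g from fun α => H _ α rfl
  intro n
  induction n using Nat.strong_induction_on with
  | _ n ih =>
    intro α hα
    have h1 := h α
    rw [MvPowerSeries.coeff_mul, ← Finset.add_sum_erase (Finset.HasAntidiagonal.antidiagonal α) _
      (show ((0, α) : (ν →₀ ℕ) × (ν →₀ ℕ)) ∈ _ from
        Finset.HasAntidiagonal.mem_antidiagonal.2 (zero_add α))] at h1
    have h2 : ∑ x ∈ (Finset.HasAntidiagonal.antidiagonal α).erase (0, α),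
        MvPowerSeries.coeff x.1 w * MvPowerSeries.coeff x.2 v ∈
          loc K (I ^ (j - α.degree)) g := by
      refine sum_mem fun x hx => ?_
      rw [Finset.mem_erase, Finset.HasAntidiagonal.mem_antidiagonal] at hx
      obtain ⟨hne, hx⟩ := hx
      have hx1 : x.1.degree ≠ 0 := fun h0 => by
        rw [Finsupp.degree_eq_zero_iff] at h0
        rw [h0, zero_add] at hx
        exact hne (Prod.ext h0 hx)
      have hd : α.degree = x.1.degree + x.2.degree := by rw [← hx, map_add]
      refine mul_left_mem_loc (by simpa using hw x.1)
        (loc_mono (Ideal.pow_le_pow_right (by omega)) g (ih x.2.degree (by omega) x.2 rfl))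
    have h3 := mul_left_mem_loc hw0 ((add_mem_cancel_right h2).1 h1)
    rw [MvPowerSeries.coeff_zero_eq_constantCoeff_apply, ← mul_assoc, inv_mul_cancel₀ hw0',
      one_mul] at h3
    exact h3

lemma sig_mem_Fl (hg : g ≠ 0) {j : ℕ} {z : K} (hz : z ∈ loc K (I ^ j) g) :
    sig k ν K z ∈ Fl K I g j := by
  obtain ⟨N, p, hp, hz⟩ := hz
  have hgN := algebraMap_ne (K := K) (pow_ne_zero N hg)
  refine Fl_cancel (w := tay K (g ^ N)) (tay_mem_Fl_zero _) ?_ ?_ ?_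
  · rw [constantCoeff_tay]
    exact ⟨N, 1, trivial, by rw [mul_inv_cancel₀ hgN, map_one]⟩
  · rwa [constantCoeff_tay]
  · rw [← sig_algebraMap, ← map_mul, hz, sig_algebraMap]
    exact tay_mem_Fl hp

lemma sig_sub_mem_Fl (hg : g ≠ 0) {z : K} (hz : z ∈ loc K ⊤ g) :
    sig k ν K z - MvPowerSeries.C z ∈ Fl K I g 1 := by
  refine mem_Fl_one (by simp [constantCoeff_sig]) (sub_mem (sig_mem_Fl hg (by simpa using hz))
    (C_mem_Fl (by simpa using hz)))

lemma coeff_tay (p : (MvPolynomial ν k)) (α : ν →₀ ℕ) : ∃ q : (MvPolynomial ν k), MvPowerSeries.coeff α (tay K p) =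
    algebraMap (MvPolynomial ν k) K q ∧ MvPolynomial.constantCoeff q = MvPolynomial.coeff α p := by
  let τ : (MvPolynomial ν k) →+* MvPolynomial ν (MvPolynomial ν k) := MvPolynomial.eval₂Hom (MvPolynomial.C.comp MvPolynomial.C)
    fun i => MvPolynomial.C (MvPolynomial.X i) + MvPolynomial.X i
  refine ⟨MvPolynomial.coeff α (τ p), ?_, ?_⟩
  · have : tay (ν := ν) (k := k) K = (MvPolynomial.coeToMvPowerSeries.ringHom).comp
        ((MvPolynomial.map (algebraMap (MvPolynomial ν k) K)).comp τ) := by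
      apply MvPolynomial.ringHom_ext <;> intro <;> simp [tay, τ]
    rw [this]
    simp [MvPolynomial.coeff_map]
  · have : (MvPolynomial.map (MvPolynomial.constantCoeff)).comp τ = RingHom.id (MvPolynomial ν k) := by
      apply MvPolynomial.ringHom_ext <;> intro <;> simp [τ]
    have h := congrArg (MvPolynomial.coeff α) (DFunLike.congr_fun this p)
    simpa [MvPolynomial.coeff_map] using h

end Taylor

section TaylorMatrix

variable {k : Type} [Field k] {ν : Type} [Finite ν] {K : Type} [Field K]
  [Algebra (MvPolynomial ν k) K] [IsFractionRing (MvPolynomial ν k) K]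
variable {m n l : Type} [Fintype m] [Fintype n] [Fintype l]

/-- Matrices of power series with entries in `Fl K I g j`. -/
def FM (K : Type) [Field K] [Algebra (MvPolynomial ν k) K] (m n : Type)
    (I : Ideal (MvPolynomial ν k)) (g : MvPolynomial ν k) (j : ℕ) :
    AddSubgroup (Matrix m n (MvPowerSeries ν K)) where
  carrier := {A | ∀ i l, A i l ∈ Fl K I g j}
  zero_mem' _ _ := zero_mem _
  add_mem' hx hy i l := add_mem (hx i l) (hy i l)
  neg_mem' hx i l := neg_mem (hx i l)

/-- The matrix of coefficients at `α`. -/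
def mc (α : ν →₀ ℕ) (A : Matrix m n (MvPowerSeries ν K)) : Matrix m n K :=
  A.map (MvPowerSeries.coeff α)

variable {I : Ideal (MvPolynomial ν k)} {g h h' : MvPolynomial ν k}

lemma mem_FM {j : ℕ} {A : Matrix m n (MvPowerSeries ν K)} :
    A ∈ FM K m n I g j ↔ ∀ α : ν →₀ ℕ, mc α A ∈ ml K m n (I ^ (j - α.degree)) g :=
  ⟨fun h α i l => h i l α, fun h i l α => h α i l⟩

lemma FM_mono {i j : ℕ} (hij : i ≤ j) : FM K m n I g j ≤ FM K m n I g i :=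
  fun _ hA i l => Fl_mono hij (hA i l)

lemma FM_mul {i j : ℕ} {A : Matrix m n (MvPowerSeries ν K)} {B : Matrix n l (MvPowerSeries ν K)}
    (hA : A ∈ FM K m n I h i) (hB : B ∈ FM K n l I h' j) (hd : h ∣ g) (hd' : h' ∣ g) :
    A * B ∈ FM K m l I g (i + j) := fun a b => by
  rw [Matrix.mul_apply]
  exact sum_mem fun t _ => Fl_mul (Fl_dvd hd _ (hA a t)) (Fl_dvd hd' _ (hB t b))

lemma FM_mul_left {j : ℕ} {A : Matrix m n (MvPowerSeries ν K)}
    {B : Matrix n l (MvPowerSeries ν K)}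
    (hA : A ∈ FM K m n I h 0) (hB : B ∈ FM K n l I h' j) (hd : h ∣ g) (hd' : h' ∣ g) :
    A * B ∈ FM K m l I g j := by
  simpa using FM_mul hA hB hd hd'

lemma FM_mul_right {j : ℕ} {A : Matrix m n (MvPowerSeries ν K)}
    {B : Matrix n l (MvPowerSeries ν K)}
    (hA : A ∈ FM K m n I h j) (hB : B ∈ FM K n l I h' 0) (hd : h ∣ g) (hd' : h' ∣ g) :
    A * B ∈ FM K m l I g j := by
  simpa using FM_mul hA hB hd hd'

lemma one_mem_FM [DecidableEq m] (g : MvPolynomial ν k) :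
    (1 : Matrix m m (MvPowerSeries ν K)) ∈ FM K m m I g 0 := fun i j => by
  rw [Matrix.one_apply]
  split_ifs
  · exact one_mem_Fl
  · exact zero_mem _

lemma pow_mem_FM [DecidableEq m] {u : Matrix m m (MvPowerSeries ν K)}
    (hu : u ∈ FM K m m I g 1) (i : ℕ) : u ^ i ∈ FM K m m I g i := by
  induction i with
  | zero => exact one_mem_FM g
  | succ i ih => rw [pow_succ]; exact FM_mul ih hu dvd_rfl dvd_rfl

/-- The matrix of Taylor expansions. -/
noncomputable abbrev sM (k : Type) [Field k] (ν : Type) [Finite ν] {K : Type} [Field K]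
    [Algebra (MvPolynomial ν k) K] [IsFractionRing (MvPolynomial ν k) K] {m n : Type}
    (A : Matrix m n K) : Matrix m n (MvPowerSeries ν K) :=
  A.map (sig k ν K)

/-- The matrix of constant power series. -/
noncomputable abbrev cM (ν : Type) {K : Type} [Field K] {m n : Type} (A : Matrix m n K) :
    Matrix m n (MvPowerSeries ν K) := A.map MvPowerSeries.C

lemma sM_mem (hg : g ≠ 0) {j : ℕ} {A : Matrix m n K} (hA : A ∈ ml K m n (I ^ j) g) :
    sM k ν A ∈ FM K m n I g j := fun i l => sig_mem_Fl hg (hA i l)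

lemma cM_mem {j : ℕ} {A : Matrix m n K} (hA : A ∈ ml K m n (I ^ j) g) :
    cM ν A ∈ FM K m n I g j := fun i l => C_mem_Fl (hA i l)

lemma sM_mem_zero (hg : g ≠ 0) {A : Matrix m n K} (hA : A ∈ ml K m n ⊤ g) :
    sM k ν A ∈ FM K m n I g 0 := sM_mem hg (by simpa using hA)

lemma cM_mem_zero {A : Matrix m n K} (hA : A ∈ ml K m n ⊤ g) :
    cM ν A ∈ FM K m n I g 0 := cM_mem (by simpa using hA)

lemma sM_sub_cM_mem (hg : g ≠ 0) {A : Matrix m n K} (hA : A ∈ ml K m n ⊤ g) :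
    sM k ν A - cM ν A ∈ FM K m n I g 1 := fun i l => sig_sub_mem_Fl hg (hA i l)

lemma sM_mul (A : Matrix m n K) (B : Matrix n l K) : sM k ν (A * B) = (sM k ν A * sM k ν B :
    Matrix m l (MvPowerSeries ν K)) := Matrix.map_mul

lemma sM_sub (A B : Matrix m n K) : sM k ν (A - B) = (sM k ν A - sM k ν B :
    Matrix m n (MvPowerSeries ν K)) := Matrix.map_sub _ (map_sub _) _ _

lemma cM_mul (A : Matrix m n K) (B : Matrix n l K) : cM ν (A * B) = cM ν A * cM ν B :=
  Matrix.map_mul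

lemma cM_sub (A B : Matrix m n K) : cM ν (A - B) = cM ν A - cM ν B :=
  Matrix.map_sub _ (map_sub _) _ _

lemma mc_sub (α : ν →₀ ℕ) (A B : Matrix m n (MvPowerSeries ν K)) :
    mc α (A - B) = mc α A - mc α B := Matrix.map_sub _ (map_sub _) _ _

lemma mc_add (α : ν →₀ ℕ) (A B : Matrix m n (MvPowerSeries ν K)) :
    mc α (A + B) = mc α A + mc α B := Matrix.map_add _ (map_add _) _ _

lemma mc_cM_mul (α : ν →₀ ℕ) (A : Matrix m n K) (B : Matrix n l (MvPowerSeries ν K)) :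
    mc α (cM ν A * B) = A * mc α B := by
  ext i j
  simp [mc, Matrix.mul_apply, MvPowerSeries.coeff_C_mul]

lemma mc_mul_cM (α : ν →₀ ℕ) (A : Matrix m n (MvPowerSeries ν K)) (B : Matrix n l K) :
    mc α (A * cM ν B) = mc α A * B := by
  ext i j
  simp [mc, Matrix.mul_apply, MvPowerSeries.coeff_mul_C]

lemma mc_mul [DecidableEq ν] (α : ν →₀ ℕ) (A : Matrix m n (MvPowerSeries ν K))
    (B : Matrix n l (MvPowerSeries ν K)) :
    mc α (A * B) = ∑ p ∈ Finset.HasAntidiagonal.antidiagonal α, mc p.1 A * mc p.2 B := by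
  ext i j
  simp only [mc, Matrix.mul_apply, Matrix.map_apply, map_sum, MvPowerSeries.coeff_mul,
    Matrix.sum_apply]
  exact Finset.sum_comm

end TaylorMatrix

section Sections

variable {P K : Type} [CommRing P] [IsDomain P] [Field K] [Algebra P K] [IsFractionRing P K]
variable {ι : Type} [Fintype ι] [DecidableEq ι] {r : ι → ℕ} {q : ℕ}

/-- Families of `q` sections modulo `𝔞`, as columns. -/
structure ColSec (g : ι → P) (Γ : ∀ a b, Matrix (Fin (r a)) (Fin (r b)) K) (𝔞 : Ideal P)
    (X : ∀ a, Matrix (Fin (r a)) (Fin q) K) : Prop where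
  mem : ∀ a, X a ∈ ml K _ _ ⊤ (g a)
  glue : ∀ a b, Γ a b * X b - X a ∈ ml K _ _ 𝔞 (g a * g b)

/-- Families of `q` sections of the dual modulo `𝔞`, as rows. -/
structure RowSec (g : ι → P) (Γ : ∀ a b, Matrix (Fin (r a)) (Fin (r b)) K) (𝔞 : Ideal P)
    (Y : ∀ a, Matrix (Fin q) (Fin (r a)) K) : Prop where
  mem : ∀ a, Y a ∈ ml K _ _ ⊤ (g a)
  glue : ∀ a b, Y a * Γ a b - Y b ∈ ml K _ _ 𝔞 (g a * g b)

variable {g : ι → P} {Γ γ : ∀ a b, Matrix (Fin (r a)) (Fin (r b)) K} {𝔞 : Ideal P}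

lemma ColSec.congr {X : ∀ a, Matrix (Fin (r a)) (Fin q) K} (hX : ColSec g Γ 𝔞 X)
    (h : ∀ a b, Γ a b - γ a b ∈ ml K _ _ 𝔞 (g a * g b)) : ColSec g γ 𝔞 X where
  mem := hX.mem
  glue a b := by
    have e : γ a b * X b - X a = Γ a b * X b - X a - (Γ a b - γ a b) * X b := by
      rw [Matrix.sub_mul]; abel
    rw [e]
    exact sub_mem (hX.glue a b) (ml_mul_right (h a b) (hX.mem b) dvd_rfl ⟨g a, by ring⟩)

lemma RowSec.congr {Y : ∀ a, Matrix (Fin q) (Fin (r a)) K} (hY : RowSec g Γ 𝔞 Y)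
    (h : ∀ a b, Γ a b - γ a b ∈ ml K _ _ 𝔞 (g a * g b)) : RowSec g γ 𝔞 Y where
  mem := hY.mem
  glue a b := by
    have e : Y a * γ a b - Y b = Y a * Γ a b - Y b - Y a * (Γ a b - γ a b) := by
      rw [Matrix.mul_sub]; abel
    rw [e]
    exact sub_mem (hY.glue a b) (ml_mul_left (hY.mem a) (h a b) ⟨g b, by ring⟩ dvd_rfl)

lemma H1Van.congr {s : ι → ℕ} {δ δ' : ∀ a b, Matrix (Fin (s a)) (Fin (s b)) K}
    (H : H1Van g 𝔞 γ δ)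
    (h : ∀ a b, Γ a b - γ a b ∈ ml K _ _ 𝔞 (g a * g b))
    (h' : ∀ a b, δ' a b - δ a b ∈ ml K _ _ 𝔞 (g a * g b)) : H1Van g 𝔞 Γ δ' := by
  intro x hx hdx
  have h1 := d1_congr h h' hx
  have h2 : d1 P γ δ x ∈ Z2 K g s r 𝔞 := by
    rw [← sub_sub_cancel (d1 P Γ δ' x) (d1 P γ δ x)]
    exact sub_mem hdx (by simpa using h1)
  obtain ⟨_, ⟨y, hy, rfl⟩, z, hz, rfl⟩ := Submodule.mem_sup.1 (H x hx h2)
  refine Submodule.mem_sup.2 ⟨_, ⟨y, hy, rfl⟩, z - (d0 P Γ δ' y - d0 P γ δ y),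
    sub_mem hz (by simpa using d0_congr h h' hy), by abel⟩

end Sections

section Flat

variable {k : Type} [Field k] {ν : Type} [Finite ν] {K : Type} [Field K]
  [Algebra (MvPolynomial ν k) K] [IsFractionRing (MvPolynomial ν k) K]
variable {ι : Type} [Fintype ι] [DecidableEq ι] {r : ι → ℕ}
  {Γ : ∀ a b, Matrix (Fin (r a)) (Fin (r b)) K} {g : ι → MvPolynomial ν k} {c : ℕ}
  {f : Fin c → MvPolynomial ν k}

lemma flat_step (hreg : RingTheory.Sequence.IsWeaklyRegular (MvPolynomial ν k) (List.ofFn f))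
    (hg : ∀ a, g a ≠ 0) {J j : ℕ} (hΓ : IsCoc g r Γ (Ideal.span (Set.range f) ^ J))
    (h1 : H1Van g (Ideal.span (Set.range f)) Γ Γ) (hj : 1 ≤ j) (hjJ : j < J)
    {h : ∀ a, Matrix (Fin (r a)) (Fin (r a)) (MvPowerSeries ν K)}
    (hh : ∀ a, 1 - h a ∈ FM K _ _ (Ideal.span (Set.range f)) (g a) 1)
    (hE : ∀ a b, sM k ν (Γ a b) * h b - h a * cM ν (Γ a b) ∈
      FM K _ _ (Ideal.span (Set.range f)) (g a * g b) j) :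
    ∃ h' : ∀ a, Matrix (Fin (r a)) (Fin (r a)) (MvPowerSeries ν K),
      (∀ a, 1 - h' a ∈ FM K _ _ (Ideal.span (Set.range f)) (g a) 1) ∧
      ∀ a b, sM k ν (Γ a b) * h' b - h' a * cM ν (Γ a b) ∈
        FM K _ _ (Ideal.span (Set.range f)) (g a * g b) (j + 1) := by
  classical
  set I := Ideal.span (Set.range f) with hI
  have hgg : ∀ a b, g a * g b ≠ 0 := fun a b => mul_ne_zero (hg a) (hg b)
  let E : ∀ a b, Matrix (Fin (r a)) (Fin (r b)) (MvPowerSeries ν K) :=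
    fun a b => sM k ν (Γ a b) * h b - h a * cM ν (Γ a b)
  have hh0 : ∀ a, h a ∈ FM K _ _ I (g a) 0 := fun a => by
    rw [← sub_sub_cancel 1 (h a)]
    exact sub_mem (one_mem_FM _) (FM_mono (Nat.zero_le _) (hh a))
  have hdE : ∀ a b c, cM ν (Γ a b) * E b c - E a c + E a b * cM ν (Γ b c) ∈
      FM K _ _ I (g a * g b * g c) (j + 1) := fun a b c => by
    have e : cM ν (Γ a b) * E b c - E a c + E a b * cM ν (Γ b c) =
        (sM k ν (Γ a b * Γ b c - Γ a c) * h c - h a * cM ν (Γ a b * Γ b c - Γ a c)) -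
          (sM k ν (Γ a b) - cM ν (Γ a b)) * E b c := by
      simp only [E, sM_sub, cM_sub, sM_mul, cM_mul, Matrix.mul_sub, Matrix.sub_mul,
        Matrix.mul_assoc]
      abel
    rw [e]
    refine sub_mem (FM_mono (by omega : j + 1 ≤ J) (sub_mem ?_ ?_)) ?_
    · exact FM_mul_right (sM_mem (mul_ne_zero (hgg a b) (hg c)) (hΓ.coc a b c)) (hh0 c) dvd_rfl
        ⟨g a * g b, by ring⟩
    · exact FM_mul_left (hh0 a) (cM_mem (hΓ.coc a b c)) ⟨g b * g c, by ring⟩ dvd_rfl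
    · rw [add_comm]
      exact FM_mul (sM_sub_cM_mem (hgg a b) (hΓ.mem a b)) (hE b c) ⟨g c, by ring⟩ ⟨g a, by ring⟩
  have key : ∀ α : ν →₀ ℕ, ∃ y : C0 K r r, y ∈ Z0 K g r r (I ^ (j - α.degree)) ∧
      (α.degree ≤ j → (fun t : ι × ι => mc α (E t.1 t.2)) - d0 (MvPolynomial ν k) Γ Γ y ∈
        Z1 K g r r (I ^ (j + 1 - α.degree))) := by
    intro α
    by_cases hα : α.degree ≤ j
    · obtain ⟨y, hy, hy'⟩ := h1.exact hreg hg hΓ.mem hΓ.mem (j := j - α.degree)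
        (x := fun t : ι × ι => mc α (E t.1 t.2)) (mem_Z1.2 fun a b => mem_FM.1 (hE a b) α)
        (mem_Z2.2 fun a b c => by
          have := mem_FM.1 (hdE a b c) α
          rw [mc_add, mc_sub, mc_cM_mul, mc_mul_cM] at this
          rw [d1_apply, show j - α.degree + 1 = j + 1 - α.degree by omega]
          exact this)
      refine ⟨y, hy, fun _ => ?_⟩
      rwa [show j + 1 - α.degree = j - α.degree + 1 by omega]
    · exact ⟨0, zero_mem _, fun h => absurd h hα⟩
  choose y hy hy' using key
  let Y : ∀ a, Matrix (Fin (r a)) (Fin (r a)) (MvPowerSeries ν K) :=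
    fun a => Matrix.of fun i l => fun α => y α a i l
  have hmY : ∀ α a, mc α (Y a) = y α a := fun α a => rfl
  have hYj : ∀ a, Y a ∈ FM K _ _ I (g a) j := fun a => mem_FM.2 fun α => by
    rw [hmY]; exact mem_Z0.1 (hy α) a
  refine ⟨fun a => h a - Y a, fun a => ?_, fun a b => ?_⟩
  · rw [← sub_add]
    exact add_mem (hh a) (FM_mono hj (hYj a))
  · have e : sM k ν (Γ a b) * (h b - Y b) - (h a - Y a) * cM ν (Γ a b) =
        (E a b - (cM ν (Γ a b) * Y b - Y a * cM ν (Γ a b))) -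
          (sM k ν (Γ a b) - cM ν (Γ a b)) * Y b := by
      simp only [E, Matrix.mul_sub, Matrix.sub_mul]
      abel
    rw [e]
    refine sub_mem (mem_FM.2 fun α => ?_) ?_
    · by_cases hα : α.degree ≤ j
      · have := mem_Z1.1 (hy' α hα) a b
        rw [mc_sub, mc_sub α (cM ν (Γ a b) * Y b), mc_cM_mul, mc_mul_cM, hmY, hmY]
        exact this
      · rw [show j + 1 - α.degree = j - α.degree by omega]
        refine mem_FM.1 (sub_mem (hE a b) (sub_mem ?_ ?_)) α
        · exact FM_mul_left (cM_mem_zero (hΓ.mem a b)) (hYj b) dvd_rfl ⟨g a, by ring⟩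
        · exact FM_mul_right (hYj a) (cM_mem_zero (hΓ.mem a b)) ⟨g b, by ring⟩ dvd_rfl
    · rw [add_comm]
      exact FM_mul (sM_sub_cM_mem (hgg a b) (hΓ.mem a b)) (hYj b) dvd_rfl ⟨g a, by ring⟩

/-- A rigid cocycle is isomorphic to its Taylor expansion. -/
lemma exists_flat (hreg : RingTheory.Sequence.IsWeaklyRegular (MvPolynomial ν k) (List.ofFn f))
    (hg : ∀ a, g a ≠ 0) {J : ℕ} (hΓ : IsCoc g r Γ (Ideal.span (Set.range f) ^ (J + 1)))
    (h1 : H1Van g (Ideal.span (Set.range f)) Γ Γ) :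
    ∃ h h' : ∀ a, Matrix (Fin (r a)) (Fin (r a)) (MvPowerSeries ν K),
      (∀ a, h a ∈ FM K _ _ (Ideal.span (Set.range f)) (g a) 0) ∧
      (∀ a, h' a ∈ FM K _ _ (Ideal.span (Set.range f)) (g a) 0) ∧
      (∀ a, h a * h' a - 1 ∈ FM K _ _ (Ideal.span (Set.range f)) (g a) (J + 1)) ∧
      (∀ a, h' a * h a - 1 ∈ FM K _ _ (Ideal.span (Set.range f)) (g a) (J + 1)) ∧
      ∀ a b, sM k ν (Γ a b) * h b - h a * cM ν (Γ a b) ∈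
        FM K _ _ (Ideal.span (Set.range f)) (g a * g b) (J + 1) := by
  set I := Ideal.span (Set.range f) with hI
  have H : ∀ j ≤ J, ∃ h : ∀ a, Matrix (Fin (r a)) (Fin (r a)) (MvPowerSeries ν K),
      (∀ a, 1 - h a ∈ FM K _ _ I (g a) 1) ∧
      ∀ a b, sM k ν (Γ a b) * h b - h a * cM ν (Γ a b) ∈ FM K _ _ I (g a * g b) (j + 1) := by
    intro j
    induction j with
    | zero =>
      refine fun _ => ⟨fun _ => 1, fun a => by simp, fun a b => ?_⟩
      beta_reduce
      rw [Matrix.mul_one, Matrix.one_mul]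
      exact sM_sub_cM_mem (mul_ne_zero (hg a) (hg b)) (hΓ.mem a b)
    | succ j ih =>
      intro hj
      obtain ⟨h, hh, hE⟩ := ih (by omega)
      exact flat_step hreg hg hΓ h1 (by omega) (by omega) hh hE
  obtain ⟨h, hh, hE⟩ := H J le_rfl
  refine ⟨h, fun a => ∑ i ∈ Finset.range (J + 1), (1 - h a) ^ i, fun a => ?_, fun a => ?_,
    fun a => ?_, fun a => ?_, hE⟩
  · rw [← sub_sub_cancel 1 (h a)]
    exact sub_mem (one_mem_FM _) (FM_mono (Nat.zero_le _) (hh a))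
  · exact sum_mem fun i _ => FM_mono (Nat.zero_le _) (pow_mem_FM (hh a) i)
  · have := mul_neg_geom_sum (1 - h a) (J + 1)
    rw [sub_sub_cancel] at this
    rw [this, sub_sub_cancel_left]
    exact neg_mem (pow_mem_FM (hh a) _)
  · have := geom_sum_mul_neg (1 - h a) (J + 1)
    rw [sub_sub_cancel] at this
    rw [this, sub_sub_cancel_left]
    exact neg_mem (pow_mem_FM (hh a) _)

/-- The Taylor coefficients of a pairing of sections are sums of pairings of sections. -/
theorem exists_taylor_sections [DecidableEq ν]
    (hreg : RingTheory.Sequence.IsWeaklyRegular (MvPolynomial ν k) (List.ofFn f))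
    (hg : ∀ a, g a ≠ 0) {J : ℕ} (hΓ : IsCoc g r Γ (Ideal.span (Set.range f) ^ (J + 1)))
    (h1 : H1Van g (Ideal.span (Set.range f)) Γ Γ) {q q' : ℕ}
    {X : ∀ a, Matrix (Fin (r a)) (Fin q) K} {Y : ∀ a, Matrix (Fin q') (Fin (r a)) K}
    (hX : ColSec g Γ (Ideal.span (Set.range f) ^ (J + 1)) X)
    (hY : RowSec g Γ (Ideal.span (Set.range f) ^ (J + 1)) Y) :
    ∃ (x : (ν →₀ ℕ) → ∀ a, Matrix (Fin (r a)) (Fin q) K)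
      (y : (ν →₀ ℕ) → ∀ a, Matrix (Fin q') (Fin (r a)) K),
      (∀ α, α.degree ≤ J → ColSec g Γ (Ideal.span (Set.range f)) (x α)) ∧
      (∀ α, α.degree ≤ J → RowSec g Γ (Ideal.span (Set.range f)) (y α)) ∧
      ∀ α, α.degree ≤ J → ∀ a, ∑ p ∈ Finset.HasAntidiagonal.antidiagonal α, y p.1 a * x p.2 a -
        mc α (sM k ν (Y a * X a)) ∈ ml K _ _ (Ideal.span (Set.range f)) (g a) := by
  obtain ⟨h, h', hh, hh', hhh', hh'h, hE⟩ := exists_flat hreg hg hΓ h1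
  set I := Ideal.span (Set.range f) with hI
  have hgg : ∀ a b, g a * g b ≠ 0 := fun a b => mul_ne_zero (hg a) (hg b)
  have hsX := fun a => sM_mem_zero (I := I) (hg a) (hX.mem a)
  have hsY := fun a => sM_mem_zero (I := I) (hg a) (hY.mem a)
  have hle : ∀ α : ν →₀ ℕ, α.degree ≤ J → I ^ (J + 1 - α.degree) ≤ I := fun α hα =>
    Ideal.pow_le_self (by omega)
  have hW : ∀ a b, cM ν (Γ a b) * (h' b * sM k ν (X b)) - h' a * sM k ν (X a) ∈
      FM K _ _ I (g a * g b) (J + 1) := fun a b => by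
    have e : cM ν (Γ a b) * (h' b * sM k ν (X b)) - h' a * sM k ν (X a) =
        h' a * sM k ν (Γ a b * X b - X a) + h' a * (sM k ν (Γ a b) * ((h b * h' b - 1) * sM k ν (X b)))
        - (h' a * ((sM k ν (Γ a b) * h b - h a * cM ν (Γ a b)) * (h' b * sM k ν (X b))) +
        (h' a * h a - 1) * (cM ν (Γ a b) * (h' b * sM k ν (X b)))) := by
      simp only [sM_sub, sM_mul, Matrix.mul_sub, Matrix.sub_mul, Matrix.mul_assoc, Matrix.one_mul]
      abel
    rw [e]
    have dl : g a ∣ g a * g b := ⟨g b, rfl⟩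
    have dr : g b ∣ g a * g b := ⟨g a, by ring⟩
    refine sub_mem (add_mem ?_ ?_) (add_mem ?_ ?_)
    · exact FM_mul_left (hh' a) (sM_mem (hgg a b) (hX.glue a b)) dl dvd_rfl
    · exact FM_mul_left (hh' a) (FM_mul_left (sM_mem_zero (hgg a b) (hΓ.mem a b))
        (FM_mul_right (hhh' b) (hsX b) dr dr) dvd_rfl dvd_rfl) dl dvd_rfl
    · exact FM_mul_left (hh' a) (FM_mul_right (hE a b) (FM_mul_left (hh' b) (hsX b) dr dr)
        dvd_rfl dvd_rfl) dl dvd_rfl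
    · exact FM_mul_right (hh'h a) (FM_mul_left (cM_mem_zero (hΓ.mem a b))
        (FM_mul_left (hh' b) (hsX b) dr dr) dvd_rfl dvd_rfl) dl dvd_rfl
  have hU : ∀ a b, sM k ν (Y a) * h a * cM ν (Γ a b) - sM k ν (Y b) * h b ∈
      FM K _ _ I (g a * g b) (J + 1) := fun a b => by
    have e : sM k ν (Y a) * h a * cM ν (Γ a b) - sM k ν (Y b) * h b =
        sM k ν (Y a * Γ a b - Y b) * h b -
          sM k ν (Y a) * (sM k ν (Γ a b) * h b - h a * cM ν (Γ a b)) := by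
      simp only [sM_sub, sM_mul, Matrix.mul_sub, Matrix.sub_mul, Matrix.mul_assoc]
      abel
    rw [e]
    have dl : g a ∣ g a * g b := ⟨g b, rfl⟩
    have dr : g b ∣ g a * g b := ⟨g a, by ring⟩
    exact sub_mem (FM_mul_right (sM_mem (hgg a b) (hY.glue a b)) (hh b) dvd_rfl dr)
      (FM_mul_left (hsY a) (hE a b) dl dvd_rfl)
  refine ⟨fun α a => mc α (h' a * sM k ν (X a)), fun α a => mc α (sM k ν (Y a) * h a),
    fun α hα => ⟨fun a => ?_, fun a b => ?_⟩, fun α hα => ⟨fun a => ?_, fun a b => ?_⟩,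
    fun α hα a => ?_⟩
  · exact ml_mono le_top _ (mem_FM.1 (FM_mul_left (hh' a) (hsX a) dvd_rfl dvd_rfl) α)
  · rw [← mc_cM_mul, ← mc_sub]
    exact ml_mono (hle α hα) _ (mem_FM.1 (hW a b) α)
  · exact ml_mono le_top _ (mem_FM.1 (FM_mul_left (hsY a) (hh a) dvd_rfl dvd_rfl) α)
  · rw [← mc_mul_cM, ← mc_sub]
    exact ml_mono (hle α hα) _ (mem_FM.1 (hU a b) α)
  · rw [← mc_mul, ← mc_sub]
    refine ml_mono (hle α hα) _ (mem_FM.1 ?_ α)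
    have e : sM k ν (Y a) * h a * (h' a * sM k ν (X a)) - sM k ν (Y a * X a) =
        sM k ν (Y a) * ((h a * h' a - 1) * sM k ν (X a)) := by
      simp only [sM_mul, Matrix.mul_sub, Matrix.sub_mul, Matrix.mul_assoc, Matrix.one_mul]
    rw [e]
    exact FM_mul_left (hsY a) (FM_mul_right (hhh' a) (hsX a) dvd_rfl dvd_rfl) dvd_rfl dvd_rfl

end Flat

section MittagLeffler

variable {P K : Type} [CommRing P] [IsDomain P] [Field K] [Algebra P K] [IsFractionRing P K]
variable {ι : Type} [Fintype ι] [DecidableEq ι] {r : ι → ℕ}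
  {γ : ∀ a b, Matrix (Fin (r a)) (Fin (r b)) K} {g : ι → P} {c : ℕ} {f : Fin c → P}

/-- The constant rank one. -/
abbrev rk1 (ι : Type) : ι → ℕ := fun _ => 1

/-- The trivial cocycle. -/
abbrev tr (ι K : Type) [Field K] : ∀ a b, Matrix (Fin (rk1 ι a)) (Fin (rk1 ι b)) K :=
  fun _ _ => (1 : Matrix (Fin 1) (Fin 1) K)

lemma tr_isCoc (g : ι → P) (𝔞 : Ideal P) : IsCoc g (rk1 ι) (tr ι K) 𝔞 where
  mem a b := one_mem_ml _
  coc a b c := by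
    have : (tr ι K a b * tr ι K b c - tr ι K a c) = 0 := by
      change (1 : Matrix (Fin 1) (Fin 1) K) * 1 - 1 = 0
      simp
    rw [this]; exact zero_mem _

/-- The failure of sections modulo `I ^ j` to lift modulo `I ^ (j + 1)`, in terms of a
parametrisation `Rep` of the first cohomology. -/
def obs (f : Fin c → P) (g : ι → P) (Γ : ℕ → ∀ a b, Matrix (Fin (r a)) (Fin (r b)) K)
    (hΓ : ∀ j a b, Γ (j + 1) a b - Γ j a b ∈
        ml K _ _ (Ideal.span (Set.range f) ^ (j + 1)) (g a * g b)) {m : ℕ}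
    (Rep : Submodule P (C1 K r (rk1 ι) × (Fin m → P))) (t : ℕ) :
    Submodule (MvPolynomial (Fin c) P) (Fin m → MvPolynomial (Fin c) P) where
  carrier := {p | ∀ j, ∃ v ∈ Z0 K g r (rk1 ι) (Ideal.span (Set.range f) ^ (j - t)),
    ∃ w : (Fin c →₀ ℕ) → C1 K r (rk1 ι), (∀ β, w β ∈ Z1 K g r (rk1 ι) ⊤) ∧
      d0 P (tr ι K) (Γ j) v - ∑ β ∈ expo c j, fm f β • w β ∈
        Z1 K g r (rk1 ι) (Ideal.span (Set.range f) ^ (j + 1)) ∧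
      ∀ β ∈ expo c j, (w β, fun i => MvPolynomial.coeff β (p i)) ∈ Rep}
  zero_mem' j := ⟨0, zero_mem _, 0, fun β => zero_mem _, by simp, fun β _ => Rep.zero_mem⟩
  add_mem' {p q} hp hq j := by
    obtain ⟨v, hv, w, hw, h1, h2⟩ := hp j
    obtain ⟨v', hv', w', hw', h1', h2'⟩ := hq j
    refine ⟨v + v', add_mem hv hv', w + w', fun β => add_mem (hw β) (hw' β), ?_, fun β hβ => ?_⟩
    · have := add_mem h1 h1'
      simp only [map_add, Pi.add_apply, smul_add, Finset.sum_add_distrib]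
      rwa [add_sub_add_comm]
    · simpa [Prod.mk_add_mk] using! Rep.add_mem (h2 β hβ) (h2' β hβ)
  smul_mem' F p hp := by
    classical
    set I := Ideal.span (Set.range f) with hI
    simp only [Set.mem_ofPred_eq] at hp ⊢
    induction F using MvPolynomial.induction_on generalizing p with
    | C a =>
      intro j
      obtain ⟨v, hv, w, hw, h1, h2⟩ := hp j
      refine ⟨a • v, Submodule.smul_mem _ _ hv, a • w, fun β => Submodule.smul_mem _ _ (hw β), ?_,
        fun β hβ => ?_⟩
      · have := Submodule.smul_mem _ a h1
        simp only [map_smul, Pi.smul_apply]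
        rw [smul_sub, Finset.smul_sum] at this
        convert this using 3
        exact smul_comm _ _ _
      · have := Rep.smul_mem a (h2 β hβ)
        have e : (fun i => MvPolynomial.coeff β
              (((MvPolynomial.C a : MvPolynomial (Fin c) P) • p) i)) =
            a • (fun i => MvPolynomial.coeff β (p i) : Fin m → P) := funext fun i =>
          MvPolynomial.coeff_C_mul β a (p i)
        rw [e]
        exact this
    | add F G hF hG =>
      intro j
      obtain ⟨v, hv, w, hw, h1, h2⟩ := hF p hp j
      obtain ⟨v', hv', w', hw', h1', h2'⟩ := hG p hp j
      refine ⟨v + v', add_mem hv hv', w + w', fun β => add_mem (hw β) (hw' β), ?_, fun β hβ => ?_⟩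
      · have := add_mem h1 h1'
        simp only [map_add, Pi.add_apply, smul_add, Finset.sum_add_distrib]
        rwa [add_sub_add_comm]
      · have := Rep.add_mem (h2 β hβ) (h2' β hβ)
        have e : (fun i => MvPolynomial.coeff β (((F + G) • p) i)) =
            (fun i => MvPolynomial.coeff β ((F • p) i)) +
              fun i => MvPolynomial.coeff β ((G • p) i) := funext fun i => by simp [add_mul]
        rw [e]
        exact this
    | mul_X F i hF =>
      rw [mul_comm, mul_smul]
      have hp' := hF p hp
      generalize F • p = p at hp'
      rintro (_ | j)
      · refine ⟨0, zero_mem _, 0, fun β => zero_mem _, by simp, fun β hβ => ?_⟩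
        have : β = 0 := by rwa [mem_expo, Finsupp.degree_eq_zero_iff] at hβ
        subst this
        have e : (fun l => MvPolynomial.coeff 0 (((MvPolynomial.X i : MvPolynomial (Fin c) P) • p) l)) = 0 :=
          funext fun l => by
            rw [Pi.smul_apply, smul_eq_mul, MvPolynomial.coeff_X_mul', if_neg (by simp)]
            rfl
        rw [e]
        exact Rep.zero_mem
      · obtain ⟨v, hv, w, hw, h1, h2⟩ := hp' j
        have hfi : f i ∈ I := Ideal.subset_span (Set.mem_range_self i)
        refine ⟨f i • v, mem_Z0.2 fun a => ?_,
          fun β => if i ∈ β.support then w (β - Finsupp.single i 1) else 0,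
          fun β => ?_, ?_, fun β hβ => ?_⟩
        · refine ml_mono ?_ _ (ml_smul_ideal hfi (mem_Z0.1 hv a))
          rw [← pow_succ']
          exact Ideal.pow_le_pow_right (by omega)
        · beta_reduce
          split_ifs
          · exact hw _
          · exact zero_mem _
        · have hs : ∑ β ∈ expo c (j + 1), fm f β •
              (if i ∈ β.support then w (β - Finsupp.single i 1) else 0) =
              f i • ∑ β ∈ expo c j, fm f β • w β := by
            rw [Finset.smul_sum]
            simp only [smul_ite, smul_zero]
            rw [← Finset.sum_filter]
            symm
            refine Finset.sum_bij' (fun β _ => β + Finsupp.single i 1)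
              (fun β _ => β - Finsupp.single i 1) (fun β hβ => ?_) (fun β hβ => ?_)
              (fun β hβ => ?_) (fun β hβ => ?_) (fun β hβ => ?_)
            · rw [Finset.mem_filter, mem_expo, map_add, mem_expo.1 hβ]
              simp
            · rw [Finset.mem_filter, mem_expo] at hβ
              rw [mem_expo]
              have h3 : Finsupp.single i 1 ≤ β := by
                rw [Finsupp.single_le_iff]
                exact Nat.one_le_iff_ne_zero.2 (Finsupp.mem_support_iff.1 hβ.2)
              have h4 := congrArg Finsupp.degree (tsub_add_cancel_of_le h3)
              rw [map_add, Finsupp.degree_single, hβ.1] at h4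
              omega
            · simp
            · rw [Finset.mem_filter] at hβ
              refine tsub_add_cancel_of_le ?_
              rw [Finsupp.single_le_iff]
              exact Nat.one_le_iff_ne_zero.2 (Finsupp.mem_support_iff.1 hβ.2)
            · rw [add_tsub_cancel_right, smul_smul]
              congr 1
              simp only [fm, Finsupp.add_apply, pow_add, Finset.prod_mul_distrib]
              rw [mul_comm]
              congr 1
              rw [Finset.prod_eq_single i (fun b _ hb => by
                rw [Finsupp.single_eq_of_ne hb, pow_zero]) (by simp)]
              simp
          rw [hs]
          have e : d0 P (tr ι K) (Γ (j + 1)) (f i • v) - f i • ∑ β ∈ expo c j, fm f β • w β =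
              f i • (d0 P (tr ι K) (Γ j) v - ∑ β ∈ expo c j, fm f β • w β) +
              f i • (d0 P (tr ι K) (Γ (j + 1)) v - d0 P (tr ι K) (Γ j) v) := by
            rw [map_smul]
            simp only [smul_sub]
            abel
          rw [e]
          refine mem_Z1.2 fun a b => add_mem ?_ ?_
          · have := ml_smul_ideal hfi (mem_Z1.1 h1 a b)
            rwa [← pow_succ'] at this
          · have h5 := d0_congr (γ' := tr ι K) (γ := tr ι K) (𝔞 := I ^ (j + 1)) (𝔟 := ⊤)
              (g := g) (fun a b => by simp) (hΓ j)
              (mem_Z0.2 fun a => ml_mono le_top _ (mem_Z0.1 hv a))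
            have := ml_smul_ideal hfi (mem_Z1.1 h5 a b)
            rwa [Ideal.mul_top, ← pow_succ'] at this
        · have h6 : (fun l => MvPolynomial.coeff β
              (((MvPolynomial.X i : MvPolynomial (Fin c) P) • p) l)) =
            if i ∈ β.support then fun l => MvPolynomial.coeff (β - Finsupp.single i 1) (p l)
              else 0 := by
            ext l
            rw [Pi.smul_apply, smul_eq_mul, MvPolynomial.coeff_X_mul']
            split_ifs <;> rfl
          rw [h6]
          split_ifs with h7
          · beta_reduce
            rw [if_pos h7]
            refine h2 _ ?_
            rw [mem_expo] at hβ ⊢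
            have h3 : Finsupp.single i 1 ≤ β := by
              rw [Finsupp.single_le_iff]
              exact Nat.one_le_iff_ne_zero.2 (Finsupp.mem_support_iff.1 h7)
            have h4 := congrArg Finsupp.degree (tsub_add_cancel_of_le h3)
            rw [map_add, Finsupp.degree_single, hβ] at h4
            omega
          · beta_reduce
            rw [if_neg h7]
            exact Rep.zero_mem

lemma obs_mono {Γ : ℕ → ∀ a b, Matrix (Fin (r a)) (Fin (r b)) K}
    (hΓ : ∀ j a b, Γ (j + 1) a b - Γ j a b ∈
        ml K _ _ (Ideal.span (Set.range f) ^ (j + 1)) (g a * g b)) {m : ℕ}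
    (Rep : Submodule P (C1 K r (rk1 ι) × (Fin m → P))) : Monotone (obs f g Γ hΓ Rep) := by
  intro s t hst p hp j
  obtain ⟨v, hv, h⟩ := hp j
  exact ⟨v, Dt_mono (Ideal.pow_le_pow_right (by omega)) hv, h⟩

/-- Sections modulo `I ^ j` lift modulo `I ^ (j + 1)` up to a correction of bounded colevel. -/
lemma exists_bounded_correction [IsNoetherianRing P]
    (hreg : RingTheory.Sequence.IsWeaklyRegular P (List.ofFn f)) (hg : ∀ a, g a ≠ 0)
    {Γ : ℕ → ∀ a b, Matrix (Fin (r a)) (Fin (r b)) K}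
    (hc : ∀ j, IsCoc g r (Γ j) (Ideal.span (Set.range f) ^ (j + 1)))
    (hΓγ : ∀ j a b, Γ j a b - γ a b ∈ ml K _ _ (Ideal.span (Set.range f)) (g a * g b))
    (hΓ : ∀ j a b, Γ (j + 1) a b - Γ j a b ∈
        ml K _ _ (Ideal.span (Set.range f) ^ (j + 1)) (g a * g b)) {m : ℕ}
    (Rep : Submodule P (C1 K r (rk1 ι) × (Fin m → P)))
    (hex : ∀ x ∈ Z1 K g r (rk1 ι) ⊤, d1 P (tr ι K) γ x ∈ Z2 K g r (rk1 ι) (Ideal.span (Set.range f)) →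
      ∃ u, (x, u) ∈ Rep)
    (hz : ∀ x ∈ Z1 K g r (rk1 ι) ⊤, (x, 0) ∈ Rep →
      x ∈ (Z0 K g r (rk1 ι) ⊤).map (d0 P (tr ι K) γ) ⊔ Z1 K g r (rk1 ι) (Ideal.span (Set.range f))) :
    ∃ t : ℕ, ∀ j, ∀ v ∈ Z0 K g r (rk1 ι) ⊤,
      d0 P (tr ι K) (Γ j) v ∈ Z1 K g r (rk1 ι) (Ideal.span (Set.range f) ^ j) →
      ∃ v' ∈ Z0 K g r (rk1 ι) (Ideal.span (Set.range f) ^ (j - t)),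
        d0 P (tr ι K) (Γ j) (v - v') ∈ Z1 K g r (rk1 ι) (Ideal.span (Set.range f) ^ (j + 1)) := by
  classical
  set I := Ideal.span (Set.range f) with hI
  have hmem : ∀ j a b, Γ j a b ∈ ml K _ _ ⊤ (g a * g b) := fun j => (hc j).mem
  have hγ : ∀ a b, γ a b ∈ ml K _ _ ⊤ (g a * g b) := fun a b => by
    have := sub_mem (hmem 0 a b) (ml_mono le_top _ (hΓγ 0 a b))
    simpa using this
  obtain ⟨t, ht⟩ := monotone_stabilizes_iff_noetherian.2 inferInstance
    ⟨obs f g Γ hΓ Rep, obs_mono hΓ Rep⟩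
  have hle : ∀ j, obs f g Γ hΓ Rep j ≤ obs f g Γ hΓ Rep t := fun j => by
    rcases le_total t j with h | h
    · exact (ht j h).ge
    · exact obs_mono hΓ Rep h
  refine ⟨t, fun j v hv hdv => ?_⟩
  have hd1 : d1 P (tr ι K) γ (d0 P (tr ι K) (Γ j) v) ∈ Z2 K g r (rk1 ι) (I ^ (j + 1)) := by
    have h1 := d1_d0 (tr_isCoc g _) (hc j) hv
    have h2 := d1_congr (γ' := tr ι K) (γ := tr ι K) (𝔞 := I) (𝔟 := I ^ j)
      (fun a b => by simp) (hΓγ j) hdv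
    rw [← pow_succ'] at h2
    have := sub_mem h1 h2
    rwa [sub_sub_cancel] at this
  obtain ⟨w, hw, hvw, hdw⟩ := lead_ker f hreg (d1 P (tr ι K) γ)
    (fun x hx => d1_mem (tr_isCoc g ⊤).mem hγ hx) (fun _ => mul_ne_zero (hg _) (hg _)) hdv hd1
  have : ∀ β, ∃ u, β ∈ expo c j → (w β, u) ∈ Rep := fun β => by
    by_cases h : β ∈ expo c j
    · obtain ⟨u, hu⟩ := hex _ (hw β) (hdw β h)
      exact ⟨u, fun _ => hu⟩
    · exact ⟨0, fun h' => absurd h' h⟩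
  choose u hu using this
  let p : Fin m → MvPolynomial (Fin c) P := fun i =>
    ∑ β ∈ expo c j, MvPolynomial.monomial β (u β i)
  have hp : ∀ β i, (p i).coeff β = if β ∈ expo c j then u β i else 0 := fun β i => by
    simp [p, MvPolynomial.coeff_sum, MvPolynomial.coeff_monomial]
  have hpj : p ∈ obs f g Γ hΓ Rep j := by
    intro j'
    by_cases hj : j' = j
    · subst hj
      refine ⟨v, by simpa using hv, w, hw, by rw [← hvw, sub_self]; exact zero_mem _, fun β hβ => ?_⟩
      simp only [hp, if_pos hβ]
      exact hu β hβ
    · refine ⟨0, zero_mem _, 0, fun β => zero_mem _, by simp, fun β hβ => ?_⟩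
      have : β ∉ expo c j := fun h => hj (by rw [← mem_expo.1 hβ, mem_expo.1 h])
      simp only [hp, if_neg this]
      exact Rep.zero_mem
  obtain ⟨v₁, hv₁, w₁, hw₁, hdv₁, hR⟩ := hle j hpj j
  have : ∀ β, ∃ y ∈ Z0 K g r (rk1 ι) ⊤, β ∈ expo c j →
      w β - w₁ β - d0 P (tr ι K) γ y ∈ Z1 K g r (rk1 ι) I := fun β => by
    by_cases h : β ∈ expo c j
    · have h1 := Rep.sub_mem (hu β h) (hR β h)
      simp only [hp, if_pos h] at h1
      have h2 : ((w β, u β) - (w₁ β, fun i => u β i) : C1 K r (rk1 ι) × (Fin m → P)) =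
          (w β - w₁ β, 0) := Prod.ext rfl (sub_self _)
      rw [h2] at h1
      obtain ⟨_, ⟨y, hy, rfl⟩, z, hz', he⟩ := Submodule.mem_sup.1 (hz _ (sub_mem (hw β) (hw₁ β)) h1)
      exact ⟨y, hy, fun _ => by rw [← he]; simpa using hz'⟩
    · exact ⟨0, zero_mem _, fun h' => absurd h' h⟩
  choose y hy hyw using this
  have hfm : ∀ {β}, β ∈ expo c j → fm f β ∈ I ^ j := fun hβ => fm_mem f _ (mem_expo.1 hβ).ge
  refine ⟨v₁ + ∑ β ∈ expo c j, fm f β • y β, add_mem hv₁ (sum_mem fun β hβ => ?_), ?_⟩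
  · exact Dt_mono (Ideal.pow_le_pow_right (Nat.sub_le _ _)) (Dt_ideal_smul (hfm hβ) (hy β))
  have e : d0 P (tr ι K) (Γ j) (v - (v₁ + ∑ β ∈ expo c j, fm f β • y β)) =
      (∑ β ∈ expo c j, fm f β • (w β - w₁ β - d0 P (tr ι K) γ (y β)
        - (d0 P (tr ι K) (Γ j) (y β) - d0 P (tr ι K) γ (y β)))) -
      (d0 P (tr ι K) (Γ j) v₁ - ∑ β ∈ expo c j, fm f β • w₁ β) := by
    rw [map_sub, map_add, map_sum, hvw]
    simp only [map_smul, smul_sub, Finset.sum_sub_distrib]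
    abel
  rw [e]
  refine sub_mem (Dt_sum_mem f (t := 1) fun β hβ => ?_) hdv₁
  rw [pow_one]
  refine sub_mem (hyw β hβ) ?_
  have := d0_congr (γ' := tr ι K) (γ := tr ι K) (𝔞 := I) (𝔟 := ⊤)
    (fun a b => by simp) (hΓγ j) (hy β)
  rwa [Ideal.mul_top] at this

end MittagLeffler

section Sections

variable {P K : Type} [CommRing P] [IsDomain P] [Field K] [Algebra P K] [IsFractionRing P K]
variable {ι : Type} [Fintype ι] [DecidableEq ι] {r : ι → ℕ}
  {γ : ∀ a b, Matrix (Fin (r a)) (Fin (r b)) K} {g : ι → P} {c : ℕ} {f : Fin c → P}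

/-- Up to powers of `g e`, a section lifts to any finite order. -/
lemma exists_lift_section
    {Γ : ℕ → ∀ a b, Matrix (Fin (r a)) (Fin (r b)) K}
    (hc : ∀ j, IsCoc g r (Γ j) (Ideal.span (Set.range f) ^ (j + 1)))
    (hΓγ : ∀ j a b, Γ j a b - γ a b ∈ ml K _ _ (Ideal.span (Set.range f)) (g a * g b))
    (hΓ : ∀ j a b, Γ (j + 1) a b - Γ j a b ∈
        ml K _ _ (Ideal.span (Set.range f) ^ (j + 1)) (g a * g b))
    {x : C0 K r (rk1 ι)} (hx : x ∈ Z0 K g r (rk1 ι) ⊤)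
    (hdx : d0 P (tr ι K) γ x ∈ Z1 K g r (rk1 ι) (Ideal.span (Set.range f))) (e : ι) (j : ℕ) :
    ∃ N : ℕ, ∃ v ∈ Z0 K g r (rk1 ι) ⊤,
      v - g e ^ N • x ∈ Z0 K g r (rk1 ι) (Ideal.span (Set.range f)) ∧
      d0 P (tr ι K) (Γ (j + 1)) v ∈ Z1 K g r (rk1 ι) (Ideal.span (Set.range f) ^ (j + 1)) := by
  set I := Ideal.span (Set.range f) with hI
  induction j with
  | zero =>
    refine ⟨0, x, hx, by simp, ?_⟩
    have := d0_congr (γ' := tr ι K) (γ := tr ι K) (𝔞 := I) (𝔟 := ⊤)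
      (fun a b => by simp) (hΓγ 1) hx
    rw [Ideal.mul_top] at this
    have := add_mem this hdx
    rw [sub_add_cancel] at this
    simpa using this
  | succ j ih =>
    obtain ⟨N, v, hv, hvx, hdv⟩ := ih
    set δ := d0 P (tr ι K) (Γ (j + 1)) v with hδ
    let y : C0 K r (rk1 ι) := fun a => - δ (a, e)
    have hy : y ∈ Dt K r (rk1 ι) (I ^ (j + 1)) fun a => g a * g e :=
      mem_Dt.2 fun a => Submodule.neg_mem _ (mem_Z1.1 hdv a e)
    obtain ⟨N₁, hN₁⟩ := Dt_descend hy
    have hz : δ - d0 P (tr ι K) (Γ (j + 1)) y ∈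
        Dt K (fun t : ι × ι => r t.1) (fun _ => 1) (I ^ (j + 2)) fun t => g t.1 * g t.2 * g e := by
      refine mem_Dt.2 fun ⟨a, b⟩ => ?_
      have h1 := mem_Z2.1 (d1_d0 (tr_isCoc g _) (hc (j + 1)) hv) a b e
      have h2 : (δ - d0 P (tr ι K) (Γ (j + 1)) y) (a, b) =
          d1 P (tr ι K) (Γ (j + 1)) δ (a, b, e) := by
        simp only [Pi.sub_apply, d0_apply, d1_apply, y, Matrix.mul_neg,
          Matrix.mul_one]
        abel
      rw [h2]
      exact h1
    obtain ⟨N₂, hN₂⟩ := Dt_descend hz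
    have h1 := hN₁ (max N₁ N₂) (le_max_left _ _)
    have h2 := hN₂ (max N₁ N₂) (le_max_right _ _)
    set N' := max N₁ N₂
    have h1' : g e ^ N' • y ∈ Z0 K g r (rk1 ι) ⊤ := Dt_mono le_top h1
    have hv' : g e ^ N' • v - g e ^ N' • y ∈ Z0 K g r (rk1 ι) ⊤ :=
      sub_mem (Submodule.smul_mem _ _ hv) h1'
    refine ⟨N' + N, g e ^ N' • v - g e ^ N' • y, hv', ?_, ?_⟩
    · have h3 : g e ^ N' • v - g e ^ N' • y - g e ^ (N' + N) • x =
          g e ^ N' • (v - g e ^ N • x) - g e ^ N' • y := by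
        rw [smul_sub, smul_smul, pow_add]; abel
      rw [h3]
      exact sub_mem (Submodule.smul_mem _ _ hvx)
        (Dt_mono (Ideal.pow_le_self (Nat.succ_ne_zero _)) h1)
    · have h3 := d0_congr (γ' := tr ι K) (γ := tr ι K) (𝔞 := I ^ (j + 1 + 1)) (𝔟 := ⊤)
        (fun a b => by simp) (hΓ (j + 1)) hv'
      rw [Ideal.mul_top] at h3
      have h4 : d0 P (tr ι K) (Γ (j + 1)) (g e ^ N' • v - g e ^ N' • y) ∈
          Z1 K g r (rk1 ι) (I ^ (j + 2)) := by
        rw [map_sub, map_smul, map_smul, ← smul_sub]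
        exact h2
      have := add_mem h3 h4
      rwa [sub_add_cancel] at this

/-- Up to a fixed power of `g e`, a section lifts to any finite order. -/
lemma exists_uniform_lift_section [IsNoetherianRing P]
    (hreg : RingTheory.Sequence.IsWeaklyRegular P (List.ofFn f)) (hg : ∀ a, g a ≠ 0)
    {Γ : ℕ → ∀ a b, Matrix (Fin (r a)) (Fin (r b)) K}
    (hc : ∀ j, IsCoc g r (Γ j) (Ideal.span (Set.range f) ^ (j + 1)))
    (hΓγ : ∀ j a b, Γ j a b - γ a b ∈ ml K _ _ (Ideal.span (Set.range f)) (g a * g b))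
    (hΓ : ∀ j a b, Γ (j + 1) a b - Γ j a b ∈
        ml K _ _ (Ideal.span (Set.range f) ^ (j + 1)) (g a * g b)) {m : ℕ}
    (Rep : Submodule P (C1 K r (rk1 ι) × (Fin m → P)))
    (hex : ∀ x ∈ Z1 K g r (rk1 ι) ⊤, d1 P (tr ι K) γ x ∈ Z2 K g r (rk1 ι) (Ideal.span (Set.range f)) →
      ∃ u, (x, u) ∈ Rep)
    (hz : ∀ x ∈ Z1 K g r (rk1 ι) ⊤, (x, 0) ∈ Rep →
      x ∈ (Z0 K g r (rk1 ι) ⊤).map (d0 P (tr ι K) γ) ⊔ Z1 K g r (rk1 ι) (Ideal.span (Set.range f)))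
    {x : C0 K r (rk1 ι)} (hx : x ∈ Z0 K g r (rk1 ι) ⊤)
    (hdx : d0 P (tr ι K) γ x ∈ Z1 K g r (rk1 ι) (Ideal.span (Set.range f))) (e : ι) :
    ∃ N : ℕ, ∀ n ≥ N, ∀ j, ∃ v ∈ Z0 K g r (rk1 ι) ⊤,
      v - g e ^ n • x ∈ Z0 K g r (rk1 ι) (Ideal.span (Set.range f)) ∧
      d0 P (tr ι K) (Γ j) v ∈ Z1 K g r (rk1 ι) (Ideal.span (Set.range f) ^ (j + 1)) := by
  set I := Ideal.span (Set.range f) with hI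
  obtain ⟨t, ht⟩ := exists_bounded_correction hreg hg hc hΓγ hΓ Rep hex hz
  obtain ⟨N, v₀, hv₀, hvx₀, hdv₀⟩ := exists_lift_section hc hΓγ hΓ hx hdx e t
  have key : ∀ j, ∃ v ∈ Z0 K g r (rk1 ι) ⊤, v - g e ^ N • x ∈ Z0 K g r (rk1 ι) I ∧
      d0 P (tr ι K) (Γ (t + 1 + j)) v ∈ Z1 K g r (rk1 ι) (I ^ (t + 1 + j)) := by
    intro j
    induction j with
    | zero => exact ⟨v₀, hv₀, hvx₀, hdv₀⟩
    | succ j ih =>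
      obtain ⟨v, hv, hvx, hdv⟩ := ih
      obtain ⟨v', hv', hdv'⟩ := ht _ v hv hdv
      have hvv : v - v' ∈ Z0 K g r (rk1 ι) ⊤ := sub_mem hv (Dt_mono le_top hv')
      refine ⟨v - v', hvv, ?_, ?_⟩
      · rw [sub_right_comm]
        exact sub_mem hvx (Dt_mono (Ideal.pow_le_self (by omega)) hv')
      · have h3 := d0_congr (γ' := tr ι K) (γ := tr ι K) (𝔞 := I ^ (t + 1 + j + 1)) (𝔟 := ⊤)
          (fun a b => by simp) (hΓ (t + 1 + j)) hvv
        rw [Ideal.mul_top] at h3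
        have := add_mem h3 hdv'
        rwa [sub_add_cancel] at this
  have hΓ' : ∀ j l a b, Γ (j + l) a b - Γ j a b ∈ ml K _ _ (I ^ (j + 1)) (g a * g b) := by
    intro j l a b
    induction l with
    | zero => simp
    | succ l ih =>
      have := add_mem (ml_mono (Ideal.pow_le_pow_right (by omega)) _ (hΓ (j + l) a b)) ih
      rwa [sub_add_sub_cancel] at this
  refine ⟨N, fun n hn j => ?_⟩
  obtain ⟨v, hv, hvx, hdv⟩ := key j
  refine ⟨g e ^ (n - N) • v, Submodule.smul_mem _ _ hv, ?_, ?_⟩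
  · have : g e ^ n • x = g e ^ (n - N) • (g e ^ N • x) := by
      rw [smul_smul, ← pow_add, Nat.sub_add_cancel hn]
    rw [this, ← smul_sub]
    exact Submodule.smul_mem _ _ hvx
  · rw [map_smul]
    refine Submodule.smul_mem _ _ ?_
    have h3 := d0_congr (γ' := tr ι K) (γ := tr ι K) (𝔞 := I ^ (j + 1)) (𝔟 := ⊤)
      (fun a b => by simp) (hΓ' j (t + 1)) hv
    rw [Ideal.mul_top] at h3
    rw [add_comm (t + 1) j] at hdv
    have := sub_mem (Dt_mono (Ideal.pow_le_pow_right (by omega)) hdv) h3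
    rwa [sub_sub_cancel] at this

end Sections

section Minors

variable {S : Type*} [CommRing S] {n N N' : Type*} [Fintype n] [DecidableEq n] [Fintype N]
  [Fintype N']

lemma det_mul_eq_sum (A : Matrix n N S) (C : Matrix N n S) :
    (A * C).det = ∑ φ : n → N, (∏ i, A i (φ i)) * (C.submatrix φ id).det := by
  classical
  have h : (A * C).det = Matrix.detRowAlternating.toMultilinearMap
      (fun i => ∑ l, A i l • C l) := by
    change Matrix.det _ = Matrix.det _
    congr 1
    ext i j
    simp [Matrix.mul_apply, Finset.sum_apply]
  rw [h, MultilinearMap.map_sum]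
  refine Finset.sum_congr rfl fun φ _ => ?_
  rw [MultilinearMap.map_smul_univ]
  rfl

lemma det_mul_mul_eq_zero (A : Matrix n N S) (B : Matrix N N' S) (C : Matrix N' n S)
    (h : ∀ (φ : n → N) (ψ : n → N'), (B.submatrix φ ψ).det = 0) : (A * B * C).det = 0 := by
  rw [Matrix.mul_assoc, det_mul_eq_sum]
  refine Finset.sum_eq_zero fun φ _ => ?_
  have h1 : (B * C).submatrix φ id = B.submatrix φ id * C := by
    ext i j; simp [Matrix.mul_apply]
  rw [h1, ← Matrix.det_transpose, Matrix.transpose_mul, det_mul_eq_sum, Finset.sum_eq_zero, mul_zero]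
  intro ψ _
  have h2 : (B.submatrix φ id).transpose.submatrix ψ id = (B.submatrix φ ψ).transpose := rfl
  rw [h2, Matrix.det_transpose, h, mul_zero]

lemma det_sub_det_mem (J : Ideal S) {A B : Matrix n n S} (h : ∀ i j, A i j - B i j ∈ J) :
    A.det - B.det ∈ J := by
  rw [← Ideal.Quotient.eq, RingHom.map_det, RingHom.map_det]
  congr 1
  ext i j
  exact Ideal.Quotient.eq.2 (h i j)

end Minors

section Trivial

variable {P K : Type} [CommRing P] [IsDomain P] [Field K] [Algebra P K] [IsFractionRing P K]
variable {ι : Type} [Fintype ι] [DecidableEq ι] {g : ι → P} {c : ℕ} {f : Fin c → P}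

/-- `P / I` is the ring of functions on the covering. -/
structure H0Triv (K : Type) [Field K] [Algebra P K] (g : ι → P) (I : Ideal P) : Prop where
  torsion : ∀ p : P, (∀ a, algebraMap P K p ∈ loc K I (g a)) → p ∈ I
  glue : ∀ z : ι → K, (∀ a, z a ∈ loc K ⊤ (g a)) → (∀ a b, z b - z a ∈ loc K I (g a * g b)) →
    ∃ p : P, ∀ a, z a - algebraMap P K p ∈ loc K I (g a)

lemma H0Triv.pow (H : H0Triv K g (Ideal.span (Set.range f)))
    (hreg : RingTheory.Sequence.IsWeaklyRegular P (List.ofFn f)) (hg : ∀ a, g a ≠ 0) {J : ℕ}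
    (z : ι → K) (hz : ∀ a, z a ∈ loc K ⊤ (g a))
    (hzz : ∀ a b, z b - z a ∈ loc K (Ideal.span (Set.range f) ^ J) (g a * g b)) :
    ∃ p : P, ∀ a, z a - algebraMap P K p ∈ loc K (Ideal.span (Set.range f) ^ J) (g a) := by
  induction J with
  | zero => exact ⟨0, fun a => by simpa using hz a⟩
  | succ J ih =>
    set I := Ideal.span (Set.range f) with hI
    obtain ⟨p, hp⟩ := ih fun a b => loc_mono (Ideal.pow_le_pow_right (Nat.le_succ _)) _ (hzz a b)
    choose w hw hzw using fun a => loc_expand (𝔞 := ⊤) f (hg a) (s := J) (z := z a - algebraMap P K p)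
      (by rw [Ideal.top_mul]; exact hp a)
    have hww : ∀ a b, ∀ β ∈ expo c J, w b β - w a β ∈ loc K I (g a * g b) := fun a b =>
      loc_qr f hreg (fun β => w b β - w a β) (fun β => sub_mem (loc_dvd _ ⟨g a, by ring⟩ (hw b β))
        (loc_dvd _ ⟨g b, by ring⟩ (hw a β))) (by
          simp only [mul_sub, Finset.sum_sub_distrib]
          rw [← hzw, ← hzw, sub_sub_sub_cancel_right]
          exact hzz a b)
    have : ∀ β, ∃ q : P, β ∈ expo c J → ∀ a, w a β - algebraMap P K q ∈ loc K I (g a) := fun β => by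
      by_cases h : β ∈ expo c J
      · obtain ⟨q, hq⟩ := H.glue (fun a => w a β) (fun a => hw a β) fun a b => hww a b β h
        exact ⟨q, fun _ => hq⟩
      · exact ⟨0, fun h' => absurd h' h⟩
    choose q hq using this
    refine ⟨p + ∑ β ∈ expo c J, fm f β * q β, fun a => ?_⟩
    have e : z a - algebraMap P K (p + ∑ β ∈ expo c J, fm f β * q β) =
        ∑ β ∈ expo c J, algebraMap P K (fm f β) * (w a β - algebraMap P K (q β)) := by
      simp only [mul_sub, Finset.sum_sub_distrib]
      rw [← hzw, map_add, map_sum]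
      simp only [map_mul]
      ring
    rw [e]
    refine sum_mem fun β hβ => ?_
    rw [pow_succ]
    exact mul_mem_loc (algebraMap_mem_loc (fm_mem f β (mem_expo.1 hβ).ge) _) (hq β hβ a)

end Trivial

section LiftFamilies

variable {P K : Type} [CommRing P] [IsDomain P] [Field K] [Algebra P K] [IsFractionRing P K]
variable {ι : Type} [Fintype ι] [DecidableEq ι] {r : ι → ℕ}
  {γ : ∀ a b, Matrix (Fin (r a)) (Fin (r b)) K} {g : ι → P} {c : ℕ} {f : Fin c → P} {I : Ideal P}

/-- The first Čech cohomology embeds, via correspondences, into a finite free module. -/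
def HasRep (g : ι → P) (I : Ideal P) (γ : ∀ a b, Matrix (Fin (r a)) (Fin (r b)) K) : Prop :=
  ∃ (m : ℕ) (Rep : Submodule P (C1 K r (rk1 ι) × (Fin m → P))),
    (∀ x ∈ Z1 K g r (rk1 ι) ⊤, d1 P (tr ι K) γ x ∈ Z2 K g r (rk1 ι) I → ∃ u, (x, u) ∈ Rep) ∧
    ∀ x ∈ Z1 K g r (rk1 ι) ⊤, (x, 0) ∈ Rep →
      x ∈ (Z0 K g r (rk1 ι) ⊤).map (d0 P (tr ι K) γ) ⊔ Z1 K g r (rk1 ι) I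

lemma ColSec.exists_lift [IsNoetherianRing P]
    (hreg : RingTheory.Sequence.IsWeaklyRegular P (List.ofFn f)) (hg : ∀ a, g a ≠ 0)
    {Γ : ℕ → ∀ a b, Matrix (Fin (r a)) (Fin (r b)) K}
    (hc : ∀ j, IsCoc g r (Γ j) (Ideal.span (Set.range f) ^ (j + 1)))
    (hΓγ : ∀ j a b, Γ j a b - γ a b ∈ ml K _ _ (Ideal.span (Set.range f)) (g a * g b))
    (hΓ : ∀ j a b, Γ (j + 1) a b - Γ j a b ∈
        ml K _ _ (Ideal.span (Set.range f) ^ (j + 1)) (g a * g b))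
    (hR : HasRep g (Ideal.span (Set.range f)) γ) {q : ℕ}
    {X : ∀ a, Matrix (Fin (r a)) (Fin q) K} (hX : ColSec g γ (Ideal.span (Set.range f)) X) (e : ι) :
    ∃ N : ℕ, ∀ n ≥ N, ∀ j, ∃ X' : ∀ a, Matrix (Fin (r a)) (Fin q) K,
      ColSec g (Γ j) (Ideal.span (Set.range f) ^ (j + 1)) X' ∧
      ∀ a, X' a - g e ^ n • X a ∈ ml K _ _ (Ideal.span (Set.range f)) (g a) := by
  obtain ⟨m, Rep, hex, hz⟩ := hR
  let x : Fin q → C0 K r (rk1 ι) := fun l a => Matrix.of fun i _ => X a i l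
  have hx : ∀ l, x l ∈ Z0 K g r (rk1 ι) ⊤ := fun l => mem_Z0.2 fun a i _ => hX.mem a i l
  have hdx : ∀ l, d0 P (tr ι K) γ (x l) ∈ Z1 K g r (rk1 ι) (Ideal.span (Set.range f)) := fun l =>
    mem_Z1.2 fun a b i j => by
      have := hX.glue a b i l
      rw [d0_apply, Matrix.mul_one]
      exact this
  choose N hN using fun l =>
    exists_uniform_lift_section hreg hg hc hΓγ hΓ Rep hex hz (hx l) (hdx l) e
  refine ⟨∑ l, N l, fun n hn j => ?_⟩
  choose v hv hvx hdv using fun l => hN l n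
    (le_trans (Finset.single_le_sum (f := N) (fun _ _ => Nat.zero_le _) (Finset.mem_univ l)) hn) j
  refine ⟨fun a => Matrix.of fun i l => v l a i 0, ⟨fun a i l => mem_Z0.1 (hv l) a i 0,
    fun a b i l => ?_⟩, fun a i l => mem_Z0.1 (hvx l) a i 0⟩
  have := mem_Z1.1 (hdv l) a b i 0
  rw [d0_apply, Matrix.mul_one] at this
  exact this

lemma IsCoc.transpose (h : IsCoc g r γ I) : IsCoc g r (fun a b => (γ b a).transpose) I where
  mem a b i j := by rw [mul_comm]; exact h.mem b a j i
  coc a b c i j := by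
    have := h.coc c b a j i
    have e : (γ b a).transpose * (γ c b).transpose - (γ c a).transpose =
        (γ c b * γ b a - γ c a).transpose := by
      rw [Matrix.transpose_sub, Matrix.transpose_mul]
    rw [e, show g a * g b * g c = g c * g b * g a by ring]
    exact this

lemma RowSec.transpose {q : ℕ} {Y : ∀ a, Matrix (Fin q) (Fin (r a)) K} (hY : RowSec g γ I Y) :
    ColSec g (fun a b => (γ b a).transpose) I (fun a => (Y a).transpose) where
  mem a i j := hY.mem a j i
  glue a b i j := by
    have := hY.glue b a j i
    rw [← Matrix.transpose_mul, mul_comm]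
    exact this

lemma ColSec.transpose {q : ℕ} {Y : ∀ a, Matrix (Fin q) (Fin (r a)) K}
    (hY : ColSec g (fun a b => (γ b a).transpose) I (fun a => (Y a).transpose)) :
    RowSec g γ I Y where
  mem a i j := hY.mem a j i
  glue a b i j := by
    have := hY.glue b a j i
    rw [← Matrix.transpose_mul, mul_comm] at this
    exact this

lemma RowSec.exists_lift [IsNoetherianRing P]
    (hreg : RingTheory.Sequence.IsWeaklyRegular P (List.ofFn f)) (hg : ∀ a, g a ≠ 0)
    {Γ : ℕ → ∀ a b, Matrix (Fin (r a)) (Fin (r b)) K}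
    (hc : ∀ j, IsCoc g r (Γ j) (Ideal.span (Set.range f) ^ (j + 1)))
    (hΓγ : ∀ j a b, Γ j a b - γ a b ∈ ml K _ _ (Ideal.span (Set.range f)) (g a * g b))
    (hΓ : ∀ j a b, Γ (j + 1) a b - Γ j a b ∈
        ml K _ _ (Ideal.span (Set.range f) ^ (j + 1)) (g a * g b))
    (hR : HasRep g (Ideal.span (Set.range f)) fun a b => (γ b a).transpose) {q : ℕ}
    {Y : ∀ a, Matrix (Fin q) (Fin (r a)) K} (hY : RowSec g γ (Ideal.span (Set.range f)) Y) (e : ι) :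
    ∃ N : ℕ, ∀ n ≥ N, ∀ j, ∃ Y' : ∀ a, Matrix (Fin q) (Fin (r a)) K,
      RowSec g (Γ j) (Ideal.span (Set.range f) ^ (j + 1)) Y' ∧
      ∀ a, Y' a - g e ^ n • Y a ∈ ml K _ _ (Ideal.span (Set.range f)) (g a) := by
  obtain ⟨N, hN⟩ := ColSec.exists_lift hreg hg (Γ := fun j a b => (Γ j b a).transpose)
    (γ := fun a b => (γ b a).transpose) (fun j => (hc j).transpose)
    (fun j a b i l => by rw [mul_comm]; exact hΓγ j b a l i)
    (fun j a b i l => by rw [mul_comm]; exact hΓ j b a l i) hR hY.transpose e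
  refine ⟨N, fun n hn j => ?_⟩
  obtain ⟨X', hX', h⟩ := hN n hn j
  exact ⟨fun a => (X' a).transpose, ColSec.transpose hX', fun a i l => h a l i⟩

lemma exists_initial_sections (hγ : IsCoc g r γ I)
    (hdiag : ∀ a, γ a a - 1 ∈ ml K _ _ I (g a * g a)) (e : ι) :
    ∃ n : ℕ, ColSec g γ I (fun a => g e ^ n • γ a e) ∧ RowSec g γ I (fun a => g e ^ n • γ e a) ∧
      ∀ a, g e ^ n • (γ e a * γ a e - 1) ∈ ml K _ _ I (g a) := by
  obtain ⟨N₁, h₁⟩ := Dt_descend (p := r) (q := fun _ => r e) (𝔞 := ⊤) (gT := g) (h := g e)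
    (x := fun a => γ a e) (mem_Dt.2 fun a => hγ.mem a e)
  obtain ⟨N₂, h₂⟩ := Dt_descend (p := fun _ => r e) (q := r) (𝔞 := ⊤) (gT := g) (h := g e)
    (x := fun a => γ e a) (mem_Dt.2 fun a => by rw [mul_comm]; exact hγ.mem e a)
  obtain ⟨N₃, h₃⟩ := Dt_descend (p := fun t : ι × ι => r t.1) (q := fun _ => r e) (𝔞 := I)
    (gT := fun t => g t.1 * g t.2) (h := g e) (x := fun t => γ t.1 t.2 * γ t.2 e - γ t.1 e)
    (mem_Dt.2 fun t => hγ.coc t.1 t.2 e)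
  obtain ⟨N₄, h₄⟩ := Dt_descend (p := fun _ => r e) (q := fun t : ι × ι => r t.2) (𝔞 := I)
    (gT := fun t => g t.1 * g t.2) (h := g e) (x := fun t => γ e t.1 * γ t.1 t.2 - γ e t.2)
    (mem_Dt.2 fun t => by
      rw [show g t.1 * g t.2 * g e = g e * g t.1 * g t.2 by ring]
      exact hγ.coc e t.1 t.2)
  obtain ⟨N₅, h₅⟩ := Dt_descend (p := fun _ : ι => r e) (q := fun _ => r e) (𝔞 := I)
    (gT := g) (h := g e * g e) (x := fun a => γ e a * γ a e - 1)
    (mem_Dt.2 fun a => by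
      rw [← sub_add_sub_cancel _ (γ e e)]
      exact add_mem (ml_dvd _ ⟨1, by ring⟩ (hγ.coc e a e)) (ml_dvd _ ⟨g a, by ring⟩ (hdiag e)))
  refine ⟨N₁ + N₂ + N₃ + N₄ + 2 * N₅, ⟨fun a => ?_, fun a b => ?_⟩, ⟨fun a => ?_, fun a b => ?_⟩,
    fun a => ?_⟩
  · exact mem_Dt.1 (h₁ _ (by omega)) a
  · rw [Matrix.mul_smul, ← smul_sub]
    exact mem_Dt.1 (h₃ _ (by omega)) (a, b)
  · exact mem_Dt.1 (h₂ _ (by omega)) a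
  · rw [Matrix.smul_mul, ← smul_sub]
    exact mem_Dt.1 (h₄ _ (by omega)) (a, b)
  · have := mem_Dt.1 (h₅ N₅ le_rfl) a
    rw [show g e ^ (N₁ + N₂ + N₃ + N₄ + 2 * N₅) =
      g e ^ (N₁ + N₂ + N₃ + N₄) * (g e * g e) ^ N₅ by ring, mul_smul]
    exact Submodule.smul_mem _ _ this

lemma H0Triv.pairing (H : H0Triv K g (Ideal.span (Set.range f)))
    (hreg : RingTheory.Sequence.IsWeaklyRegular P (List.ofFn f)) (hg : ∀ a, g a ≠ 0) {J q q' : ℕ}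
    {X : ∀ a, Matrix (Fin (r a)) (Fin q) K} {Y : ∀ a, Matrix (Fin q') (Fin (r a)) K}
    (hX : ColSec g γ (Ideal.span (Set.range f) ^ J) X)
    (hY : RowSec g γ (Ideal.span (Set.range f) ^ J) Y) :
    ∃ B : Matrix (Fin q') (Fin q) P, ∀ a, Y a * X a - B.map (algebraMap P K) ∈
      ml K _ _ (Ideal.span (Set.range f) ^ J) (g a) := by
  have h1 : ∀ a, Y a * X a ∈ ml K _ _ ⊤ (g a) := fun a =>
    ml_mul_left (hY.mem a) (hX.mem a) dvd_rfl dvd_rfl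
  have h2 : ∀ a b, Y b * X b - Y a * X a ∈
      ml K _ _ (Ideal.span (Set.range f) ^ J) (g a * g b) := fun a b => by
    have e : Y b * X b - Y a * X a =
        Y a * (γ a b * X b - X a) - (Y a * γ a b - Y b) * X b := by
      rw [Matrix.mul_sub, Matrix.sub_mul, Matrix.mul_assoc]; abel
    rw [e]
    exact sub_mem (ml_mul_left (hY.mem a) (hX.glue a b) ⟨g b, rfl⟩ dvd_rfl)
      (ml_mul_right (hY.glue a b) (hX.mem b) dvd_rfl ⟨g a, by ring⟩)
  choose B hB using fun i j => H.pow hreg hg (fun a => (Y a * X a) i j) (fun a => h1 a i j)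
    fun a b => h2 a b i j
  exact ⟨Matrix.of B, fun a i j => hB i j a⟩

end LiftFamilies

section Pairing

variable {k ν K : Type} [Field k] [Fintype ν] [DecidableEq ν] [Field K] [Algebra (MvPolynomial ν k) K]
  [IsFractionRing (MvPolynomial ν k) K]
variable {ι : Type} [Fintype ι] [DecidableEq ι] {r : ι → ℕ}
  {γ : ∀ a b, Matrix (Fin (r a)) (Fin (r b)) K} {g : ι → MvPolynomial ν k} {c : ℕ}
  {f : Fin c → MvPolynomial ν k} {I : Ideal (MvPolynomial ν k)}

lemma det_sum_monomial_eq_zero {n : Type} [Fintype n] [DecidableEq n] (D : Finset (ν →₀ ℕ))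
    (c : (ν →₀ ℕ) → (ν →₀ ℕ) → Matrix n n k)
    (h : ∀ φ ψ : n → D × n,
      (Matrix.of fun i l => c (φ i).1 (ψ l).1 (φ i).2 (ψ l).2).det = 0) :
    (Matrix.of fun i l => ∑ β ∈ D, ∑ β' ∈ D, MvPolynomial.monomial (β + β') (c β β' i l)).det =
      0 := by
  let A : Matrix n (D × n) (MvPolynomial ν k) := Matrix.of fun i p =>
    if p.2 = i then MvPolynomial.monomial p.1 1 else 0
  let B : Matrix (D × n) (D × n) (MvPolynomial ν k) := Matrix.of fun p p' =>
    MvPolynomial.C (c p.1 p'.1 p.2 p'.2)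
  let C : Matrix (D × n) n (MvPolynomial ν k) := Matrix.of fun p i =>
    if p.2 = i then MvPolynomial.monomial p.1 1 else 0
  have e : (Matrix.of fun i l => ∑ β ∈ D, ∑ β' ∈ D,
      MvPolynomial.monomial (β + β') (c β β' i l)) = A * B * C := by
    ext1 i l
    simp only [A, B, C, Matrix.mul_apply, Matrix.of_apply, Fintype.sum_prod_type, ite_mul, zero_mul,
      mul_ite, mul_zero, Finset.sum_ite_eq', Finset.mem_univ, if_true, Finset.sum_mul,
      MvPolynomial.C_apply, MvPolynomial.monomial_mul]
    rw [Finset.sum_comm]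
    rw [← Finset.sum_coe_sort D]
    refine Finset.sum_congr rfl fun β _ => ?_
    rw [← Finset.sum_coe_sort D]
    exact Finset.sum_congr rfl fun β' _ => by simp
  rw [e]
  refine det_mul_mul_eq_zero A B C fun φ ψ => ?_
  have e' : B.submatrix φ ψ = (MvPolynomial.C : k →+* MvPolynomial ν k).mapMatrix
      (Matrix.of fun i l => c (φ i).1 (ψ l).1 (φ i).2 (ψ l).2) := rfl
  rw [e', ← RingHom.map_det, h, map_zero]

lemma coeff_pairing (hg : ∀ a, g a ≠ 0) (H : H0Triv K g I)
    (hI : I ≤ RingHom.ker (MvPolynomial.constantCoeff (σ := ν) (R := k))) {J q q' : ℕ}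
    {X : ∀ a, Matrix (Fin (r a)) (Fin q) K} {Y : ∀ a, Matrix (Fin q') (Fin (r a)) K}
    {Z : Matrix (Fin q') (Fin q) (MvPolynomial ν k)}
    (hZ : ∀ a, Y a * X a - Z.map (algebraMap _ K) ∈ ml K _ _ (I ^ (J + 1)) (g a))
    {x : (ν →₀ ℕ) → ∀ a, Matrix (Fin (r a)) (Fin q) K}
    {y : (ν →₀ ℕ) → ∀ a, Matrix (Fin q') (Fin (r a)) K} {α : ν →₀ ℕ} (hα : α.degree ≤ J)
    (hxy : ∀ a, ∑ p ∈ Finset.HasAntidiagonal.antidiagonal α, y p.1 a * x p.2 a -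
        mc α (sM k ν (Y a * X a)) ∈ ml K _ _ I (g a))
    {B : (ν →₀ ℕ) → (ν →₀ ℕ) → Matrix (Fin q') (Fin q) (MvPolynomial ν k)}
    (hB : ∀ p ∈ Finset.HasAntidiagonal.antidiagonal α, ∀ a,
      y p.1 a * x p.2 a - (B p.1 p.2).map (algebraMap _ K) ∈ ml K _ _ I (g a)) (i : Fin q')
    (l : Fin q) :
    MvPolynomial.coeff α (Z i l) = ∑ p ∈ Finset.HasAntidiagonal.antidiagonal α,
      MvPolynomial.constantCoeff (B p.1 p.2 i l) := by
  obtain ⟨w, hw, hw'⟩ := coeff_tay (K := K) (Z i l) α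
  have key : ∑ p ∈ Finset.HasAntidiagonal.antidiagonal α, B p.1 p.2 i l - w ∈ I := by
    refine H.torsion _ fun a => ?_
    have h1 := sub_mem (sum_mem fun p hp => hB p hp a) (hxy a)
    have h2 := ml_mono (Ideal.pow_le_self (I := I) (show J + 1 - α.degree ≠ 0 by omega)) (g a)
      (mem_FM.1 (sM_mem (hg a) (hZ a)) α)
    have h3 := sub_mem h2 h1
    rw [sM_sub, mc_sub] at h3
    have h4 := h3 i l
    have e : mc α (sM k ν (Z.map (algebraMap _ K))) i l = algebraMap _ K w := by
      rw [← hw, ← sig_algebraMap]; rfl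
    refine Eq.mp (congrArg (· ∈ loc K I (g a)) ?_) h4
    simp only [Matrix.sub_apply, Matrix.sum_apply, e, Matrix.map_apply,
      Finset.sum_sub_distrib, map_sub, map_sum]
    ring
  have := RingHom.mem_ker.1 (hI key)
  rw [map_sub, map_sum, hw', sub_eq_zero] at this
  exact this.symm

/-- Some section pairing of size `r e` is nondegenerate at the origin. -/
theorem exists_nondegenerate_pairing
    (hreg : RingTheory.Sequence.IsWeaklyRegular (MvPolynomial ν k) (List.ofFn f))
    (hg : ∀ a, g a ≠ 0) (hγ : IsCoc g r γ (Ideal.span (Set.range f)))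
    (hdiag : ∀ a, γ a a - 1 ∈ ml K _ _ (Ideal.span (Set.range f)) (g a * g a))
    (h2 : H2Van g (Ideal.span (Set.range f)) γ γ) (h1 : H1Van g (Ideal.span (Set.range f)) γ γ)
    (hR : HasRep g (Ideal.span (Set.range f)) γ)
    (hR' : HasRep g (Ideal.span (Set.range f)) fun a b => (γ b a).transpose)
    (H : H0Triv K g (Ideal.span (Set.range f)))
    (hI : Ideal.span (Set.range f) ≤ RingHom.ker (MvPolynomial.constantCoeff (σ := ν) (R := k)))
    (e : ι) (he : ∀ N, ∃ J, g e ^ N ∉ Ideal.span (Set.range f) ⊔ MvPolynomial.idealOfVars ν k ^ J) :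
    ∃ (X : ∀ a, Matrix (Fin (r a)) (Fin (r e)) K) (Y : ∀ a, Matrix (Fin (r e)) (Fin (r a)) K)
      (B : Matrix (Fin (r e)) (Fin (r e)) (MvPolynomial ν k)),
      ColSec g γ (Ideal.span (Set.range f)) X ∧ RowSec g γ (Ideal.span (Set.range f)) Y ∧
      (∀ a, Y a * X a - B.map (algebraMap _ K) ∈ ml K _ _ (Ideal.span (Set.range f)) (g a)) ∧
      MvPolynomial.constantCoeff B.det ≠ 0 := by
  set I := Ideal.span (Set.range f) with hIdef
  by_contra! hcon
  obtain ⟨Γ, hΓ, hΓγ, hΓs⟩ := exists_lift hreg hg hγ h2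
  obtain ⟨n, hX₀, hY₀, hXY₀⟩ := exists_initial_sections hγ hdiag e
  obtain ⟨N₁, hN₁⟩ := ColSec.exists_lift hreg hg hΓ hΓγ hΓs hR hX₀ e
  obtain ⟨N₂, hN₂⟩ := RowSec.exists_lift hreg hg hΓ hΓγ hΓs hR' hY₀ e
  obtain ⟨J, hJ⟩ := he (((N₁ + N₂) + (n + ((N₁ + N₂) + n))) * r e)
  obtain ⟨X, hX, hXX⟩ := hN₁ (N₁ + N₂) (by omega) J
  obtain ⟨Y, hY, hYY⟩ := hN₂ (N₁ + N₂) (by omega) J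
  obtain ⟨Z, hZ⟩ := H.pairing hreg hg hX hY
  have h1' : H1Van g I (Γ J) (Γ J) := h1.congr (hΓγ J) (hΓγ J)
  obtain ⟨x, y, hx, hy, hxy⟩ := exists_taylor_sections hreg hg (hΓ J) h1' hX hY
  have hx' : ∀ α, α.degree ≤ J → ColSec g γ I (x α) := fun α hα => (hx α hα).congr (hΓγ J)
  have hy' : ∀ α, α.degree ≤ J → RowSec g γ I (y α) := fun α hα => (hy α hα).congr (hΓγ J)
  have hP : ∀ β β', ∃ B : Matrix (Fin (r e)) (Fin (r e)) (MvPolynomial ν k),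
      β.degree ≤ J → β'.degree ≤ J →
        ∀ a, y β a * x β' a - B.map (algebraMap _ K) ∈ ml K _ _ I (g a) := fun β β' => by
    by_cases h : β.degree ≤ J ∧ β'.degree ≤ J
    · obtain ⟨B, hB⟩ := H.pairing (J := 1) hreg hg (by simpa using hx' β' h.2)
        (by simpa using hy' β h.1)
      exact ⟨B, fun _ _ => by simpa using hB⟩
    · exact ⟨0, fun h₁ h₂ => absurd ⟨h₁, h₂⟩ h⟩
  choose B hB using hP
  have hD := Finsupp.finite_of_degree_le (σ := ν) J
  let D := hD.toFinset
  have hDmem : ∀ {β : ν →₀ ℕ}, β ∈ D ↔ β.degree ≤ J := by simp [D]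
  let W : Matrix (Fin (r e)) (Fin (r e)) (MvPolynomial ν k) := Matrix.of fun i l =>
    ∑ β ∈ D, ∑ β' ∈ D, MvPolynomial.monomial (β + β') (MvPolynomial.constantCoeff (B β β' i l))
  have hW : W.det = 0 := by
    refine det_sum_monomial_eq_zero D (fun β β' => Matrix.of fun i l =>
      MvPolynomial.constantCoeff (B β β' i l)) fun φ ψ => ?_
    have hφ : ∀ i, ((φ i).1 : ν →₀ ℕ).degree ≤ J := fun i => hDmem.1 (φ i).1.2
    have hψ : ∀ i, ((ψ i).1 : ν →₀ ℕ).degree ≤ J := fun i => hDmem.1 (ψ i).1.2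
    have := hcon (fun a => Matrix.of fun i l => x (ψ l).1 a i (ψ l).2)
      (fun a => Matrix.of fun i l => y (φ i).1 a (φ i).2 l)
      (Matrix.of fun i l => B (φ i).1 (ψ l).1 (φ i).2 (ψ l).2)
      ⟨fun a i l => (hx' _ (hψ l)).mem a i _, fun a b i l => (hx' _ (hψ l)).glue a b i _⟩
      ⟨fun a i l => (hy' _ (hφ i)).mem a _ l, fun a b i l => (hy' _ (hφ i)).glue a b _ l⟩
      fun a i l => hB _ _ (hφ i) (hψ l) a _ _
    rw [RingHom.map_det] at this
    exact this
  have hZW : Z.det ∈ MvPolynomial.idealOfVars ν k ^ (J + 1) := by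
    rw [← sub_zero Z.det, ← hW]
    refine det_sub_det_mem _ fun i l => ?_
    rw [MvPolynomial.mem_pow_idealOfVars_iff']
    intro α hα
    rw [MvPolynomial.coeff_sub, sub_eq_zero, coeff_pairing hg H hI hZ (by omega) (hxy α (by omega))
      (fun p hp => hB _ _ ?_ ?_)]
    · simp only [W, Matrix.of_apply, MvPolynomial.coeff_sum, MvPolynomial.coeff_monomial]
      rw [← Finset.sum_product' (f := fun β β' => if β + β' = α then
        MvPolynomial.constantCoeff (B β β' i l) else 0), ← Finset.sum_filter]
      refine Finset.sum_congr ?_ fun _ _ => rfl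
      ext p
      simp only [Finset.mem_filter, Finset.mem_product, Finset.HasAntidiagonal.mem_antidiagonal,
        hDmem]
      refine ⟨fun h => ⟨?_, h⟩, fun h => h.2⟩
      have := congrArg Finsupp.degree h
      rw [map_add] at this
      omega
    all_goals
      have := congrArg Finsupp.degree (Finset.HasAntidiagonal.mem_antidiagonal.1 hp)
      rw [map_add] at this
      omega
  refine hJ ?_
  have hZI : ∀ i l, Z i l -
      (g e ^ (N₁ + N₂ + (n + (N₁ + N₂ + n))) • (1 : Matrix (Fin (r e)) (Fin (r e)) _)) i l ∈ I := by
    intro i l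
    refine H.torsion _ fun a => ?_
    have t1 := ml_mono (Ideal.pow_le_self (I := I) (Nat.succ_ne_zero J)) (g a) (hZ a)
    have t2 := ml_mul_left (hY.mem a) (hXX a) dvd_rfl dvd_rfl
    have t3 := ml_mul_right (hYY a) (Submodule.smul_mem _ (g e ^ (N₁ + N₂)) (hX₀.mem a)) dvd_rfl
      dvd_rfl
    have t4 := Submodule.smul_mem _ (g e ^ (N₁ + N₂ + (n + (N₁ + N₂)))) (hXY₀ a)
    have := sub_mem (add_mem t2 (add_mem t3 t4)) t1 i l
    refine Eq.mp (congrArg (· ∈ loc K I (g a)) ?_) this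
    simp only [pow_add, mul_smul, Matrix.mul_sub, Matrix.sub_mul, Matrix.smul_mul, Matrix.mul_smul,
      Matrix.sub_apply, Matrix.add_apply, Matrix.smul_apply, Matrix.map_apply, smul_sub, map_sub]
    have e1 : ∀ s : MvPolynomial ν k, algebraMap _ K (s • (1 : Matrix (Fin (r e)) (Fin (r e))
        (MvPolynomial ν k)) i l) = s • (1 : Matrix (Fin (r e)) (Fin (r e)) K) i l := fun s => by
      by_cases h : i = l <;> simp [Matrix.one_apply, h, Algebra.smul_def]
    simp only [← mul_smul, e1]
    ring_nf
  have := det_sub_det_mem _ hZI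
  rw [Matrix.det_smul, Matrix.det_one, mul_one, Fintype.card_fin, ← pow_mul] at this
  rw [← sub_sub_cancel Z.det (g e ^ _)]
  exact sub_mem (Ideal.mem_sup_right (Ideal.pow_le_pow_right (Nat.le_succ J) hZW))
    (Ideal.mem_sup_left this)

end Pairing

section Frames

variable {P K R : Type} [CommRing P] [IsDomain P] [Field K] [Algebra P K] [IsFractionRing P K]
  [CommRing R] [Algebra P R] {I : Ideal P}

lemma loc_cancel {𝔞 : Ideal P} {p h : P} {z : K} (hp : p ≠ 0) (hd : p ∣ h)
    (hz : algebraMap P K p * z ∈ loc K 𝔞 h) : z ∈ loc K 𝔞 h := by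
  have := mul_left_mem_loc (inv_mem_loc_of_dvd (K := K) hp hd) hz
  rwa [inv_mul_cancel_left₀ (algebraMap_ne hp)] at this

/-- `z : K` and `w : R` have a common lift to `P`, up to `I` after inverting `h`. -/
def Sim (I : Ideal P) (h : P) (z : K) (w : R) : Prop :=
  ∃ p : P, algebraMap P R p = w ∧ z - algebraMap P K p ∈ loc K I h

variable {h h' : P} {z z' : K} {w w' : R}

lemma Sim.add (H : Sim I h z w) (H' : Sim I h z' w') : Sim I h (z + z') (w + w') := by
  obtain ⟨p, rfl, hp⟩ := H
  obtain ⟨q, rfl, hq⟩ := H'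
  refine ⟨p + q, map_add _ _ _, ?_⟩
  rw [map_add, add_sub_add_comm]
  exact add_mem hp hq

lemma Sim.sub (H : Sim I h z w) (H' : Sim I h z' w') : Sim I h (z - z') (w - w') := by
  obtain ⟨p, rfl, hp⟩ := H
  obtain ⟨q, rfl, hq⟩ := H'
  refine ⟨p - q, map_sub _ _ _, ?_⟩
  rw [map_sub, sub_sub_sub_comm]
  exact sub_mem hp hq

lemma Sim.mul (H : Sim I h z w) (H' : Sim I h z' w') : Sim I h (z * z') (w * w') := by
  obtain ⟨p, rfl, hp⟩ := H
  obtain ⟨q, rfl, hq⟩ := H'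
  refine ⟨p * q, map_mul _ _ _, ?_⟩
  rw [map_mul, show z * z' - algebraMap P K p * algebraMap P K q =
    (z - algebraMap P K p) * (z' - algebraMap P K q) + algebraMap P K p * (z' - algebraMap P K q) +
      (z - algebraMap P K p) * algebraMap P K q by ring]
  exact add_mem (add_mem (mul_left_mem_loc (loc_mono le_top _ hp) hq)
    (mul_left_mem_loc (algebraMap_mem_loc (𝔞 := ⊤) Submodule.mem_top _) hq))
    (mul_right_mem_loc hp (algebraMap_mem_loc (𝔞 := ⊤) Submodule.mem_top _))

lemma Sim.of_alg (p : P) : Sim I h (algebraMap P K p) (algebraMap P R p) :=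
  ⟨p, rfl, by simp⟩

lemma Sim.of_mem (hz : z ∈ loc K I h) : Sim I h z (0 : R) := ⟨0, map_zero _, by simpa using hz⟩

lemma Sim.zero : Sim I h (0 : K) (0 : R) := Sim.of_mem (zero_mem _)

lemma Sim.sum {T : Type*} (S : Finset T) {z : T → K} {w : T → R}
    (H : ∀ t ∈ S, Sim I h (z t) (w t)) : Sim I h (∑ t ∈ S, z t) (∑ t ∈ S, w t) := by
  classical
  induction S using Finset.induction_on with
  | empty => simpa using Sim.zero
  | insert t S ht ih =>
    rw [Finset.sum_insert ht, Finset.sum_insert ht]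
    exact (H t (Finset.mem_insert_self _ _)).add (ih fun s hs => H s (Finset.mem_insert_of_mem hs))

lemma Sim.dvd (H : Sim I h z w) (hd : h ∣ h') : Sim I h' z w :=
  ⟨H.choose, H.choose_spec.1, loc_dvd _ hd H.choose_spec.2⟩

lemma Sim.congr (H : Sim I h z w) (hz : z' - z ∈ loc K I h) : Sim I h z' w := by
  simpa using H.add (Sim.of_mem (R := R) hz)

lemma Sim.mem_top (H : Sim I h z w) : z ∈ loc K ⊤ h := by
  obtain ⟨p, -, hp⟩ := H
  rw [← sub_add_cancel z (algebraMap P K p)]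
  exact add_mem (loc_mono le_top _ hp) (algebraMap_mem_loc (𝔞 := ⊤) Submodule.mem_top _)

lemma Sim.mem (hI : ∀ p, algebraMap P R p = 0 ↔ p ∈ I) (H : Sim I h z (0 : R)) :
    z ∈ loc K I h := by
  obtain ⟨p, h0, hp⟩ := H
  rw [← sub_add_cancel z (algebraMap P K p)]
  exact add_mem hp (algebraMap_mem_loc ((hI p).1 h0) _)

lemma Sim.exists_pow (hI : ∀ p, algebraMap P R p = 0 ↔ p ∈ I) (H : Sim I h z w)
    (hz : z ∈ loc K I h) : ∃ N : ℕ, algebraMap P R h ^ N * w = 0 := by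
  obtain ⟨p, rfl, hp⟩ := H
  obtain ⟨N, hN⟩ := mem_of_algebraMap_mem_loc (K := K) (p := p) (g := h) (𝔞 := I) (by
    rw [← sub_sub_cancel z (algebraMap P K p)]
    exact Submodule.sub_mem _ hz hp)
  exact ⟨N, by rw [← map_pow, ← map_mul]; exact (hI _).2 hN⟩

lemma Sim.exists_sim (hs : Function.Surjective (algebraMap P R)) (h : P) (w : R) :
    ∃ z : K, Sim I h z w := by
  obtain ⟨p, rfl⟩ := hs w
  exact ⟨_, Sim.of_alg p⟩

/-- Exact quotients by `p ∣ h`. -/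
lemma Sim.exists_div (hs : Function.Surjective (algebraMap P R)) {p h : P} (hp : p ≠ 0)
    (w : R) : ∃ z : K, Sim I h (algebraMap P K p * z) w := by
  obtain ⟨z, hz⟩ := Sim.exists_sim (K := K) (I := I) hs h w
  exact ⟨(algebraMap P K p)⁻¹ * z, by rwa [mul_inv_cancel_left₀ (algebraMap_ne hp)]⟩

variable {ι : Type} [Fintype ι] [DecidableEq ι]

/-- Trivialisations of a module on the basic open sets of `g`, with denominators cleared. -/
structure Frame (g : ι → P) (r : ι → ℕ) (M : Type) [AddCommGroup M] [Module R M] where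
  b : ∀ a, Fin (r a) → M
  φ : ∀ a, Fin (r a) → M →ₗ[R] R
  φ_b : ∀ a i j, φ a i (b a j) = if i = j then algebraMap P R (g a) else 0
  sum : ∀ a x, ∑ i, φ a i x • b a i = algebraMap P R (g a) • x

variable {g : ι → P} {r s : ι → ℕ} {M N : Type} [AddCommGroup M] [Module R M]
  [AddCommGroup N] [Module R N]

/-- The transition functions of a frame. -/
def Frame.IsTrans (F : Frame (R := R) g r M) (I : Ideal P)
    (γ : ∀ a b, Matrix (Fin (r a)) (Fin (r b)) K) : Prop :=
  ∀ a b i j, Sim I (g a) (algebraMap P K (g a) * γ a b i j) (F.φ a i (F.b b j))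

lemma Frame.exists_isTrans (hs : Function.Surjective (algebraMap P R)) (hg : ∀ a, g a ≠ 0)
    (F : Frame (R := R) g r M) (I : Ideal P) :
    ∃ γ : ∀ a b, Matrix (Fin (r a)) (Fin (r b)) K, F.IsTrans I γ := by
  choose γ hγ using fun a b (i : Fin (r a)) (j : Fin (r b)) =>
    Sim.exists_div (K := K) (I := I) hs (h := g a) (hg a) (F.φ a i (F.b b j))
  exact ⟨fun a b => Matrix.of (γ a b), hγ⟩

lemma Frame.sum_φ (F : Frame (R := R) g r M) (a : ι) (x : M) (θ : M →ₗ[R] R) :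
    ∑ i, F.φ a i x * θ (F.b a i) = algebraMap P R (g a) * θ x := by
  have := congrArg θ (F.sum a x)
  simpa using this

section
variable {F : Frame (R := R) g r M} {γ : ∀ a b, Matrix (Fin (r a)) (Fin (r b)) K}
  (hI : ∀ p, algebraMap P R p = 0 ↔ p ∈ I) (hg : ∀ a, g a ≠ 0) (hF : F.IsTrans I γ)
include hI hg hF

lemma Frame.IsTrans.mem (a b : ι) (i : Fin (r a)) (j : Fin (r b)) : γ a b i j ∈ loc K ⊤ (g a) :=
  loc_cancel (hg a) dvd_rfl (hF a b i j).mem_top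

lemma Frame.IsTrans.diag (a : ι) : γ a a - 1 ∈ ml K _ _ I (g a) := fun i j => by
  refine loc_cancel (hg a) dvd_rfl (Sim.mem (R := R) hI ?_)
  have h1 := hF a a i j
  rw [F.φ_b] at h1
  rw [Matrix.sub_apply, mul_sub, Matrix.one_apply]
  by_cases h : i = j
  · simpa [h] using h1.sub (Sim.of_alg (g a))
  · simpa [h] using h1

lemma Frame.IsTrans.isCoc : IsCoc g r γ I where
  mem a b i j := loc_dvd _ ⟨g b, rfl⟩ (hF.mem hI hg a b i j)
  coc a b c i j := by
    have hd : g a * g b ∣ g a * g b * g c := ⟨g c, rfl⟩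
    refine loc_cancel (mul_ne_zero (hg a) (hg b)) hd (Sim.mem (R := R) hI ?_)
    have h1 : Sim I (g a * g b * g c)
        (∑ l, (algebraMap P K (g b) * γ b c l j) * (algebraMap P K (g a) * γ a b i l))
        (∑ l, F.φ b l (F.b c j) * F.φ a i (F.b b l)) := Sim.sum _ fun l _ =>
      ((hF b c l j).dvd ⟨g a * g c, by ring⟩).mul ((hF a b i l).dvd ⟨g b * g c, by ring⟩)
    rw [F.sum_φ] at h1
    have h2 := h1.sub ((Sim.of_alg (g b)).mul
      ((hF a c i j).dvd (h' := g a * g b * g c) ⟨g b * g c, by ring⟩))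
    rw [sub_self] at h2
    refine Eq.mp ?_ h2
    congr 1
    rw [Matrix.sub_apply, Matrix.mul_apply, mul_sub, Finset.mul_sum, map_mul]
    congr 1
    · exact Finset.sum_congr rfl fun l _ => by ring
    · ring
end

/-- The frame of the ring itself. -/
def Frame.self (g : ι → P) (R : Type) [CommRing R] [Algebra P R] :
    Frame (R := R) g (rk1 ι) R where
  b _ _ := 1
  φ a _ := algebraMap P R (g a) • LinearMap.id
  φ_b a i j := by
    have : i = j := Subsingleton.elim (α := Fin 1) i j
    simp [this, Algebra.smul_def]
  sum a x := by
    change ∑ i : Fin 1, _ = _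
    simp [Algebra.smul_def]

lemma Frame.self_isTrans : Frame.IsTrans (K := K) (Frame.self g R) I (tr ι K) := fun a b i j => by
  have e : tr ι K a b i j = 1 := by
    change (1 : Matrix (Fin 1) (Fin 1) K) i j = 1
    rw [Subsingleton.elim (α := Fin 1) i j, Matrix.one_apply_eq]
  rw [e, mul_one]
  simpa [Frame.self, Algebra.smul_def] using Sim.of_alg (K := K) (R := R) (g a)

end Frames

section FrameHom

variable {P K R : Type} [CommRing P] [IsDomain P] [Field K] [Algebra P K] [IsFractionRing P K]
  [CommRing R] [Algebra P R] {I : Ideal P}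
variable {ι : Type} [Fintype ι] [DecidableEq ι] {g : ι → P} {r s : ι → ℕ}
  {M N : Type} [AddCommGroup M] [Module R M] [AddCommGroup N] [Module R N]
  [Module P N] [IsScalarTower P R N]
  {F : Frame (R := R) g r M} {G : Frame (R := R) g s N}
  {γ : ∀ a b, Matrix (Fin (r a)) (Fin (r b)) K} {δ : ∀ a b, Matrix (Fin (s a)) (Fin (s b)) K}

lemma IsCoc.coc_self (hγ : IsCoc g r γ I) (a e : ι) :
    γ a e * γ e a - γ a a ∈ ml K _ _ I (g a * g e) := fun i j => by
  obtain ⟨N, p, hp, hz⟩ := hγ.coc a e a i j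
  refine ⟨N + N, (g e) ^ N * p, I.mul_mem_left _ hp, ?_⟩
  rw [map_mul, ← hz]
  simp only [map_mul, mul_pow, pow_add]
  ring

/-- The cochain `κ` is the family of matrices of `T` in the given frames. -/
def Frame.MatOf (F : Frame (R := R) g r M) (G : Frame (R := R) g s N) (I : Ideal P)
    (T : M →ₗ[R] N) (κ : C0 K s r) : Prop :=
  ∀ a i j, Sim I (g a) (algebraMap P K (g a) * κ a i j) (G.φ a i (T (F.b a j)))

lemma Frame.exists_matOf (hs : Function.Surjective (algebraMap P R)) (hg : ∀ a, g a ≠ 0)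
    (T : M →ₗ[R] N) : ∃ κ : C0 K s r, F.MatOf G I T κ := by
  choose κ hκ using fun a (i : Fin (s a)) (j : Fin (r a)) =>
    Sim.exists_div (K := K) (I := I) hs (h := g a) (hg a) (G.φ a i (T (F.b a j)))
  exact ⟨fun a => Matrix.of (κ a), hκ⟩

lemma Frame.MatOf.add {T T' : M →ₗ[R] N} {κ κ' : C0 K s r} (H : F.MatOf G I T κ)
    (H' : F.MatOf G I T' κ') : F.MatOf G I (T + T') (κ + κ') := fun a i j => by
  have := (H a i j).add (H' a i j)
  rw [← mul_add, ← map_add] at this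
  exact this

lemma Frame.MatOf.smul {T : M →ₗ[R] N} {κ : C0 K s r} (p : P) (H : F.MatOf G I T κ) :
    F.MatOf G I (p • T) (p • κ) := fun a i j => by
  have := (Sim.of_alg p).mul (H a i j)
  have e : G.φ a i ((p • T) (F.b a j)) = algebraMap P R p * G.φ a i (T (F.b a j)) := by
    rw [LinearMap.smul_apply, ← algebraMap_smul R p, map_smul, smul_eq_mul]
  rw [e, Pi.smul_apply, Matrix.smul_apply, Algebra.smul_def, mul_left_comm]
  exact this

lemma Frame.MatOf.of_mem (T : M →ₗ[R] N) (hT : T = 0) {κ : C0 K s r}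
    (hκ : κ ∈ Z0 K g s r I) : F.MatOf G I T κ := fun a i j => by
  subst hT
  rw [LinearMap.zero_apply, map_zero]
  exact Sim.of_mem (mul_left_mem_loc (algebraMap_mem_loc (𝔞 := ⊤) Submodule.mem_top _)
    (mem_Z0.1 hκ a i j))

lemma Frame.MatOf.mem_Z0_top (hg : ∀ a, g a ≠ 0) {T : M →ₗ[R] N} {κ : C0 K s r}
    (H : F.MatOf G I T κ) : κ ∈ Z0 K g s r ⊤ :=
  mem_Z0.2 fun a i j => loc_cancel (hg a) dvd_rfl (H a i j).mem_top

lemma Frame.MatOf.mem_Z0 (hI : ∀ p, algebraMap P R p = 0 ↔ p ∈ I) (hg : ∀ a, g a ≠ 0)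
    {κ : C0 K s r} (H : F.MatOf G I 0 κ) : κ ∈ Z0 K g s r I :=
  VB.mem_Z0.2 fun a i j => loc_cancel (hg a) dvd_rfl
    (Sim.mem (R := R) hI (by simpa using H a i j))

lemma Frame.MatOf.eq_zero (hI : ∀ p, algebraMap P R p = 0 ↔ p ∈ I)
    (htf : ∀ x : N, (∀ a, ∃ n : ℕ, algebraMap P R (g a) ^ n • x = 0) → x = 0)
    {T : M →ₗ[R] N} {κ : C0 K s r} (H : F.MatOf G I T κ) (hκ : κ ∈ Z0 K g s r I) : T = 0 := by
  refine LinearMap.ext fun x => htf _ fun a => ?_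
  choose n hn using fun i j => (H a i j).exists_pow hI
    (mul_left_mem_loc (algebraMap_mem_loc (𝔞 := ⊤) Submodule.mem_top _) (VB.mem_Z0.1 hκ a i j))
  set q := algebraMap P R (g a) with hq
  set m := ∑ i, ∑ j, n i j with hm
  have hm' : ∀ i j, q ^ m * G.φ a i (T (F.b a j)) = 0 := fun i j => by
    have : n i j ≤ m := (Finset.single_le_sum (f := fun j => n i j) (fun _ _ => Nat.zero_le _)
      (Finset.mem_univ j)).trans (Finset.single_le_sum (f := fun i => ∑ j, n i j)
        (fun _ _ => Nat.zero_le _) (Finset.mem_univ i))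
    rw [← Nat.sub_add_cancel this, pow_add, mul_assoc, hn, mul_zero]
  have hT : ∀ j, q ^ (m + 1) • T (F.b a j) = 0 := fun j => by
    rw [pow_succ, mul_smul, ← G.sum, Finset.smul_sum]
    exact Finset.sum_eq_zero fun i _ => by rw [smul_smul, hm', zero_smul]
  refine ⟨m + 1 + 1, ?_⟩
  rw [pow_succ, mul_smul, ← map_smul, ← F.sum, map_sum, Finset.smul_sum]
  refine Finset.sum_eq_zero fun j _ => ?_
  rw [map_smul, smul_comm, hT, smul_zero]

/-- Cochains that come from global homomorphisms. -/
def Frame.homs (F : Frame (R := R) g r M) (G : Frame (R := R) g s N) (I : Ideal P) :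
    Submodule P (C0 K s r) where
  carrier := {κ | ∃ T : M →ₗ[R] N, F.MatOf G I T κ}
  zero_mem' := ⟨0, .of_mem 0 rfl (zero_mem _)⟩
  add_mem' := fun ⟨T, h⟩ ⟨T', h'⟩ => ⟨T + T', h.add h'⟩
  smul_mem' p _ := fun ⟨T, h⟩ => ⟨p • T, h.smul p⟩

section
variable (hI : ∀ p, algebraMap P R p = 0 ↔ p ∈ I) (hg : ∀ a, g a ≠ 0)
  (htf : ∀ x : N, (∀ a, ∃ n : ℕ, algebraMap P R (g a) ^ n • x = 0) → x = 0)
include hI htf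

lemma Frame.MatOf.unique {T T' : M →ₗ[R] N} {κ κ' : C0 K s r} (H : F.MatOf G I T κ)
    (H' : F.MatOf G I T' κ') (h : κ - κ' ∈ Z0 K g s r I) : T = T' := by
  have h1 := H.add (H'.smul (-1))
  have h2 := h1.eq_zero hI htf (by simpa [sub_eq_add_neg] using h)
  have h3 : T - T' = 0 := by rw [← h2, sub_eq_add_neg, neg_one_smul]
  exact sub_eq_zero.1 h3

/-- The homomorphism defined by a cochain of matrices. -/
noncomputable def Frame.homsMap (F : Frame (R := R) g r M) (G : Frame (R := R) g s N) :
    F.homs (K := K) G I →ₗ[P] (M →ₗ[R] N) where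
  toFun κ := κ.2.choose
  map_add' κ κ' := Frame.MatOf.unique hI htf (κ + κ').2.choose_spec
    (κ.2.choose_spec.add κ'.2.choose_spec) (by simp)
  map_smul' p κ := Frame.MatOf.unique hI htf (p • κ).2.choose_spec
    (κ.2.choose_spec.smul p) (by simp)

include hg

lemma Frame.exists_homsEquiv (hs : Function.Surjective (algebraMap P R)) :
    Nonempty ((M →ₗ[R] N) ≃ₗ[P] SQ (F.homs (K := K) G I) (Z0 K g s r I)) := by
  have hsurj : Function.Surjective (F.homsMap (K := K) hI htf G) := fun T => by
    obtain ⟨κ, hκ⟩ := F.exists_matOf (G := G) (K := K) (I := I) hs hg T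
    let y : F.homs (K := K) G I := ⟨κ, T, hκ⟩
    exact ⟨y, Frame.MatOf.unique hI htf y.2.choose_spec hκ (by simp [y])⟩
  have hker : (F.homsMap (K := K) hI htf G).ker =
      (Z0 K g s r I).submoduleOf (F.homs (K := K) G I) := by
    ext κ
    rw [LinearMap.mem_ker, Submodule.submoduleOf, Submodule.mem_comap]
    constructor
    · intro h
      have := κ.2.choose_spec
      rw [show κ.2.choose = 0 from h] at this
      exact this.mem_Z0 hI hg
    · intro h
      exact Frame.MatOf.eq_zero hI htf κ.2.choose_spec h
  exact ⟨((Submodule.quotEquivOfEq _ _ hker).symm.trans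
    (LinearMap.quotKerEquivOfSurjective _ hsurj)).symm⟩

end

section
variable (hI : ∀ p, algebraMap P R p = 0 ↔ p ∈ I) (hg : ∀ a, g a ≠ 0)
  (hF : F.IsTrans I γ) (hG : G.IsTrans I δ)
include hI hg hF hG

lemma Frame.MatOf.d0_mem {T : M →ₗ[R] N} {κ : C0 K s r} (H : F.MatOf G I T κ) :
    d0 P γ δ κ ∈ Z1 K g s r I := mem_Z1.2 fun a b i j => by
  have hd : g a * g a * g b ∣ (g a * g b) ^ 2 := ⟨g b, by ring⟩
  have hh : ∀ z : K, z ∈ loc K I ((g a * g b) ^ 2) → z ∈ loc K I (g a * g b) := fun z hz => by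
    obtain ⟨n, p, hp, h⟩ := hz
    exact ⟨2 * n, p, hp, by rw [pow_mul]; exact h⟩
  refine hh _ (loc_cancel (mul_ne_zero (mul_ne_zero (hg a) (hg a)) (hg b)) hd
    (Sim.mem (R := R) hI ?_))
  have da : g a ∣ (g a * g b) ^ 2 := ⟨g a * g b ^ 2, by ring⟩
  have db : g b ∣ (g a * g b) ^ 2 := ⟨g a ^ 2 * g b, by ring⟩
  have h1 : Sim I ((g a * g b) ^ 2)
      (∑ l, (algebraMap P K (g b) * κ b l j) * (algebraMap P K (g a) * δ a b i l))
      (∑ l, G.φ b l (T (F.b b j)) * G.φ a i (G.b b l)) := Sim.sum _ fun l _ =>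
    ((H b l j).dvd db).mul ((hG a b i l).dvd da)
  have h2 : Sim I ((g a * g b) ^ 2)
      (∑ l, (algebraMap P K (g a) * γ a b l j) * (algebraMap P K (g a) * κ a i l))
      (∑ l, F.φ a l (F.b b j) * ((G.φ a i).comp T) (F.b a l)) := Sim.sum _ fun l _ =>
    ((hF a b l j).dvd da).mul ((H a i l).dvd da)
  rw [G.sum_φ] at h1
  rw [F.sum_φ] at h2
  have h3 := ((Sim.of_alg (g a)).mul h1).sub ((Sim.of_alg (g b)).mul h2)
  rw [LinearMap.comp_apply, mul_left_comm, sub_self] at h3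
  refine Eq.mp ?_ h3
  congr 1
  rw [d0_apply, Matrix.sub_apply, Matrix.mul_apply, Matrix.mul_apply, mul_sub, Finset.mul_sum,
    Finset.mul_sum, Finset.mul_sum, Finset.mul_sum, map_mul, map_mul]
  congr 1 <;> exact Finset.sum_congr rfl fun l _ => by ring

lemma Frame.exists_pow_smul_mem_homs (hs : Function.Surjective (algebraMap P R))
    {κ : C0 K s r} (hκ : κ ∈ Z0 K g s r ⊤) (hd : d0 P γ δ κ ∈ Z1 K g s r I) (e : ι) :
    ∃ n : ℕ, g e ^ n • κ ∈ F.homs (K := K) G I := by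
  have hκ' := mem_Z0.1 hκ
  obtain ⟨n, p, -, hp⟩ := exists_common_den (K := K) (g := g e) (𝔞 := ⊤)
    (Finset.univ : Finset (Fin (s e) × Fin (r e))) (fun t => κ e t.1 t.2)
    (fun t => hκ' e t.1 t.2)
  let T : M →ₗ[R] N := ∑ i, ∑ j,
    (algebraMap P R (p (i, j))) • (F.φ e j).smulRight (G.b e i)
  obtain ⟨κ', H⟩ := F.exists_matOf (G := G) (K := K) (I := I) hs hg T
  have hcoc := hF.isCoc hI hg
  have key : κ' - g e ^ (n + 1) • κ ∈ Dt K s r I fun a => g a * g e := mem_Dt.2 fun a => by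
    have e1 : κ' a - g e ^ (n + 1) • (δ a e * κ e * γ e a) ∈ ml K _ _ I (g a * g e) :=
      fun i j => by
        refine loc_cancel (hg a) ⟨_, rfl⟩ (Sim.mem (R := R) hI ?_)
        have da : g a ∣ g a * g e := ⟨_, rfl⟩
        have de : g e ∣ g a * g e := ⟨g a, by ring⟩
        have h1 : Sim I (g a * g e)
            (∑ u, ∑ v, algebraMap P K (p (u, v)) * ((algebraMap P K (g e) * γ e a v j) *
              (algebraMap P K (g a) * δ a e i u)))
            (∑ u, ∑ v, algebraMap P R (p (u, v)) * (F.φ e v (F.b a j) * G.φ a i (G.b e u))) :=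
          Sim.sum _ fun u _ => Sim.sum _ fun v _ => (Sim.of_alg _).mul
            (((hF e a v j).dvd de).mul ((hG a e i u).dvd da))
        have h2 : G.φ a i (T (F.b a j)) =
            ∑ u, ∑ v, algebraMap P R (p (u, v)) * (F.φ e v (F.b a j) * G.φ a i (G.b e u)) := by
          simp [T, LinearMap.sum_apply, Algebra.smul_def]
        rw [← h2] at h1
        have h3 := ((H a i j).dvd da).sub h1
        rw [sub_self] at h3
        refine Eq.mp ?_ h3
        congr 1
        rw [Matrix.sub_apply, mul_sub, Matrix.smul_apply, Matrix.mul_assoc]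
        congr 1
        simp only [Matrix.mul_apply, Finset.mul_sum, Algebra.smul_def]
        refine Finset.sum_congr rfl fun u _ => Finset.sum_congr rfl fun v _ => ?_
        rw [← hp (u, v) (Finset.mem_univ _)]
        simp only [map_pow]
        ring
    have e2 : δ a e * κ e * γ e a - κ a ∈ ml K _ _ I (g a * g e) := by
      have h1 := mem_Z1.1 hd a e
      rw [d0_apply] at h1
      have E : δ a e * κ e * γ e a - κ a = (δ a e * κ e - κ a * γ a e) * γ e a +
          κ a * (γ a e * γ e a - γ a a) + κ a * (γ a a - 1) := by
        simp only [Matrix.mul_sub, Matrix.sub_mul, Matrix.mul_assoc, Matrix.mul_one]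
        abel
      rw [E]
      exact add_mem (add_mem (ml_mul_right h1 (hcoc.mem e a) dvd_rfl ⟨1, by ring⟩)
        (ml_mul_left (hκ' a) (hcoc.coc_self a e) ⟨g e, rfl⟩ dvd_rfl))
        (ml_mul_left (hκ' a) (hF.diag hI hg a) ⟨g e, rfl⟩ ⟨g e, rfl⟩)
    have e3 := add_mem e1 (Submodule.smul_mem _ (g e ^ (n + 1)) e2)
    rw [smul_sub, sub_add_sub_cancel] at e3
    exact e3
  obtain ⟨N', hN⟩ := Dt_descend key
  have h1 := hN N' le_rfl
  refine ⟨N' + (n + 1), ?_⟩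
  rw [pow_add, mul_smul]
  have h2 : g e ^ N' • g e ^ (n + 1) • κ =
      g e ^ N' • κ' - g e ^ N' • (κ' - g e ^ (n + 1) • κ) := by
    rw [smul_sub, sub_sub_cancel]
  rw [h2]
  exact sub_mem (Submodule.smul_mem _ _ ⟨T, H⟩) ⟨0, .of_mem 0 rfl h1⟩

/-- Čech cohomology of the sheaf of homomorphisms between two modules with frames. -/
theorem Frame.cech_vanish (hs : Function.Surjective (algebraMap P R))
    (htf : ∀ x : N, (∀ a, ∃ n : ℕ, algebraMap P R (g a) ^ n • x = 0) → x = 0)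
    {𝔪 : Ideal P} (hfg : 𝔪.FG)
    (hgm : ∀ a, g a ∈ 𝔪) (hrad : 𝔪 ≤ (I ⊔ Ideal.span (Set.range g)).radical) {m : ℕ}
    (hE : EV (ModuleCat.of P (P ⧸ 𝔪)) (m + 2) (M →ₗ[R] N)) :
    (∀ κ ∈ Z0 K g s r ⊤, d0 P γ δ κ ∈ Z1 K g s r I → ∃ T : M →ₗ[R] N, F.MatOf G I T κ) ∧
      (1 ≤ m → H1Van g I γ δ) ∧ (2 ≤ m → H2Van g I γ δ) :=
  VB.cech_vanish (hF.isCoc hI hg) (hG.isCoc hI hg) (hF.diag hI hg) hg hfg hgm hrad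
    (B := F.homs (K := K) G I) (fun _ h => ⟨0, .of_mem 0 rfl h⟩)
    (fun _ ⟨_, h⟩ => h.mem_Z0_top hg) (fun _ ⟨_, h⟩ => h.d0_mem hI hg hF hG)
    (fun _ h h' e => F.exists_pow_smul_mem_homs hI hg hF hG hs h h' e)
    (hE.ofEquiv (Frame.exists_homsEquiv hI hg htf hs).some)

end
end FrameHom

section Rep

variable {P K : Type} [CommRing P] [IsDomain P] [Field K] [Algebra P K] [IsFractionRing P K]
  {I : Ideal P} {ι : Type} [Fintype ι] [DecidableEq ι] {g : ι → P} {r : ι → ℕ}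
  {γ : ∀ a b, Matrix (Fin (r a)) (Fin (r b)) K}

/-- A locally split embedding into a trivial bundle parametrises the first cohomology. -/
lemma HasRep.of_matrices (hγ : IsCoc g r γ I) (H0 : H0Triv K g I)
    (H1 : H1Van g I (tr ι K) (tr ι K)) {m p : ℕ}
    (B : ∀ a, Matrix (Fin m) (Fin (r a)) K) (C : ∀ a, Matrix (Fin (r a)) (Fin m) K)
    (Q : ∀ a, Matrix (Fin m) (Fin p) K) (Ψ : Matrix (Fin p) (Fin m) P)
    (hB : ∀ a, B a ∈ ml K _ _ ⊤ (g a)) (hC : ∀ a, C a ∈ ml K _ _ ⊤ (g a))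
    (hQ : ∀ a, Q a ∈ ml K _ _ ⊤ (g a)) (hCB : ∀ a, C a * B a - 1 ∈ ml K _ _ I (g a))
    (hBC : ∀ a, 1 - B a * C a - Q a * Ψ.map (algebraMap P K) ∈ ml K _ _ I (g a))
    (hΨ : ∀ a, Ψ.map (algebraMap P K) * B a ∈ ml K _ _ I (g a))
    (hBγ : ∀ a b, B a * γ a b - B b ∈ ml K _ _ I (g a * g b)) : HasRep g I γ := by
  have da : ∀ a b, g a ∣ g a * g b := fun a b => ⟨_, rfl⟩
  have db : ∀ a b, g b ∣ g a * g b := fun a b => ⟨g a, mul_comm _ _⟩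
  have dab : ∀ a b c, g a * g b ∣ g a * g b * g c := fun a b c => ⟨_, rfl⟩
  have dbc : ∀ a b c, g b * g c ∣ g a * g b * g c := fun a b c => ⟨g a, by ring⟩
  have dac : ∀ a b c, g a * g c ∣ g a * g b * g c := fun a b c => ⟨g b, by ring⟩
  have hΨt : ∀ h : P, Ψ.map (algebraMap P K) ∈ ml K _ _ ⊤ h := fun h i j =>
    algebraMap_mem_loc (𝔞 := ⊤) Submodule.mem_top _
  let cm : (Fin p → P) → Matrix (Fin p) (Fin 1) K := fun u => Matrix.of fun i _ => algebraMap P K (u i)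
  let Rep : Submodule P (C1 K r (rk1 ι) × (Fin p → P)) :=
    { carrier := {x | ∃ w : ∀ _ : ι, Matrix (Fin m) (Fin 1) K, (∀ a, w a ∈ ml K _ _ ⊤ (g a)) ∧
        (∀ a b, B a * x.1 (a, b) - (w b - w a) ∈ ml K _ _ I (g a * g b)) ∧
        ∀ a, Ψ.map (algebraMap P K) * w a - cm x.2 ∈ ml K _ _ I (g a)}
      zero_mem' := ⟨0, fun _ => zero_mem _, fun a b => by simp, fun a i j => by simp [cm]⟩
      add_mem' := by
        rintro x y ⟨w, h1, h2, h3⟩ ⟨w', h1', h2', h3'⟩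
        refine ⟨w + w', fun a => add_mem (h1 a) (h1' a), fun a b => ?_, fun a => ?_⟩
        · have := add_mem (h2 a b) (h2' a b)
          rw [Prod.fst_add, Pi.add_apply, Pi.add_apply, Pi.add_apply, Matrix.mul_add]
          convert this using 1
          abel
        · have := add_mem (h3 a) (h3' a)
          have e : cm (x + y).2 = cm x.2 + cm y.2 := by ext i j; simp [cm]
          rw [Pi.add_apply, Matrix.mul_add, e]
          convert this using 1
          abel
      smul_mem' := by
        rintro q x ⟨w, h1, h2, h3⟩
        refine ⟨q • w, fun a => Submodule.smul_mem _ _ (h1 a), fun a b => ?_, fun a => ?_⟩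
        · have := Submodule.smul_mem _ q (h2 a b)
          rw [Prod.smul_fst, Pi.smul_apply, Pi.smul_apply, Pi.smul_apply, Matrix.mul_smul, ← smul_sub,
            ← smul_sub]
          exact this
        · have := Submodule.smul_mem _ q (h3 a)
          have e : cm (q • x).2 = q • cm x.2 := by ext i j; simp [cm, Algebra.smul_def]
          rw [Pi.smul_apply, Matrix.mul_smul, e, ← smul_sub]
          exact this }
  refine ⟨p, Rep, fun x hx hdx => ?_, fun x hx hxR => ?_⟩
  · rw [mem_Z1] at hx
    rw [mem_Z2] at hdx
    let y : Fin m → C1 K (rk1 ι) (rk1 ι) := fun l t => Matrix.of fun _ _ => (B t.1 * x t) l 0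
    have hy : ∀ l, y l ∈ Z1 K g (rk1 ι) (rk1 ι) ⊤ := fun l => mem_Z1.2 fun a b i j =>
      ml_mul_left (hB a) (hx a b) (da a b) dvd_rfl l 0
    have hdy : ∀ l, d1 P (tr ι K) (tr ι K) (y l) ∈ Z2 K g (rk1 ι) (rk1 ι) I := fun l =>
      mem_Z2.2 fun a b c i j => by
        have h1 := ml_mul_left (ml_dvd _ (da a b) (hB a)) (hdx a b c) (dab a b c) dvd_rfl
        have h2 := ml_mul_right (hBγ a b) (hx b c) (dab a b c) (dbc a b c)
        have h3 := sub_mem h1 h2 l 0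
        rw [d1_apply, Matrix.one_mul, Matrix.mul_one]
        rw [d1_apply, Matrix.mul_one, Matrix.mul_add, Matrix.mul_sub, Matrix.sub_mul,
          ← Matrix.mul_assoc] at h3
        refine Eq.mp (congrArg (· ∈ loc K I (g a * g b * g c)) ?_) h3
        simp only [Matrix.sub_apply, Matrix.add_apply, y, Matrix.of_apply]
        ring
    choose z hz using fun l => Submodule.mem_sup.1 (H1 (y l) (hy l) (hdy l))
    choose hzm t ht hzt using hz
    choose v hv hvz using hzm
    let w : ∀ _ : ι, Matrix (Fin m) (Fin 1) K := fun a => Matrix.of fun l _ => v l a 0 0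
    have hw : ∀ a, w a ∈ ml K _ _ ⊤ (g a) := fun a l _ => mem_Z0.1 (hv l) a 0 0
    have hwx : ∀ a b, B a * x (a, b) - (w b - w a) ∈ ml K _ _ I (g a * g b) := fun a b l j => by
      have h1 := mem_Z1.1 (ht l) a b 0 0
      have h2 : y l (a, b) 0 0 = z l (a, b) 0 0 + t l (a, b) 0 0 := by rw [← hzt l]; rfl
      rw [← hvz l, d0_apply, Matrix.one_mul, Matrix.mul_one] at h2
      have h3 : y l (a, b) 0 0 = (B a * x (a, b)) l 0 := rfl
      rw [Subsingleton.elim j 0]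
      refine Eq.mp (congrArg (· ∈ loc K I (g a * g b)) ?_) h1
      rw [h3] at h2
      rw [Matrix.sub_apply, h2]
      simp only [Matrix.sub_apply, w, Matrix.of_apply]
      ring
    have hu : ∀ i, ∃ u : P, ∀ a, (Ψ.map (algebraMap P K) * w a) i 0 - algebraMap P K u ∈
        loc K I (g a) := fun i => by
      refine H0.glue _ (fun a => ml_mul_left (hΨt _) (hw a) dvd_rfl dvd_rfl i 0) fun a b => ?_
      have h1 := ml_mul_left (hΨt 1) (hwx a b) (one_dvd _) dvd_rfl
      have h2 := ml_mul_right (hΨ a) (hx a b) (da a b) dvd_rfl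
      have h3 := sub_mem h2 h1 i 0
      refine Eq.mp (congrArg (· ∈ loc K I (g a * g b)) ?_) h3
      rw [Matrix.mul_sub, Matrix.mul_sub, Matrix.mul_assoc]
      simp only [Matrix.sub_apply]
      ring
    choose u hu using hu
    exact ⟨u, w, hw, hwx, fun a i j => by rw [Subsingleton.elim j 0]; exact hu i a⟩
  · rw [mem_Z1] at hx
    obtain ⟨w, hw, hwx, hΨw⟩ := hxR
    have hcm : cm 0 = 0 := by ext i j; simp [cm]
    have hΨw' : ∀ a, Ψ.map (algebraMap P K) * w a ∈ ml K _ _ I (g a) := fun a => by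
      have := hΨw a
      rwa [show ((x, (0 : Fin p → P)) : C1 K r (rk1 ι) × (Fin p → P)).2 = 0 from rfl, hcm,
        sub_zero] at this
    let v : C0 K r (rk1 ι) := fun a => C a * w a
    have hv : ∀ a, v a ∈ ml K _ _ ⊤ (g a) := fun a => ml_mul_left (hC a) (hw a) dvd_rfl dvd_rfl
    have hBv : ∀ a, B a * v a - w a ∈ ml K _ _ I (g a) := fun a => by
      have h1 := ml_mul_right (hBC a) (hw a) dvd_rfl dvd_rfl
      have h2 := ml_mul_left (hQ a) (hΨw' a) dvd_rfl dvd_rfl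
      have h3 := neg_mem (add_mem h1 h2)
      simp only [Matrix.sub_mul, Matrix.one_mul, Matrix.mul_assoc] at h3
      convert h3 using 1
      simp only [v]
      abel
    have key : x - d0 P (tr ι K) γ v ∈ Z1 K g r (rk1 ι) I := mem_Z1.2 fun a b => by
      have h1 : B a * (x (a, b) - (γ a b * v b - v a)) ∈ ml K _ _ I (g a * g b) := by
        have h3 := ml_mul_right (hBγ a b) (hv b) dvd_rfl (db a b)
        have h4 := ml_dvd _ (da a b) (hBv a)
        have h5 := ml_dvd _ (db a b) (hBv b)
        have h6 := add_mem (sub_mem (sub_mem (hwx a b) h3) h5) h4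
        convert h6 using 1
        simp only [Matrix.mul_sub, Matrix.sub_mul, Matrix.mul_assoc]
        abel
      have h2 := ml_mul_left (hC a) h1 (da a b) dvd_rfl
      have hxv : x (a, b) - (γ a b * v b - v a) ∈ ml K _ _ ⊤ (g a * g b) :=
        sub_mem (hx a b) (sub_mem (ml_mul_left (hγ.mem a b) (hv b) dvd_rfl (db a b))
          (ml_dvd _ (da a b) (hv a)))
      have h3 := ml_mul_right (hCB a) hxv (da a b) dvd_rfl
      have h4 := sub_mem h2 h3
      rw [Matrix.sub_mul, Matrix.one_mul, Matrix.mul_assoc, sub_sub_cancel] at h4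
      rw [Pi.sub_apply, d0_apply, Matrix.mul_one]
      exact h4
    rw [← add_sub_cancel (d0 P (tr ι K) γ v) x]
    exact Submodule.add_mem_sup (Submodule.mem_map_of_mem (mem_Z0.2 hv)) key

end Rep

section RepFrame

variable {P K R : Type} [CommRing P] [IsDomain P] [Field K] [Algebra P K] [IsFractionRing P K]
  [CommRing R] [Algebra P R] {I : Ideal P} {ι : Type} [Fintype ι] [DecidableEq ι] {g : ι → P}
  {r : ι → ℕ} {γ : ∀ a b, Matrix (Fin (r a)) (Fin (r b)) K}
  {M : Type} [AddCommGroup M] [Module R M]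
  (hs : Function.Surjective (algebraMap P R)) (hI : ∀ p, algebraMap P R p = 0 ↔ p ∈ I)
  (hg : ∀ a, g a ≠ 0)
include hs hI

lemma HasRep.of_frame [IsNoetherianRing R] [Module.Finite R M] (hγ : IsCoc g r γ I)
    (H0 : H0Triv K g I) (H1 : H1Van g I (tr ι K) (tr ι K)) (F : Frame (R := R) g r M)
    (t s : ι → K) (ht : ∀ a, t a ∈ loc K ⊤ (g a)) (hs' : ∀ a, s a ∈ loc K ⊤ (g a))
    (hts : ∀ a, t a * s a * algebraMap P K (g a) = 1)
    (hγF : ∀ a b i (x : M) (w : Fin (r a) → P) (z : P), (∀ j, algebraMap P R (w j) = F.φ a j x) →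
      algebraMap P R z = F.φ b i x →
      t a * ∑ j, algebraMap P K (w j) * γ a b j i - t b * algebraMap P K z ∈
        loc K I (g a * g b)) : HasRep g I γ := by
  let L : R → P := Function.surjInv hs
  have hL : ∀ w, algebraMap P R (L w) = w := Function.surjInv_eq hs
  have hLS : ∀ h w, Sim (K := K) I h (algebraMap P K (L w)) w := fun h w => ⟨L w, hL w, by simp⟩
  have hLt : ∀ h w, algebraMap P K (L w) ∈ loc K ⊤ h := fun h w =>
    algebraMap_mem_loc (𝔞 := ⊤) Submodule.mem_top _
  obtain ⟨m, x, hx⟩ := Module.Finite.exists_fin (R := R) (M := M)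
  have hgen : ∀ y : M, ∃ c : Fin m → R, ∑ l, c l • x l = y := fun y =>
    (Submodule.mem_span_range_iff_exists_fun R).1 (hx ▸ Submodule.mem_top)
  choose c hc using fun a j => hgen (F.b a j)
  obtain ⟨p, ψ, hψ⟩ := Submodule.fg_iff_exists_fin_generating_family.1
    (IsNoetherian.noetherian (LinearMap.ker (Fintype.linearCombination R x)))
  have hψ0 : ∀ i, ∑ l, ψ i l • x l = 0 := fun i => by
    have : ψ i ∈ LinearMap.ker (Fintype.linearCombination R x) :=
      hψ ▸ Submodule.subset_span ⟨i, rfl⟩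
    simpa [Fintype.linearCombination_apply] using this
  have hq : ∀ a l, ∃ q : Fin p → R, ∀ l', ∑ i, q i * ψ i l' =
      (if l = l' then algebraMap P R (g a) else 0) - ∑ j, F.φ a j (x l) * c a j l' := fun a l => by
    have : (fun l' => (if l = l' then algebraMap P R (g a) else 0) - ∑ j, F.φ a j (x l) * c a j l')
        ∈ LinearMap.ker (Fintype.linearCombination R x) := by
      rw [LinearMap.mem_ker, Fintype.linearCombination_apply]
      simp only [sub_smul, Finset.sum_sub_distrib, ite_smul, zero_smul, Finset.sum_ite_eq,
        Finset.mem_univ, if_true, Finset.sum_smul, mul_smul]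
      rw [Finset.sum_comm, ← F.sum a (x l), sub_eq_zero]
      exact Finset.sum_congr rfl fun j _ => by rw [← Finset.smul_sum, hc]
    rw [← hψ] at this
    obtain ⟨q, hq⟩ := (Submodule.mem_span_range_iff_exists_fun R).1 this
    exact ⟨q, fun l' => by rw [← congrFun hq l']; simp⟩
  choose q hq using hq
  have hIs : ∀ {h : P} {z : K} {w : R}, Sim I h z w → w = 0 → z ∈ loc K I h := fun H h =>
    Sim.mem hI (h ▸ H)
  refine HasRep.of_matrices hγ H0 H1 (m := m) (p := p)
    (fun a => Matrix.of fun l j => t a * algebraMap P K (L (F.φ a j (x l))))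
    (fun a => Matrix.of fun j l => s a * algebraMap P K (L (c a j l)))
    (fun a => Matrix.of fun l i => t a * s a * algebraMap P K (L (q a l i)))
    (Matrix.of fun i l => L (ψ i l))
    (fun a l j => mul_left_mem_loc (ht a) (hLt _ _)) (fun a j l => mul_left_mem_loc (hs' a) (hLt _ _))
    (fun a l i => mul_left_mem_loc (mul_left_mem_loc (ht a) (hs' a)) (hLt _ _))
    (fun a j i => ?_) (fun a l l' => ?_) (fun a i j => ?_) (fun a b l i => ?_)
  · have h1 : Sim I (g a) (∑ l, algebraMap P K (L (c a j l)) * algebraMap P K (L (F.φ a i (x l))))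
        (∑ l, c a j l * F.φ a i (x l)) := Sim.sum _ fun l _ => (hLS _ _).mul (hLS _ _)
    have e : ∑ l, c a j l * F.φ a i (x l) = if i = j then algebraMap P R (g a) else 0 := by
      rw [← F.φ_b, ← hc a j]
      simp
    have h2 : Sim I (g a) (if i = j then algebraMap P K (g a) else 0)
        (if i = j then algebraMap P R (g a) else 0) := by
      split_ifs
      exacts [Sim.of_alg _, Sim.zero]
    have h3 := mul_left_mem_loc (mul_left_mem_loc (ht a) (hs' a))
      (hIs (h1.sub h2) (by rw [e, sub_self]))
    refine Eq.mp (congrArg (· ∈ loc K I (g a)) ?_) h3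
    rw [Matrix.sub_apply, Matrix.mul_apply, Matrix.one_apply, mul_sub, mul_ite, mul_zero, hts,
      Finset.mul_sum]
    congr 1
    · exact Finset.sum_congr rfl fun l _ => by simp only [Matrix.of_apply]; ring
    · simp only [eq_comm]
  · have h1 : Sim I (g a) (∑ j, algebraMap P K (L (F.φ a j (x l))) * algebraMap P K (L (c a j l')))
        (∑ j, F.φ a j (x l) * c a j l') := Sim.sum _ fun j _ => (hLS _ _).mul (hLS _ _)
    have h2 : Sim I (g a) (∑ i, algebraMap P K (L (q a l i)) * algebraMap P K (L (ψ i l')))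
        (∑ i, q a l i * ψ i l') := Sim.sum _ fun j _ => (hLS _ _).mul (hLS _ _)
    have h3 : Sim I (g a) (if l = l' then algebraMap P K (g a) else 0)
        (if l = l' then algebraMap P R (g a) else 0) := by
      split_ifs
      exacts [Sim.of_alg _, Sim.zero]
    have h4 := mul_left_mem_loc (mul_left_mem_loc (ht a) (hs' a))
      (hIs ((h3.sub h1).sub h2) (by rw [hq, sub_self]))
    refine Eq.mp (congrArg (· ∈ loc K I (g a)) ?_) h4
    rw [Matrix.sub_apply, Matrix.sub_apply, Matrix.mul_apply, Matrix.one_apply, mul_sub, mul_sub,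
      mul_ite, mul_zero, hts, Finset.mul_sum, Matrix.mul_apply, Finset.mul_sum]
    congr 1
    · congr 1
      exact Finset.sum_congr rfl fun l _ => by simp only [Matrix.of_apply]; ring
    · exact Finset.sum_congr rfl fun l _ => by simp only [Matrix.of_apply, Matrix.map_apply]; ring
  · have h1 : Sim I (g a) (∑ l, algebraMap P K (L (ψ i l)) * algebraMap P K (L (F.φ a j (x l))))
        (∑ l, ψ i l * F.φ a j (x l)) := Sim.sum _ fun j _ => (hLS _ _).mul (hLS _ _)
    have h2 := mul_left_mem_loc (ht a) (hIs h1 (by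
      have := congrArg (F.φ a j) (hψ0 i)
      simpa using this))
    refine Eq.mp (congrArg (· ∈ loc K I (g a)) ?_) h2
    rw [Matrix.mul_apply, Finset.mul_sum]
    exact Finset.sum_congr rfl fun l _ => by simp only [Matrix.of_apply, Matrix.map_apply]; ring
  · refine Eq.mp (congrArg (· ∈ loc K I (g a * g b)) ?_)
      (hγF a b i (x l) (fun j => L (F.φ a j (x l))) _ (fun j => hL _) (hL _))
    rw [Matrix.sub_apply, Matrix.mul_apply, Finset.mul_sum]
    congr 1
    exact Finset.sum_congr rfl fun j _ => by simp only [Matrix.of_apply]; ring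

omit hs hI in
/-- The dual frame. -/
def Frame.dual (F : Frame (R := R) g r M) : Frame (R := R) g r (M →ₗ[R] R) where
  b := F.φ
  φ a i := LinearMap.applyₗ (F.b a i)
  φ_b a i j := by simp [F.φ_b, eq_comm]
  sum a θ := LinearMap.ext fun x => by
    have := F.sum_φ a x θ
    simp only [LinearMap.sum_apply, LinearMap.smul_apply, LinearMap.applyₗ_apply_apply, smul_eq_mul]
    rw [← this]
    exact Finset.sum_congr rfl fun _ _ => mul_comm _ _

variable {F : Frame (R := R) g r M} (hF : F.IsTrans I γ) (H0 : H0Triv K g I)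
  (H1 : H1Van g I (tr ι K) (tr ι K))
include hF H0 H1 hg

lemma Frame.IsTrans.hasRep [IsNoetherianRing R] [Module.Finite R M] : HasRep g I γ := by
  refine HasRep.of_frame hs hI (hF.isCoc hI hg) H0 H1 F.dual (fun _ => 1)
    (fun a => (algebraMap P K (g a))⁻¹) (fun a => one_mem_loc _) (fun a => inv_mem_loc (hg a))
    (fun a => by rw [one_mul, inv_mul_cancel₀ (algebraMap_ne (hg a))])
    fun a b i θ w z hw hz => ?_
  refine loc_cancel (hg a) ⟨_, rfl⟩ (Sim.mem (R := R) hI ?_)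
  have h1 : Sim I (g a * g b) (∑ j, (algebraMap P K (g a) * γ a b j i) * algebraMap P K (w j))
      (∑ j, F.φ a j (F.b b i) * θ (F.b a j)) := Sim.sum _ fun j _ =>
    ((hF a b j i).dvd ⟨_, rfl⟩).mul ⟨w j, hw j, by simp⟩
  have h2 := h1.sub ((Sim.of_alg (g a)).mul (Sim.of_alg z))
  rw [F.sum_φ, hz, show F.dual.φ b i θ = θ (F.b b i) from rfl, sub_self] at h2
  refine Eq.mp ?_ h2
  congr 1
  rw [one_mul, one_mul, mul_sub, Finset.mul_sum]
  congr 1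
  exact Finset.sum_congr rfl fun j _ => by ring

lemma Frame.IsTrans.hasRep_transpose [IsNoetherianRing R] [Module.Finite R M] :
    HasRep g I fun a b => (γ b a).transpose := by
  refine HasRep.of_frame hs hI (hF.isCoc hI hg).transpose H0 H1 F
    (fun a => (algebraMap P K (g a))⁻¹) (fun _ => 1) (fun a => inv_mem_loc (hg a))
    (fun a => one_mem_loc _)
    (fun a => by rw [mul_one, inv_mul_cancel₀ (algebraMap_ne (hg a))])
    fun a b i x w z hw hz => ?_
  refine loc_cancel (mul_ne_zero (hg a) (hg b)) dvd_rfl (Sim.mem (R := R) hI ?_)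
  have h1 : Sim I (g a * g b) (∑ j, algebraMap P K (w j) * (algebraMap P K (g b) * γ b a i j))
      (∑ j, F.φ a j x * F.φ b i (F.b a j)) := Sim.sum _ fun j _ =>
    Sim.mul ⟨w j, hw j, by simp⟩ ((hF b a i j).dvd ⟨g a, by ring⟩)
  have h2 := h1.sub ((Sim.of_alg (g a)).mul (Sim.of_alg z))
  rw [F.sum_φ, hz, sub_self] at h2
  refine Eq.mp ?_ h2
  congr 1
  have ha := algebraMap_ne (K := K) (hg a)
  have hb := algebraMap_ne (K := K) (hg b)
  rw [map_mul, mul_sub]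
  congr 1
  · rw [Finset.mul_sum, Finset.mul_sum]
    refine Finset.sum_congr rfl fun j _ => ?_
    rw [Matrix.transpose_apply]
    field_simp
  · field_simp

end RepFrame

section Conclusion

variable {P K R : Type} [CommRing P] [IsDomain P] [Field K] [Algebra P K] [IsFractionRing P K]
  [CommRing R] [Algebra P R] {I : Ideal P} {ι : Type} [Fintype ι] [DecidableEq ι] {g : ι → P}
  {r : ι → ℕ} {γ : ∀ a b, Matrix (Fin (r a)) (Fin (r b)) K}
  {M : Type} [AddCommGroup M] [Module R M]

/-- `D(g)` covers the complement of `V(𝔪)` in `Spec R`, where `R = P / I`. -/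
structure Cover (R : Type) [CommRing R] [Algebra P R] (g : ι → P) (I 𝔪 : Ideal P) : Prop where
  surj : Function.Surjective (algebraMap P R)
  ker : ∀ p, algebraMap P R p = 0 ↔ p ∈ I
  ne : ∀ a, g a ≠ 0
  fg : 𝔪.FG
  mem : ∀ a, g a ∈ 𝔪
  rad : 𝔪 ≤ (I ⊔ Ideal.span (Set.range g)).radical

variable {𝔪 : Ideal P} (C : Cover R g I 𝔪)
include C

lemma Cover.h0Triv (htf : ∀ x : R, (∀ a, ∃ n : ℕ, algebraMap P R (g a) ^ n • x = 0) → x = 0)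
    (hE : EV (ModuleCat.of P (P ⧸ 𝔪)) 2 (R →ₗ[R] R)) : H0Triv K g I where
  torsion p hp := by
    refine (C.ker p).1 (htf _ fun a => ?_)
    obtain ⟨N, hN⟩ := mem_of_algebraMap_mem_loc (hp a)
    exact ⟨N, by rw [smul_eq_mul, ← map_pow, ← map_mul]; exact (C.ker _).2 hN⟩
  glue z hz hzz := by
    obtain ⟨T, hT⟩ := (Frame.cech_vanish (m := 0) C.ker C.ne (Frame.self_isTrans (K := K))
      (Frame.self_isTrans (K := K)) C.surj htf C.fg C.mem C.rad hE).1
      (fun a => Matrix.of fun _ _ => z a) (mem_Z0.2 fun a i j => hz a)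
      (mem_Z1.2 fun a b i j => by
        rw [d0_apply, Matrix.one_mul, Matrix.mul_one]
        exact hzz a b)
    obtain ⟨p, hp⟩ := C.surj (T 1)
    refine ⟨p, fun a => loc_cancel (C.ne a) dvd_rfl (Sim.mem (R := R) C.ker ?_)⟩
    have h1 := (hT a 0 0).sub ((Sim.of_alg (g a)).mul (Sim.of_alg p))
    have h2 : (Frame.self g R).φ a 0 (T ((Frame.self g R).b a 0)) =
        algebraMap P R (g a) * T 1 := rfl
    rw [h2, hp, sub_self] at h1
    rw [mul_sub]
    exact h1

lemma Cover.h1Van (htf : ∀ x : R, (∀ a, ∃ n : ℕ, algebraMap P R (g a) ^ n • x = 0) → x = 0)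
    (hE : EV (ModuleCat.of P (P ⧸ 𝔪)) 3 (R →ₗ[R] R)) : H1Van g I (tr ι K) (tr ι K) :=
  (Frame.cech_vanish (m := 1) C.ker C.ne (Frame.self_isTrans (K := K))
      (Frame.self_isTrans (K := K)) C.surj htf C.fg C.mem C.rad hE).2.1 le_rfl

variable [Module P M] [IsScalarTower P R M] {F : Frame (R := R) g r M} (hF : F.IsTrans I γ) {q : ℕ}
include hF

lemma ColSec.exists_elements
    (htf : ∀ x : M, (∀ a, ∃ n : ℕ, algebraMap P R (g a) ^ n • x = 0) → x = 0)
    (hE : EV (ModuleCat.of P (P ⧸ 𝔪)) 2 (R →ₗ[R] M))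
    {X : ∀ a, Matrix (Fin (r a)) (Fin q) K} (hX : ColSec g γ I X) :
    ∃ x : Fin q → M, ∀ a j l, Sim I (g a) (algebraMap P K (g a) * X a j l) (F.φ a j (x l)) := by
  have H := (Frame.cech_vanish (m := 0) C.ker C.ne (Frame.self_isTrans (K := K)) hF C.surj htf
    C.fg C.mem C.rad hE).1
  choose T hT using fun l : Fin q => H (fun a => Matrix.of fun j _ => X a j l)
    (mem_Z0.2 fun a i _ => hX.mem a i l) (mem_Z1.2 fun a b i j => by
      rw [d0_apply, Matrix.mul_one]
      exact hX.glue a b i l)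
  exact ⟨fun l => T l 1, fun a j l => hT l a j 0⟩

lemma RowSec.exists_elements
    (htf : ∀ x : R, (∀ a, ∃ n : ℕ, algebraMap P R (g a) ^ n • x = 0) → x = 0)
    (hE : EV (ModuleCat.of P (P ⧸ 𝔪)) 2 (M →ₗ[R] R))
    {Y : ∀ a, Matrix (Fin q) (Fin (r a)) K} (hY : RowSec g γ I Y) :
    ∃ y : Fin q → M →ₗ[R] R, ∀ a i j, Sim I (g a) (Y a i j) (y i (F.b a j)) := by
  have H := (Frame.cech_vanish (m := 0) C.ker C.ne hF (Frame.self_isTrans (K := K)) C.surj htf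
    C.fg C.mem C.rad hE).1
  choose T hT using fun i : Fin q => H (fun a => Matrix.of fun _ j => Y a i j)
    (mem_Z0.2 fun a _ j => hY.mem a i j) (mem_Z1.2 fun a b l j => by
      rw [d0_apply, Matrix.one_mul]
      have := neg_mem (hY.glue a b)
      rw [neg_sub] at this
      exact this i j)
  refine ⟨T, fun a i j => ?_⟩
  obtain ⟨p, hp⟩ := C.surj (T i (F.b a j))
  have h1 := (hT i a 0 j).sub ((Sim.of_alg (g a)).mul (Sim.of_alg p))
  have h2 : (Frame.self g R).φ a 0 (T i (F.b a j)) = algebraMap P R (g a) * T i (F.b a j) := rfl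
  rw [h2, hp, sub_self, ← mul_sub] at h1
  exact ⟨p, hp, loc_cancel (C.ne a) dvd_rfl (Sim.mem (R := R) C.ker h1)⟩

end Conclusion

section Pairing

variable {P R : Type} [CommRing P] [IsDomain P] [CommRing R] [Algebra P R] {ι : Type} [Fintype ι] [DecidableEq ι]
  {g : ι → P} {r : ι → ℕ}
  {M : Type} [AddCommGroup M] [Module R M]

lemma det_smul_eq_zero {S : Type*} [CommRing S] {m n : ℕ} (h : m ≤ n) (A : Matrix (Fin n) (Fin m) S)
    (B : Matrix (Fin m) (Fin n) S) {v : Fin m → S} (hv : A.mulVec v = 0) (j : Fin m) :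
    (A * B).det * v j = 0 := by
  rw [← Matrix.det_transpose, Matrix.transpose_mul, det_mul_eq_sum, Finset.sum_mul]
  refine Finset.sum_eq_zero fun φ _ => ?_
  rw [mul_assoc]
  have h2 : (A.transpose.submatrix φ id) = (A.submatrix id φ).transpose := rfl
  rw [h2, Matrix.det_transpose]
  by_cases hφ : Function.Injective φ
  · have hc : Fintype.card (Fin n) = Fintype.card (Fin m) :=
      le_antisymm (Fintype.card_le_of_injective φ hφ) (by simpa using h)
    let e := Equiv.ofBijective φ ((Fintype.bijective_iff_injective_and_card φ).2 ⟨hφ, hc⟩)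
    obtain ⟨i, rfl⟩ := e.surjective j
    have h3 : (A.submatrix id φ).mulVec (v ∘ φ) = 0 := by
      ext i
      have := congrFun hv i
      rw [Matrix.mulVec, dotProduct, ← e.sum_comp] at this
      exact this
    have h4 := congrArg ((A.submatrix id φ).adjugate.mulVec ·) h3
    simp only [Matrix.mulVec_mulVec, Matrix.adjugate_mul, Matrix.mulVec_zero] at h4
    have h5 := congrFun h4 i
    rw [Matrix.smul_mulVec, Matrix.one_mulVec] at h5
    rw [show v (e i) = (v ∘ φ) i from rfl, show (A.submatrix id φ).det * (v ∘ φ) i = 0 from h5,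
      mul_zero]
  · obtain ⟨i, j, hij, hne⟩ : ∃ i j, φ i = φ j ∧ i ≠ j := by
      simpa [Function.Injective] using hφ
    rw [Matrix.det_zero_of_column_eq hne fun l => by simp [hij], zero_mul, mul_zero]

/-- Elements killed by the functionals `y` are torsion, if `y` is somewhere of maximal rank. -/
lemma Frame.pow_smul_eq_zero (F : Frame (R := R) g r M) {n : ℕ} (x : Fin n → M)
    (y : Fin n → M →ₗ[R] R) {z : M} (hz : ∀ i, y i z = 0) (a : ι) (h : r a ≤ n) :
    algebraMap P R (g a) ^ (n + 1) • (Matrix.of fun i l => y i (x l)).det • z = 0 := by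
  have h1 : (algebraMap P R (g a)) • (Matrix.of fun i l => y i (x l)) =
      (Matrix.of fun i j => y i (F.b a j)) * (Matrix.of fun j l => F.φ a j (x l)) := by
    ext i l
    simp only [Matrix.smul_apply, Matrix.of_apply, Matrix.mul_apply, smul_eq_mul]
    rw [← F.sum_φ]
    exact Finset.sum_congr rfl fun _ _ => mul_comm _ _
  have h2 : (Matrix.of fun i j => y i (F.b a j)).mulVec (fun j => F.φ a j z) = 0 := by
    ext i
    have := F.sum_φ a z (y i)
    rw [hz, mul_zero] at this
    rw [Pi.zero_apply, ← this, Matrix.mulVec, dotProduct]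
    exact Finset.sum_congr rfl fun _ _ => mul_comm _ _
  have h3 := det_smul_eq_zero h _ (Matrix.of fun j l => F.φ a j (x l)) h2
  rw [← h1, Matrix.det_smul, Fintype.card_fin] at h3
  rw [pow_succ, mul_smul, smul_comm (algebraMap P R (g a)), ← F.sum, Finset.smul_sum,
    Finset.smul_sum]
  refine Finset.sum_eq_zero fun j _ => ?_
  rw [smul_smul, smul_smul, h3, zero_smul]

end Pairing

section Main

variable {k ν : Type} [Field k] [Fintype ν] [DecidableEq ν] {R : Type} [CommRing R]
  [Algebra (MvPolynomial ν k) R] [IsNoetherianRing R]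
  {ι : Type} [Fintype ι] [DecidableEq ι] {g : ι → MvPolynomial ν k} {r : ι → ℕ}
  {M : Type} [AddCommGroup M] [Module R M] [Module.Finite R M]
  [Module (MvPolynomial ν k) M] [IsScalarTower (MvPolynomial ν k) R M] {c : ℕ}
  {f : Fin c → MvPolynomial ν k} {𝔪 : Ideal (MvPolynomial ν k)}

/-- Finitely many elements and functionals whose pairing is nondegenerate at the origin and
generically a dual basis. -/
theorem exists_dual_pairing
    (hreg : RingTheory.Sequence.IsWeaklyRegular (MvPolynomial ν k) (List.ofFn f))
    (C : Cover R g (Ideal.span (Set.range f)) 𝔪) (F : Frame (R := R) g r M)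
    (hI : Ideal.span (Set.range f) ≤ RingHom.ker (MvPolynomial.constantCoeff (σ := ν) (R := k)))
    (hK : ∀ p : MvPolynomial ν k,
      (∀ J, p ∈ Ideal.span (Set.range f) ⊔ MvPolynomial.idealOfVars ν k ^ J) →
        p ∈ Ideal.span (Set.range f))
    (htR : ∀ x : R, (∀ a, ∃ n : ℕ, algebraMap _ R (g a) ^ n • x = 0) → x = 0)
    (htM : ∀ x : M, (∀ a, ∃ n : ℕ, algebraMap _ R (g a) ^ n • x = 0) → x = 0)
    (hRR : EV (ModuleCat.of (MvPolynomial ν k) (MvPolynomial ν k ⧸ 𝔪)) 3 (R →ₗ[R] R))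
    (hMR : EV (ModuleCat.of (MvPolynomial ν k) (MvPolynomial ν k ⧸ 𝔪)) 2 (M →ₗ[R] R))
    (hRM : EV (ModuleCat.of (MvPolynomial ν k) (MvPolynomial ν k ⧸ 𝔪)) 2 (R →ₗ[R] M))
    (hMM : EV (ModuleCat.of (MvPolynomial ν k) (MvPolynomial ν k ⧸ 𝔪)) 4 (M →ₗ[R] M)) :
    ∃ (n : ℕ) (x : Fin n → M) (y : Fin n → M →ₗ[R] R) (p : MvPolynomial ν k),
      (Matrix.of fun i l => y i (x l)).det = algebraMap _ R p ∧
      MvPolynomial.constantCoeff p ≠ 0 ∧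
      ∀ z, (∀ i, y i z = 0) → algebraMap _ R p • z = 0 := by
  set I := Ideal.span (Set.range f) with hIdef
  obtain ⟨γ, hγ⟩ := F.exists_isTrans (K := FractionRing (MvPolynomial ν k)) C.surj C.ne I
  have H0 : H0Triv (FractionRing (MvPolynomial ν k)) g I := C.h0Triv htR (hRR.mono (by simp))
  have H1 : H1Van g I (tr ι (FractionRing (MvPolynomial ν k))) (tr ι _) := C.h1Van htR hRR
  have H := Frame.cech_vanish C.ker C.ne hγ hγ C.surj htM C.fg C.mem C.rad hMM
  obtain ⟨e, he, hmax⟩ : ∃ e, (∀ N, g e ^ N ∉ I) ∧ ∀ a, (∀ N, g a ^ N ∉ I) → r a ≤ r e := by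
    classical
    have hne : (Finset.univ.filter fun a => ∀ N, g a ^ N ∉ I).Nonempty := by
      by_contra hcon
      have hnil : ∀ a, ∃ N, g a ^ N ∈ I := by
        simpa [Finset.not_nonempty_iff_eq_empty, Finset.filter_eq_empty_iff] using hcon
      have h1 : (1 : MvPolynomial ν k) ∈ I := H0.torsion 1 fun a => by
        obtain ⟨N, hN⟩ := hnil a
        exact ⟨N, g a ^ N, hN, by simp⟩
      have := hI h1
      simp at this
    obtain ⟨e, he, hmax⟩ := Finset.exists_max_image _ r hne
    exact ⟨e, (Finset.mem_filter.1 he).2, fun a ha =>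
      hmax a (Finset.mem_filter.2 ⟨Finset.mem_univ _, ha⟩)⟩
  obtain ⟨X, Y, B, hX, hY, hXY, hB⟩ := exists_nondegenerate_pairing hreg C.ne
    (hγ.isCoc C.ker C.ne) (fun a => ml_dvd _ ⟨_, rfl⟩ (hγ.diag C.ker C.ne a)) (H.2.2 le_rfl)
    (H.2.1 (by simp)) (hγ.hasRep C.surj C.ker C.ne H0 H1)
    (hγ.hasRep_transpose C.surj C.ker C.ne H0 H1) H0 hI e
    (fun N => by
      by_contra! hcon
      exact he N (hK _ hcon))
  obtain ⟨x, hx⟩ := hX.exists_elements C hγ htM hRM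
  obtain ⟨y, hy⟩ := hY.exists_elements C hγ htR hMR
  have hyx : (Matrix.of fun i l => y i (x l)) = (algebraMap _ R).mapMatrix B := by
    ext i l
    obtain ⟨p, hp⟩ := C.surj (y i (x l))
    rw [Matrix.of_apply, RingHom.mapMatrix_apply, Matrix.map_apply, ← hp, ← sub_eq_zero,
      ← map_sub, C.ker]
    refine H0.torsion _ fun a => ?_
    refine loc_cancel (C.ne a) dvd_rfl (Sim.mem (R := R) C.ker ?_)
    have h1 : Sim I (g a) (∑ j, (algebraMap _ (FractionRing (MvPolynomial ν k)) (g a) * X a j l) *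
        Y a i j) (∑ j, F.φ a j (x l) * y i (F.b a j)) := Sim.sum _ fun j _ =>
      (hx a j l).mul (hy a i j)
    rw [F.sum_φ] at h1
    have h2 := ((Sim.of_alg (g a)).mul (Sim.of_alg p)).sub h1
    rw [hp, sub_self] at h2
    have h3 := mul_left_mem_loc (algebraMap_mem_loc (K := FractionRing (MvPolynomial ν k))
      (𝔞 := ⊤) (p := g a) Submodule.mem_top _) (hXY a i l)
    refine h2.congr ?_
    refine Eq.mp (congrArg (· ∈ loc (FractionRing (MvPolynomial ν k)) I (g a)) ?_) h3
    rw [Matrix.sub_apply, Matrix.mul_apply, Matrix.map_apply, map_sub, mul_sub, mul_sub,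
      Finset.mul_sum]
    have : ∀ j, algebraMap _ (FractionRing (MvPolynomial ν k)) (g a) * (Y a i j * X a j l) =
      algebraMap _ (FractionRing (MvPolynomial ν k)) (g a) * X a j l * Y a i j := fun j => by ring
    simp only [this]
    ring
  have hdet : (Matrix.of fun i l => y i (x l)).det = algebraMap _ R B.det := by
    rw [hyx, RingHom.map_det]
  refine ⟨r e, x, y, B.det, hdet, hB, fun z hz => htM _ fun a => ?_⟩
  rw [← hdet]
  by_cases ha : ∀ N, g a ^ N ∉ I
  · exact ⟨_, F.pow_smul_eq_zero x y hz a (hmax a ha)⟩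
  · push Not at ha
    obtain ⟨N, hN⟩ := ha
    exact ⟨N, by rw [← map_pow, (C.ker _).2 hN, zero_smul]⟩

end Main

section Graded

variable {k R : Type} [Field k] [CommRing R] [Algebra k R] {𝒜 : ℕ → Submodule k R}
  [GradedAlgebra 𝒜] {M : Type} [AddCommGroup M] [Module k M] [Module R M] [IsScalarTower k R M]

lemma coe_decompose_sum {τ α : Type} [DecidableEq τ] (ℳ : τ → Submodule k M)
    [DirectSum.Decomposition ℳ] (s : Finset α) (f : α → M) (j : τ) :
    (DirectSum.decompose ℳ (∑ a ∈ s, f a) j : M) = ∑ a ∈ s, (DirectSum.decompose ℳ (f a) j : M) := by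
  rw [DirectSum.decompose_sum, DFinsupp.finsetSum_apply, AddSubmonoidClass.coe_finsetSum]

/-- An element with invertible constant term acts injectively on a graded module. -/
lemma eq_zero_of_smul_eq_zero {τ : Type} [LinearOrder τ] {ℳ : τ → Submodule k M}
    [DirectSum.Decomposition ℳ] (sh : ℕ → τ → τ) (sh0 : ∀ j, sh 0 j = j)
    (hsh : ∀ i j, 0 < i → j < sh i j)
    (hsmul : ∀ i j (r : R) (x : M), r ∈ 𝒜 i → x ∈ ℳ j → r • x ∈ ℳ (sh i j)) {u : R}
    (hu : IsUnit (GradedRing.proj 𝒜 0 u)) {z : M} (hz : u • z = 0) : z = 0 := by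
  classical
  by_contra hne
  have hs : (DirectSum.decompose ℳ z).support.Nonempty := by
    rw [Finset.nonempty_iff_ne_empty, Ne, DFinsupp.support_eq_empty]
    exact fun h => hne ((DirectSum.decompose ℳ).injective (h.trans (DirectSum.decompose_zero ℳ).symm))
  set j := (DirectSum.decompose ℳ z).support.min' hs with hj
  have hjm : j ∈ (DirectSum.decompose ℳ z).support := Finset.min'_mem _ _
  have hjl : ∀ l ∈ (DirectSum.decompose ℳ z).support, j ≤ l := fun l hl => Finset.min'_le _ _ hl
  have key : ∀ i l, (DirectSum.decompose ℳ ((DirectSum.decompose 𝒜 u i : R) •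
      (DirectSum.decompose ℳ z l : M)) j : M) =
        if i = 0 then if l = j then (DirectSum.decompose 𝒜 u 0 : R) •
          (DirectSum.decompose ℳ z j : M) else 0 else 0 := fun i l => by
    have hm := hsmul i l _ _ (DirectSum.decompose 𝒜 u i).2 (DirectSum.decompose ℳ z l).2
    by_cases hl : l ∈ (DirectSum.decompose ℳ z).support
    · split_ifs with h1 h2
      · subst h1 h2
        rw [sh0] at hm
        rw [DirectSum.decompose_of_mem_same ℳ hm]
      · subst h1
        rw [sh0] at hm
        rw [DirectSum.decompose_of_mem_ne ℳ hm h2]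
      · rw [DirectSum.decompose_of_mem_ne ℳ hm]
        exact ((hjl l hl).trans_lt (hsh i l (Nat.pos_of_ne_zero h1))).ne'
    · have : (DirectSum.decompose ℳ z l) = 0 := DFinsupp.notMem_support_iff.1 hl
      rw [this]
      have hlj : l ≠ j := fun h => hl (h ▸ hjm)
      simp [hlj]
  have h1 : (DirectSum.decompose ℳ (u • z) j : M) =
      (DirectSum.decompose 𝒜 u 0 : R) • (DirectSum.decompose ℳ z j : M) := by
    conv_lhs => rw [← DirectSum.sum_support_decompose 𝒜 u, ← DirectSum.sum_support_decompose ℳ z]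
    rw [Finset.sum_smul, coe_decompose_sum]
    simp_rw [Finset.smul_sum, coe_decompose_sum, key]
    rw [Finset.sum_eq_single 0]
    · simp only [if_true]
      rw [Finset.sum_eq_single j (fun l _ h => if_neg h) (fun h => absurd hjm h), if_pos rfl]
    · intro i _ hi
      simp [hi]
    · intro h
      rw [DFinsupp.notMem_support_iff.1 h]
      simp
  rw [hz, DirectSum.decompose_zero, DirectSum.zero_apply, ZeroMemClass.coe_zero] at h1
  have h2 := (hu.smul_eq_zero).1 h1.symm
  exact DFinsupp.mem_support_iff.1 hjm (Subtype.ext h2)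

variable {ℳ : ℤ → Submodule k M} [DirectSum.Decomposition ℳ]
  (hsmul : ∀ (i : ℕ) (j : ℤ) (r : R) (x : M), r ∈ 𝒜 i → x ∈ ℳ j → r • x ∈ ℳ (i + j))
include hsmul

/-- The components of a multiple of a homogeneous element. -/
lemma decompose_smul_apply (c : R) {x : M} {e : ℤ} (hx : x ∈ ℳ e) (j : ℤ) :
    (DirectSum.decompose ℳ (c • x) j : M) =
      (if 0 ≤ j - e then (DirectSum.decompose 𝒜 c (j - e).toNat : R) else 0) • x := by
  classical
  have key : ∀ i, (DirectSum.decompose ℳ ((DirectSum.decompose 𝒜 c i : R) • x) j : M) =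
      if (i : ℤ) + e = j then (DirectSum.decompose 𝒜 c i : R) • x else 0 := fun i => by
    have hm := hsmul i e _ _ (DirectSum.decompose 𝒜 c i).2 hx
    split_ifs with h
    · subst h; rw [DirectSum.decompose_of_mem_same ℳ hm]
    · rw [DirectSum.decompose_of_mem_ne ℳ hm h]
  have h1 : (DirectSum.decompose ℳ (c • x) j : M) =
      ∑ i ∈ (DirectSum.decompose 𝒜 c).support,
        if (i : ℤ) + e = j then (DirectSum.decompose 𝒜 c i : R) • x else 0 := by
    conv_lhs => rw [← DirectSum.sum_support_decompose 𝒜 c]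
    rw [Finset.sum_smul, coe_decompose_sum]
    simp_rw [key]
  rw [h1]
  split_ifs with hj
  · rw [Finset.sum_eq_single (j - e).toNat]
    · rw [if_pos (by omega)]
    · intro i _ hi
      rw [if_neg (by omega)]
    · intro h
      rw [DFinsupp.notMem_support_iff.1 h]
      simp
  · rw [zero_smul]
    exact Finset.sum_eq_zero fun i _ => if_neg (by omega)

/-- A graded module with a pairing which is nondegenerate at the origin is graded free. -/
theorem exists_graded_basis (h0 : ∀ u ∈ 𝒜 0, u ≠ 0 → IsUnit u)
    {n : ℕ} (x : Fin n → M)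
    (y : Fin n → M →ₗ[R] R)
    (hdet : (Matrix.of fun i l => y i (x l)).det ∉ (HomogeneousIdeal.irrelevant 𝒜).toIdeal)
    (hy : ∀ z, (∀ i, y i z = 0) → (Matrix.of fun i l => y i (x l)).det • z = 0) :
    ∃ (r : ℕ) (δ : Fin r → ℤ) (e : M ≃ₗ[R] (Fin r → R)),
      ∀ (j : ℤ) (x : M), x ∈ ℳ j → ∀ i : Fin r,
        if h : 0 ≤ j + δ i then (e x) i ∈ 𝒜 ((j + δ i).toNat) else (e x) i = 0 := by
  classical
  have hunit : ∀ u ∉ (HomogeneousIdeal.irrelevant 𝒜).toIdeal, IsUnit (GradedRing.proj 𝒜 0 u) :=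
    fun u hu => h0 _ (by simp [GradedRing.proj_apply]) fun h =>
      hu ((HomogeneousIdeal.mem_irrelevant_iff 𝒜 u).2 h)
  have hGM : ∀ u ∉ (HomogeneousIdeal.irrelevant 𝒜).toIdeal, ∀ z : M, u • z = 0 → z = 0 :=
    fun u hu z => eq_zero_of_smul_eq_zero (𝒜 := 𝒜) (ℳ := ℳ) (fun i j => (i : ℤ) + j) (by simp)
      (fun i j _ => by omega) hsmul (hunit u hu)
  have hGR : ∀ u ∉ (HomogeneousIdeal.irrelevant 𝒜).toIdeal, ∀ z : R, u • z = 0 → z = 0 :=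
    fun u hu z => eq_zero_of_smul_eq_zero (𝒜 := 𝒜) (ℳ := 𝒜) (fun i j => i + j) (by simp)
      (fun i j _ => by omega) (fun i j r x hr hx => SetLike.mul_mem_graded hr hx) (hunit u hu)
  have hinj : ∀ z, (∀ i, y i z = 0) → z = 0 := fun z hz => hGM _ hdet z (hy z hz)
  obtain ⟨x', ε, hx', hdet'⟩ : ∃ (x' : Fin n → M) (ε : Fin n → ℤ), (∀ l, x' l ∈ ℳ (ε l)) ∧
      (Matrix.of fun i l => y i (x' l)).det ∉ (HomogeneousIdeal.irrelevant 𝒜).toIdeal := by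
    by_contra! hcon
    let Φ := (Matrix.detRowAlternating (n := Fin n) (R := R)).toMultilinearMap.compLinearMap
      (fun _ => LinearMap.pi y)
    have hΦ : ∀ w : Fin n → M, Φ w = (Matrix.of fun i l => y i (w l)).det := fun w => by
      rw [← Matrix.det_transpose]; rfl
    refine hdet ?_
    rw [← hΦ, show x = fun l => ∑ j ∈ (DirectSum.decompose ℳ (x l)).support,
      (DirectSum.decompose ℳ (x l) j : M) from
        funext fun l => (DirectSum.sum_support_decompose ℳ (x l)).symm,
      MultilinearMap.map_sum_finset]
    refine Ideal.sum_mem _ fun s _ => ?_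
    rw [hΦ]
    exact hcon _ s fun l => SetLike.coe_mem _
  set B := Matrix.of fun i l => y i (x' l) with hB
  have hBc : ∀ (c : Fin n → R) i, y i (∑ l, c l • x' l) = B.mulVec c i := fun c i => by
    simp [hB, Matrix.mulVec, dotProduct, mul_comm]
  have hspan : ∀ z, ∃ c : Fin n → R, B.det • z = ∑ l, c l • x' l := fun z => by
    refine ⟨B.adjugate.mulVec fun i => y i z, ?_⟩
    rw [← sub_eq_zero]
    refine hinj _ fun i => ?_
    rw [map_sub, hBc, Matrix.mulVec_mulVec, Matrix.mul_adjugate, Matrix.smul_mulVec,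
      Matrix.one_mulVec]
    simp
  have hli : LinearIndependent R x' := by
    rw [Fintype.linearIndependent_iff]
    intro c hc
    have h1 : B.mulVec c = 0 := by
      ext i
      rw [← hBc, hc, map_zero, Pi.zero_apply]
    have h2 := congrArg (B.adjugate.mulVec ·) h1
    simp only [Matrix.mulVec_mulVec, Matrix.adjugate_mul, Matrix.mulVec_zero, Matrix.smul_mulVec,
      Matrix.one_mulVec] at h2
    exact fun l => hGR _ hdet' _ (congrFun h2 l)
  have hhom : ∀ j, ∀ z ∈ ℳ j, ∃ c : Fin n → R, z = ∑ l, c l • x' l ∧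
      ∀ l, if 0 ≤ j - ε l then c l ∈ 𝒜 (j - ε l).toNat else c l = 0 := fun j z hz => by
    obtain ⟨c, hc⟩ := hspan z
    obtain ⟨v, hv⟩ := (hunit _ hdet').exists_right_inv
    have hv0 : (DirectSum.decompose 𝒜 v 0 : R) * (DirectSum.decompose 𝒜 B.det 0 : R) = 1 := by
      have h1 := congrArg (fun w => (DirectSum.decompose 𝒜 w 0 : R)) hv
      simp only [GradedRing.proj_apply] at h1
      rw [DirectSum.decompose_of_mem_same 𝒜 SetLike.GradedOne.one_mem,
        DirectSum.coe_decompose_mul_of_left_mem_zero 𝒜 (SetLike.coe_mem _)] at h1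
      rw [mul_comm, h1]
    have h2 := congrArg (fun w => (DirectSum.decompose ℳ w j : M)) hc
    simp only [decompose_smul_apply hsmul _ hz, coe_decompose_sum,
      decompose_smul_apply hsmul _ (hx' _), sub_self, le_refl,
      if_true] at h2
    refine ⟨fun l => (DirectSum.decompose 𝒜 v 0 : R) *
      if 0 ≤ j - ε l then (DirectSum.decompose 𝒜 (c l) (j - ε l).toNat : R) else 0, ?_, ?_⟩
    · simp only [mul_smul]
      rw [← Finset.smul_sum, ← h2, smul_smul, show (j - j).toNat = 0 by simp, hv0, one_smul]
    · intro l
      split_ifs with h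
      · have := SetLike.mul_mem_graded (SetLike.coe_mem (DirectSum.decompose 𝒜 v 0))
          (SetLike.coe_mem (DirectSum.decompose 𝒜 (c l) (j - ε l).toNat))
        rw [zero_add] at this
        simpa only [if_pos h] using this
      · simp only [if_neg h, mul_zero]
  have htop : ⊤ ≤ Submodule.span R (Set.range x') := fun z _ => by
    rw [← DirectSum.sum_support_decompose ℳ z]
    refine Submodule.sum_mem _ fun j _ => ?_
    obtain ⟨c, hc, -⟩ := hhom j _ (SetLike.coe_mem (DirectSum.decompose ℳ z j))
    rw [hc]
    exact Submodule.sum_mem _ fun l _ => Submodule.smul_mem _ _ (Submodule.subset_span ⟨l, rfl⟩)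
  let b := Module.Basis.mk hli htop
  refine ⟨n, fun i => - ε i, b.equivFun, fun j z hz i => ?_⟩
  obtain ⟨c, hc, hcm⟩ := hhom j z hz
  have h3 : b.equivFun z = c := by
    rw [hc, show ∑ l, c l • x' l = b.equivFun.symm c by simp [b, Module.Basis.equivFun_symm_apply],
      LinearEquiv.apply_symm_apply]
  rw [h3]
  have := hcm i
  rw [← sub_eq_add_neg]
  split_ifs at this ⊢ with h <;> exact this

end Graded

section LocalFrame

variable {R : Type} [CommRing R] [IsNoetherianRing R] {M : Type} [AddCommGroup M] [Module R M]
  [Module.Finite R M]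

/-- A module which becomes free after localization has a basis with bounded denominators. -/
lemma exists_local_basis (S : Submonoid R)
    (hfree : Module.Free (Localization S) (LocalizedModule S M)) :
    ∃ s ∈ S, ∃ (r : ℕ) (b : Fin r → M) (φ : Fin r → M →ₗ[R] R),
      (∀ i j, φ i (b j) = if i = j then s else 0) ∧ ∀ x, ∑ i, φ i x • b i = s • x := by
  have : Module.FinitePresentation R M := Module.finitePresentation_of_finite R M
  rcases subsingleton_or_nontrivial (Localization S) with hsub | hnt
  · have h0 : (0 : R) ∈ S := by
      have : (algebraMap R (Localization S)) 1 = algebraMap R (Localization S) 0 :=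
        Subsingleton.elim _ _
      obtain ⟨c, hc⟩ := (IsLocalization.eq_iff_exists S _).1 this
      have := c.2
      simp only [mul_one, mul_zero] at hc
      rwa [hc] at this
    exact ⟨0, h0, 0, Fin.elim0, Fin.elim0, fun i => i.elim0, fun x => by simp⟩
  let B := Module.finBasis (Localization S) (LocalizedModule S M)
  set r := Module.finrank (Localization S) (LocalizedModule S M)
  let E : LocalizedModule S M ≃ₗ[R] (Fin r → Localization S) := B.equivFun.restrictScalars R
  let fM := LocalizedModule.mkLinearMap S M
  let fN : (Fin r → R) →ₗ[R] (Fin r → Localization S) :=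
    .pi fun i => Algebra.linearMap R (Localization S) ∘ₗ .proj i
  have : IsLocalizedModule S fN := inferInstanceAs (IsLocalizedModule S
    (.pi fun i => Algebra.linearMap R (Localization S) ∘ₗ .proj i))
  obtain ⟨h, s, hs⟩ := Module.FinitePresentation.exists_lift_of_isLocalizedModule S fN
    (E.toLinearMap ∘ₗ fM)
  obtain ⟨h', s', hs'⟩ := Module.FinitePresentation.exists_lift_of_isLocalizedModule S fM
    (E.symm.toLinearMap ∘ₗ fN)
  have hv : ∀ x, fN (h x) = (s : R) • E (fM x) := fun x => LinearMap.congr_fun hs x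
  have hv' : ∀ x, fM (h' x) = (s' : R) • E.symm (fN x) := fun x => LinearMap.congr_fun hs' x
  obtain ⟨c, hc⟩ := Module.Finite.exists_smul_of_comp_eq_of_isLocalizedModule S fN
    (h ∘ₗ h') ((s * s' : R) • LinearMap.id) (LinearMap.ext fun x => by
      rw [LinearMap.comp_apply, LinearMap.comp_apply, hv, hv', map_smul,
        LinearEquiv.apply_symm_apply, smul_smul]
      exact (map_smul fN _ x).symm)
  obtain ⟨c', hc'⟩ := Module.Finite.exists_smul_of_comp_eq_of_isLocalizedModule S fM
    (h' ∘ₗ h) ((s * s' : R) • LinearMap.id) (LinearMap.ext fun x => by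
      rw [LinearMap.comp_apply, LinearMap.comp_apply, hv', hv, map_smul,
        LinearEquiv.symm_apply_apply, smul_smul, mul_comm]
      exact (map_smul fM _ x).symm)
  have hcv : ∀ x, (c : R) • h (h' x) = (c * (s * s') : R) • x := fun x =>
    (LinearMap.congr_fun hc x).trans (smul_smul (c : R) (s * s' : R) x)
  have hcv' : ∀ x, (c' : R) • h' (h x) = (c' * (s * s') : R) • x := fun x =>
    (LinearMap.congr_fun hc' x).trans (smul_smul (c' : R) (s * s' : R) x)
  refine ⟨c' * c * (s * s'), (c' * c * (s * s')).2, r, fun i => h' (Pi.single i 1),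
    fun i => (c' * c : R) • (LinearMap.proj i ∘ₗ h), fun i j => ?_, fun x => ?_⟩
  · have := congrFun (hcv (Pi.single j 1)) i
    simp only [Pi.smul_apply, smul_eq_mul, Pi.single_apply] at this
    simp only [LinearMap.smul_apply, LinearMap.comp_apply, LinearMap.proj_apply, smul_eq_mul,
      mul_assoc, this]
    split_ifs <;> simp
  · have h1 : ∑ i, h x i • h' (Pi.single i 1) = h' (h x) := by
      conv_rhs => rw [pi_eq_sum_univ' (h x), map_sum]
      refine Finset.sum_congr rfl fun i _ => ?_
      rw [map_smul]
    calc ∑ i, ((c' * c : R) • (LinearMap.proj i ∘ₗ h)) x • h' (Pi.single i 1)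
        = (c * c' : R) • ∑ i, h x i • h' (Pi.single i 1) := by
          rw [Finset.smul_sum]
          refine Finset.sum_congr rfl fun i _ => ?_
          rw [smul_smul, mul_comm (c : R)]
          rfl
      _ = _ := by
          rw [h1, mul_smul, hcv', smul_smul]
          congr 1
          ring

variable {P : Type} [CommRing P] [Algebra P R]

/-- A module which is free on the punctured spectrum is free on a finite affine cover. -/
theorem exists_cover [IsNoetherianRing P] (hs : Function.Surjective (algebraMap P R))
    {I : Ideal P} (hI : ∀ p, algebraMap P R p = 0 ↔ p ∈ I) {m : Ideal R} [hm : m.IsMaximal]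
    (hfree : ∀ p : PrimeSpectrum R, p.asIdeal ≠ m →
      Module.Free (Localization.AtPrime p.asIdeal) (LocalizedModule p.asIdeal.primeCompl M)) :
    ∃ (T : Finset P) (r : T → ℕ), Nonempty (Frame (R := R) (fun a : T => (a : P)) r M) ∧
      Cover R (fun a : T => (a : P)) I (m.comap (algebraMap P R)) := by
  have key : ∀ p : {p : PrimeSpectrum R // p.asIdeal ≠ m}, ∃ g : P,
      algebraMap P R g ∉ p.1.asIdeal ∧ algebraMap P R g ∈ m ∧ ∃ (r : ℕ) (b : Fin r → M)
        (φ : Fin r → M →ₗ[R] R), (∀ i j, φ i (b j) = if i = j then algebraMap P R g else 0) ∧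
          ∀ x, ∑ i, φ i x • b i = algebraMap P R g • x := fun ⟨p, hp⟩ => by
    obtain ⟨s, hsp, r, b, φ, h1, h2⟩ := exists_local_basis (M := M) _ (hfree p hp)
    obtain ⟨t, htm, htp⟩ : ∃ t ∈ m, t ∉ p.asIdeal := Set.not_subset.1 fun h =>
      hp (hm.eq_of_le p.2.ne_top h).symm
    obtain ⟨g, hg⟩ := hs (t * s)
    refine ⟨g, ?_, ?_, r, b, fun i => t • φ i, fun i j => ?_, fun x => ?_⟩
    · rw [hg]
      exact fun h => (p.2.mem_or_mem h).elim htp hsp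
    · rw [hg]
      exact m.mul_mem_right _ htm
    · rw [LinearMap.smul_apply, h1, hg]
      split_ifs <;> simp
    · rw [hg, mul_smul, ← h2, Finset.smul_sum]
      exact Finset.sum_congr rfl fun i _ => by rw [LinearMap.smul_apply, smul_smul, smul_eq_mul]
  choose G hGp hGm hG using key
  obtain ⟨T, hT, hTs⟩ := (Submodule.fg_span_iff_fg_span_finset_subset (R := P) (Set.range G)).1
    (IsNoetherian.noetherian _)
  choose p hp using fun a : T => hT a.2
  choose r b φ h1 h2 using hG
  refine ⟨T, fun a => r (p a), ⟨⟨fun a => b (p a), fun a => φ (p a), fun a i j => ?_,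
    fun a x => ?_⟩⟩, hs, hI, fun a ha => ?_, IsNoetherian.noetherian _, fun a => ?_, ?_⟩
  · rw [h1, hp]
  · rw [h2, hp]
  · refine hGp (p a) ?_
    rw [hp, ha, map_zero]
    exact zero_mem _
  · rw [Ideal.mem_comap, ← hp]
    exact hGm _
  · rw [Ideal.radical_eq_sInf]
    refine le_sInf fun q ⟨hq, hqp⟩ => ?_
    have hker : RingHom.ker (algebraMap P R) ≤ q := fun x hx => hq (Ideal.mem_sup_left
      ((hI x).1 hx))
    have hq' := Ideal.map_isPrime_of_surjective hs hker
    have hcm : (q.map (algebraMap P R)).comap (algebraMap P R) = q := by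
      rw [Ideal.comap_map_of_surjective _ hs, sup_eq_left]
      exact hker
    by_cases hqm : q.map (algebraMap P R) = m
    · rw [← hqm, hcm]
    · refine absurd (Ideal.mem_map_of_mem _ (hq (Ideal.mem_sup_right ?_)))
        (hGp ⟨⟨_, hq'⟩, hqm⟩)
      have h3 : G ⟨⟨_, hq'⟩, hqm⟩ ∈ Submodule.span P (T : Set P) :=
        hTs ▸ Submodule.subset_span ⟨_, rfl⟩
      rwa [show (Set.range fun a : T => (a : P)) = (T : Set P) from Subtype.range_coe]

end LocalFrame

section DepthTwo

variable {P : Type} [CommRing P] {𝔪 : Ideal P} {A : Type} [AddCommGroup A] [Module P A]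

/-- Elementary form of `depth A ≥ 2`: sections over the complement of `V(𝔪)` extend uniquely. -/
structure SectionsExtend (𝔪 : Ideal P) (A : Type) [AddCommGroup A] [Module P A] : Prop where
  eq_zero : ∀ x : A, (∀ p ∈ 𝔪, p • x = 0) → x = 0
  exists_eq : ∀ θ : 𝔪 →ₗ[P] A, ∃ x : A, ∀ p, θ p = (p : P) • x

lemma SectionsExtend.ev (h : SectionsExtend 𝔪 A) : EV (ModuleCat.of P (P ⧸ 𝔪)) 2 A :=
  EV.ofHom h.eq_zero h.exists_eq

lemma SectionsExtend.hom {R : Type} [CommRing R] [Algebra P R] [Module R A] [IsScalarTower P R A]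
    (h : SectionsExtend 𝔪 A) (L : Type) [AddCommGroup L] [Module R L] :
    SectionsExtend 𝔪 (L →ₗ[R] A) where
  eq_zero φ hφ := LinearMap.ext fun l => h.eq_zero _ fun p hp => LinearMap.congr_fun (hφ p hp) l
  exists_eq θ := by
    choose x hx using fun l : L => h.exists_eq ((LinearMap.applyₗ' P l).comp θ)
    have hx' : ∀ l, ∀ p (hp : p ∈ 𝔪), p • x l = θ ⟨p, hp⟩ l := fun l p hp => (hx l ⟨p, hp⟩).symm
    refine ⟨⟨⟨x, fun l l' => ?_⟩, fun r l => ?_⟩, fun p => LinearMap.ext fun l => hx l p⟩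
    · rw [← sub_eq_zero]
      refine h.eq_zero _ fun p hp => ?_
      rw [smul_sub, smul_add, hx' _ _ hp, hx' _ _ hp, hx' _ _ hp, map_add, sub_self]
    · rw [RingHom.id_apply, ← sub_eq_zero]
      refine h.eq_zero _ fun p hp => ?_
      rw [smul_sub, smul_comm, hx' _ _ hp, hx' _ _ hp, map_smul, sub_self]

lemma SectionsExtend.of_regular {p q : P} (hp : p ∈ 𝔪) (hq : q ∈ 𝔪)
    (h0 : ∀ x : A, p • x = 0 → x = 0) (h1 : ∀ x z : A, q • x = p • z → ∃ y, x = p • y) :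
    SectionsExtend 𝔪 A where
  eq_zero x hx := h0 x (hx p hp)
  exists_eq θ := by
    have hθ : ∀ a b : 𝔪, (a : P) • θ b = (b : P) • θ a := fun a b => by
      rw [← map_smul, ← map_smul]
      congr 1
      ext
      simp [mul_comm]
    obtain ⟨y, hy⟩ := h1 (θ ⟨p, hp⟩) (θ ⟨q, hq⟩) (hθ ⟨q, hq⟩ ⟨p, hp⟩)
    refine ⟨y, fun a => ?_⟩
    rw [← sub_eq_zero]
    refine h0 _ ?_
    rw [smul_sub, show p • θ a = (a : P) • θ ⟨p, hp⟩ from hθ ⟨p, hp⟩ a, hy, smul_comm, sub_self]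

lemma exists_eq_smul_of_isWeaklyRegular {p q : P} {rs : List P}
    (h : RingTheory.Sequence.IsWeaklyRegular A (p :: q :: rs)) {x z : A} (hxz : q • x = p • z) :
    ∃ y, x = p • y := by
  rw [RingTheory.Sequence.isWeaklyRegular_cons_iff,
    RingTheory.Sequence.isWeaklyRegular_cons_iff] at h
  have h2 : (Submodule.Quotient.mk x : QuotSMulTop p A) = 0 := h.2.1 (by
    simp only [smul_zero]
    rw [← Submodule.Quotient.mk_smul, hxz, Submodule.Quotient.mk_eq_zero]
    exact Submodule.smul_mem_pointwise_smul _ _ _ trivial)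
  rw [Submodule.Quotient.mk_eq_zero] at h2
  obtain ⟨y, -, hy⟩ := h2
  exact ⟨y, hy.symm⟩

lemma SectionsExtend.of_isWeaklyRegular {rs : List P} (hrs : ∀ r ∈ rs, r ∈ 𝔪)
    (hl : 2 ≤ rs.length) (h : RingTheory.Sequence.IsWeaklyRegular A rs) : SectionsExtend 𝔪 A := by
  match rs, hl with
  | p :: q :: rs, _ =>
    exact .of_regular (hrs p (by simp)) (hrs q (by simp))
      (fun x hx => ((RingTheory.Sequence.isWeaklyRegular_cons_iff _ _ _).1 h).1 (by simpa using hx))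
      fun x z hxz => exists_eq_smul_of_isWeaklyRegular h hxz

variable {R : Type} [CommRing R] [Algebra P R] {m : Ideal R} [m.IsMaximal] [m.IsPrime]
  {M : Type} [AddCommGroup M] [Module R M] [Module P M] [IsScalarTower P R M]

lemma SectionsExtend.of_depthGE (hs : Function.Surjective (algebraMap P R))
    (hG : ∀ s ∉ m, ∀ z : M, s • z = 0 → z = 0)
    (h : depthGE (Localization.AtPrime m) (LocalizedModule m.primeCompl M) 2) :
    SectionsExtend (m.comap (algebraMap P R)) M := by
  obtain ⟨rs, hl, hrs, hreg⟩ := h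
  match rs, hl with
  | [r₁, r₂], _ =>
    have hr₁ : ∀ v : LocalizedModule m.primeCompl M, r₁ • v = 0 → v = 0 := fun v hv =>
      ((RingTheory.Sequence.isWeaklyRegular_cons_iff _ _ _).1 hreg).1 (by simpa using hv)
    let μ := LocalizedModule.mkLinearMap m.primeCompl M
    have hμ : ∀ x, μ x = 0 → x = 0 := fun x hx => by
      obtain ⟨s, hs⟩ := (IsLocalizedModule.eq_zero_iff m.primeCompl μ).1 hx
      exact hG s s.2 x hs
    have hμs : ∀ (a : R) x, algebraMap R (Localization.AtPrime m) a • μ x = μ (a • x) :=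
      fun a x => by rw [algebraMap_smul, map_smul]
    have hfrac : ∀ r ∈ maximalIdeal (Localization.AtPrime m), ∃ s ∉ m, ∃ p ∈ m.comap (algebraMap P R),
        algebraMap R (Localization.AtPrime m) (algebraMap P R p) =
          r * algebraMap R (Localization.AtPrime m) s := fun r hr => by
      obtain ⟨⟨a, s⟩, h⟩ := IsLocalization.surj m.primeCompl r
      obtain ⟨p, rfl⟩ := hs a
      refine ⟨s, s.2, p, ?_, h.symm⟩
      rw [Ideal.mem_comap, ← IsLocalization.AtPrime.to_map_mem_maximal_iff (Localization.AtPrime m) m,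
        ← h]
      exact Ideal.mul_mem_right _ _ hr
    obtain ⟨s₁, hs₁, p₁, hp₁, h₁⟩ := hfrac r₁ (hrs _ (by simp))
    obtain ⟨s₂, hs₂, p₂, hp₂, h₂⟩ := hfrac r₂ (hrs _ (by simp))
    have hreg₁ : ∀ x : M, p₁ • x = 0 → x = 0 := fun x hx => by
      refine hG s₁ hs₁ _ (hμ _ (hr₁ _ ?_))
      rw [← hμs, smul_smul, ← h₁, hμs, algebraMap_smul, hx, map_zero]
    have hreg₂ : ∀ x z : M, p₂ • x = p₁ • z → ∃ s ∉ m, ∃ y, s • x = p₁ • y := fun x z hxz => by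
      have h3 : r₂ • μ (s₂ • x) = r₁ • μ (s₁ • z) := by
        rw [← hμs, ← hμs, smul_smul, smul_smul, ← h₁, ← h₂, hμs, hμs, algebraMap_smul,
          algebraMap_smul, hxz]
      obtain ⟨v, hv⟩ := exists_eq_smul_of_isWeaklyRegular hreg h3
      obtain ⟨⟨y, t⟩, hy⟩ := IsLocalizedModule.surj m.primeCompl μ v
      have hy' : algebraMap R (Localization.AtPrime m) t • v = μ y := by
        rw [algebraMap_smul]; exact hy
      refine ⟨s₁ * t * s₂, m.primeCompl.mul_mem (m.primeCompl.mul_mem hs₁ t.2) hs₂, y, ?_⟩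
      rw [← sub_eq_zero]
      refine hμ _ ?_
      rw [map_sub, mul_smul, ← hμs, hv, map_mul, mul_smul, smul_comm _ r₁, hy', smul_smul,
        mul_comm, ← h₁, hμs, algebraMap_smul, sub_self]
    refine ⟨fun x hx => hreg₁ x (hx _ hp₁), fun θ => ?_⟩
    have hθ : ∀ a b : m.comap (algebraMap P R), (a : P) • θ b = (b : P) • θ a := fun a b => by
      rw [← map_smul, ← map_smul]
      congr 1
      ext
      simp [mul_comm]
    obtain ⟨s, hsm, y, hy⟩ := hreg₂ (θ ⟨p₁, hp₁⟩) (θ ⟨p₂, hp₂⟩) (hθ ⟨p₂, hp₂⟩ ⟨p₁, hp₁⟩)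
    obtain ⟨α, i, hi, hαi⟩ := Ideal.IsMaximal.exists_inv (I := m) inferInstance hsm
    obtain ⟨β, rfl⟩ := hs α
    obtain ⟨σ, rfl⟩ := hs s
    rw [algebraMap_smul] at hy
    have hz₀ : 1 - β * σ ∈ m.comap (algebraMap P R) := by
      rw [Ideal.mem_comap, map_sub, map_mul, map_one, ← hαi, add_sub_cancel_left]
      exact hi
    have hσ : ∀ q, σ • θ q = (q : P) • y := fun q => by
      rw [← sub_eq_zero]
      refine hreg₁ _ ?_
      rw [smul_sub, smul_comm, show p₁ • θ q = (q : P) • θ ⟨p₁, hp₁⟩ from hθ ⟨p₁, hp₁⟩ q,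
        smul_comm, hy, smul_comm, sub_self]
    refine ⟨β • y + θ ⟨_, hz₀⟩, fun q => ?_⟩
    rw [smul_add, smul_comm, ← hσ, hθ q ⟨_, hz₀⟩, smul_smul, ← add_smul, add_sub_cancel, one_smul]

end DepthTwo

section ExtComparison

open CategoryTheory CategoryTheory.Abelian Limits Opposite

lemma exists_of_homologyι_descOpcycles_eq_zero {E : Type*} [Category E] [Abelian E]
    {ι : Type*} {c : ComplexShape ι} (K : HomologicalComplex E c) {i j l : ι} (hj : c.prev i = j)
    (hl : c.next i = l) {J : E} [Injective J] (a : K.X i ⟶ J) (ha : K.d j i ≫ a = 0)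
    (h : K.homologyι i ≫ K.descOpcycles a j hj ha = 0) : ∃ b : K.X l ⟶ J, K.d i l ≫ b = a := by
  have hex : (ShortComplex.mk (K.homologyι i) (K.fromOpcycles i l) (by simp)).Exact :=
    ShortComplex.exact_of_f_is_kernel _ (K.homologyIsKernel i l hl)
  refine ⟨hex.descToInjective _ h, ?_⟩
  rw [← K.p_fromOpcycles, Category.assoc, hex.comp_descToInjective, K.p_descOpcycles]

variable {R : Type} [CommRing R] {X X' Y : ModuleCat.{0} R}

/-- The contravariant hom functor whose left derived functors define `Ext`. -/
noncomputable abbrev homFunctor (Y : ModuleCat.{0} R) : ModuleCat.{0} R ⥤ (ModuleCat.{0} R)ᵒᵖ :=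
  ((linearYoneda R (ModuleCat.{0} R)).obj Y).rightOp

/-- A cochain with values in `Y`, as a morphism of the opposite category. -/
noncomputable def cochain {Q : ModuleCat.{0} R} (f : Q ⟶ Y) :
    (homFunctor Y).obj Q ⟶ op (ModuleCat.of R R) :=
  (ModuleCat.ofHom (LinearMap.toSpanSingleton R (Q ⟶ Y) f)).op

lemma map_comp_cochain {Q Q' : ModuleCat.{0} R} (g : Q' ⟶ Q) (f : Q ⟶ Y) :
    (homFunctor Y).map g ≫ cochain f = cochain (g ≫ f) := by
  refine Quiver.Hom.unop_inj (ModuleCat.hom_ext (LinearMap.ext_ring ?_))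
  change g ≫ ((1 : R) • f) = (1 : R) • (g ≫ f)
  rw [one_smul, one_smul]

lemma cochain_surjective {Q : ModuleCat.{0} R} (b : (homFunctor Y).obj Q ⟶ op (ModuleCat.of R R)) :
    ∃ f, cochain f = b :=
  ⟨b.unop.hom (1 : R), Quiver.Hom.unop_inj (ModuleCat.hom_ext
    (LinearMap.ext_ring (one_smul R (b.unop.hom (1 : R)))))⟩

lemma cochain_injective {Q : ModuleCat.{0} R} {f g : Q ⟶ Y} (h : cochain f = cochain g) :
    f = g := by
  have h1 := congrArg (fun b => b.unop.hom (1 : R)) h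
  change (1 : R) • f = (1 : R) • g at h1
  rwa [one_smul, one_smul] at h1

lemma cochain_zero {Q : ModuleCat.{0} R} : cochain (0 : Q ⟶ Y) = 0 :=
  Quiver.Hom.unop_inj (ModuleCat.hom_ext (LinearMap.ext_ring (smul_zero (A := Q ⟶ Y) (1 : R))))

variable (P : ProjectiveResolution X) (P' : ProjectiveResolution X')

lemma d_comp_cochain {i j : ℕ} (f : P.complex.X i ⟶ Y) (hf : P.complex.d j i ≫ f = 0) :
    (((homFunctor Y).mapHomologicalComplex _).obj P.complex).d j i ≫ cochain f = 0 :=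
  (map_comp_cochain _ f).trans ((congrArg cochain hf).trans cochain_zero)

/-- The class in the derived functor of a cocycle with values in `Y`. -/
noncomputable def leftDerivedClass {i : ℕ} (f : P.complex.X i ⟶ Y)
    (hf : P.complex.d (i + 1) i ≫ f = 0) :
    ((homFunctor Y).leftDerived i).obj X ⟶ op (ModuleCat.of R R) :=
  (P.isoLeftDerivedObj (homFunctor Y) i).hom ≫
    (((homFunctor Y).mapHomologicalComplex _).obj P.complex).homologyι i ≫
      (((homFunctor Y).mapHomologicalComplex _).obj P.complex).descOpcycles (cochain f) (i + 1)
        (by simp) (d_comp_cochain P f hf)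

lemma map_comp_leftDerivedClass {i : ℕ} (f : P.complex.X i ⟶ Y)
    (hf : P.complex.d (i + 1) i ≫ f = 0) (g : X' ⟶ X) (φ : ProjectiveResolution.Hom P' P g) :
    ((homFunctor Y).leftDerived i).map g ≫ leftDerivedClass P f hf =
      leftDerivedClass P' (φ.hom.f i ≫ f) (by simp [← φ.hom.comm_assoc, hf]) := by
  rw [leftDerivedClass, ← Category.assoc, ProjectiveResolution.isoLeftDerivedObj_hom_naturality g P' P φ.hom
    (by simpa using φ.hom_f_zero_comp_π_f_zero), leftDerivedClass, Category.assoc]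
  congr 1
  refine (HomologicalComplex.homologyι_naturality_assoc
    (((homFunctor Y).mapHomologicalComplex _).map φ.hom) i _).trans ?_
  congr 1
  refine (HomologicalComplex.opcyclesMap_comp_descOpcycles _ _ _ _ _).trans ?_
  congr 1

instance : Injective (op (ModuleCat.of R R)) := by
  have : Projective (ModuleCat.of R R) := inferInstance
  infer_instance

lemma exists_of_leftDerivedClass_eq_zero {i : ℕ} (f : P.complex.X (i + 1) ⟶ Y)
    (hf : P.complex.d (i + 1 + 1) (i + 1) ≫ f = 0) (h : leftDerivedClass P f hf = 0) :
    ∃ g : P.complex.X i ⟶ Y, P.complex.d (i + 1) i ≫ g = f := by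
  rw [leftDerivedClass, Preadditive.IsIso.comp_left_eq_zero] at h
  obtain ⟨b, hb⟩ := exists_of_homologyι_descOpcycles_eq_zero _ _ (l := i) (by simp) _ _ h
  obtain ⟨g, rfl⟩ := cochain_surjective b
  exact ⟨g, cochain_injective ((map_comp_cochain _ g).symm.trans hb)⟩

/-- Every class in `Ext` is represented by an element of the derived functor `Ext`, in such a way
that restrictions along morphisms that kill the latter also kill the former. -/
lemma exists_ext_representative {i : ℕ} (α : Abelian.Ext X Y (i + 1)) :
    ∃ z : ((_root_.Ext R (ModuleCat.{0} R) (i + 1)).obj (op X)).obj Y,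
      ∀ (X' : ModuleCat.{0} R) (g : X' ⟶ X),
        (((_root_.Ext R (ModuleCat.{0} R) (i + 1)).map g.op).app Y).hom z = 0 →
          (Abelian.Ext.mk₀ g).comp α (zero_add _) = 0 := by
  let P := projectiveResolution X
  obtain ⟨f, hf, rfl⟩ := P.extMk_surjective α (i + 1 + 1) rfl
  refine ⟨(leftDerivedClass P f hf).unop.hom (1 : R), fun X' g hz => ?_⟩
  let P' := projectiveResolution X'
  let φ : ProjectiveResolution.Hom P' P g := ⟨ProjectiveResolution.lift g P' P,
    (ProjectiveResolution.lift_commutes_zero g P' P).trans (by simp)⟩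
  rw [ProjectiveResolution.mk₀_comp_extMk f _ rfl hf φ, ProjectiveResolution.extMk_eq_zero_iff _ _ _ _ _ i rfl]
  refine exists_of_leftDerivedClass_eq_zero P' _ (by simp [← φ.hom.comm_assoc, hf]) ?_
  rw [← map_comp_leftDerivedClass P P' f hf g φ]
  exact Quiver.Hom.unop_inj (ModuleCat.hom_ext (LinearMap.ext_ring hz))

lemma subsingleton_ext_obj {i : ℕ} (h : Subsingleton (Abelian.Ext X Y (i + 1))) :
    Subsingleton (((_root_.Ext R (ModuleCat.{0} R) (i + 1)).obj (op X)).obj Y) := by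
  let P := projectiveResolution X
  rw [← ModuleCat.isZero_iff_subsingleton]
  refine IsZero.of_iso ?_ (P.isoExt (i + 1) Y)
  rw [← HomologicalComplex.exactAt_iff_isZero_homology,
    HomologicalComplex.exactAt_iff' _ i (i + 1) (i + 1 + 1) (by simp) (by simp),
    ShortComplex.moduleCat_exact_iff]
  intro f hf
  exact (P.extMk_eq_zero_iff f _ rfl hf i rfl).1 (Subsingleton.elim _ _)

end ExtComparison

section LocalCohomology

open CategoryTheory CategoryTheory.Abelian Limits Opposite localCohomology

variable {R : Type} [CommRing R] (m : Ideal R) (A : ModuleCat.{0} R) (i : ℕ)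

/-- The colimit cocone exhibiting a local cohomology module as `colim Ext(R/mᵗ, A)`. -/
noncomputable def localCohomologyCocone : Cocone (diagram (idealPowersDiagram m) i ⋙ (evaluation _ _).obj A) :=
  ((evaluation _ _).obj A).mapCocone (colimit.cocone (diagram (idealPowersDiagram m) i))

/-- `localCohomologyCocone` is a colimit. -/
noncomputable def isColimitLocalCohomologyCocone : IsColimit (localCohomologyCocone m A i) :=
  isColimitOfPreserves ((evaluation _ _).obj A) (colimit.isColimit _)

lemma subsingleton_localCohomology
    (h : ∀ t, Subsingleton (Abelian.Ext (ModuleCat.of R (R ⧸ m ^ t)) A (i + 1))) :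
    Subsingleton ((localCohomology m (i + 1)).obj A) := by
  refine subsingleton_of_forall_eq 0 fun x => ?_
  obtain ⟨j, z, hz⟩ := Concrete.isColimit_exists_rep _ (isColimitLocalCohomologyCocone m A (i + 1)) x
  have : Subsingleton (((_root_.Ext R (ModuleCat.{0} R) (i + 1)).obj
    (op (ModuleCat.of R (R ⧸ m ^ j.unop.unop)))).obj A) := subsingleton_ext_obj (h _)
  rw [← hz, show z = 0 from this.elim _ _]
  exact map_zero ((localCohomologyCocone m A (i + 1)).ι.app j).hom

lemma subsingleton_ext_of_localCohomology
    (hN : ∀ t, ∀ N : Submodule R (R ⧸ m ^ t), Subsingleton (Abelian.Ext (ModuleCat.of R N) A i))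
    (h : Subsingleton ((localCohomology m (i + 1)).obj A)) :
    Subsingleton (Abelian.Ext (ModuleCat.of R (R ⧸ m ^ 1)) A (i + 1)) := by
  refine subsingleton_of_forall_eq 0 fun α => ?_
  obtain ⟨z, hz⟩ := exists_ext_representative α
  obtain ⟨j, w, w', hw⟩ := Concrete.isColimit_exists_of_rep_eq
    (diagram (idealPowersDiagram m) (i + 1) ⋙ (evaluation _ _).obj A)
    (isColimitLocalCohomologyCocone m A (i + 1)) (i := op (op 1)) (j := op (op 1)) z 0
    (h.elim _ _)
  have h1 := hz _ ((ringModIdeals (idealPowersDiagram m)).map w.unop)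
    (hw.trans (map_zero (((diagram (idealPowersDiagram m) (i + 1)).map w').app A).hom))
  let g : (R ⧸ m ^ j.unop.unop) →ₗ[R] R ⧸ m ^ 1 :=
    ((ringModIdeals (idealPowersDiagram m)).map w.unop).hom
  have hg : Function.Surjective g := by
    intro y
    obtain ⟨x, rfl⟩ := Submodule.Quotient.mk_surjective _ y
    exact ⟨Submodule.Quotient.mk x, rfl⟩
  have hS := shortExact_of (LinearMap.ker g).subtype g (Submodule.subtype_injective _) hg
    (LinearMap.exact_subtype_ker_map g)
  obtain ⟨β, hβ⟩ := Abelian.Ext.contravariant_sequence_exact₃ hS A α h1 (n₀ := i) (add_comm _ _)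
  rw [← hβ, (hN _ (LinearMap.ker g)).elim β 0, Abelian.Ext.comp_zero]

variable {A} [IsNoetherianRing R] [Module.Finite R A]

lemma support_quotient_pow_subset (t : ℕ) (N : Submodule R (R ⧸ m ^ t)) :
    Module.support R N ⊆ PrimeSpectrum.zeroLocus m := by
  rw [Module.support_eq_zeroLocus, PrimeSpectrum.zeroLocus_subset_zeroLocus_iff]
  refine fun a ha => ⟨t, ?_⟩
  have h1 := Ideal.pow_mem_pow ha t
  rw [Module.mem_annihilator]
  rintro ⟨x, hx⟩
  ext
  obtain ⟨y, rfl⟩ := Submodule.Quotient.mk_surjective _ x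
  change a ^ t • Submodule.Quotient.mk y = 0
  rw [← Submodule.Quotient.mk_smul, Submodule.Quotient.mk_eq_zero]
  exact Ideal.mul_mem_right _ _ h1

lemma EV.exists_isRegular (hm : m • (⊤ : Submodule R A) < ⊤) {n : ℕ}
    (h : EV (ModuleCat.of R (R ⧸ m)) n A) : ∃ rs : List R, rs.length = n ∧ (∀ r ∈ rs, r ∈ m) ∧
      RingTheory.Sequence.IsRegular A rs :=
  ModuleCat.exists_isRegular_of_exists_subsingleton_ext m n A hm (ModuleCat.of R (R ⧸ m))
    (by rw [Module.support_eq_zeroLocus, Ideal.annihilator_quotient]) h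

lemma ev_of_isRegular (hm : m • (⊤ : Submodule R A) < ⊤) {rs : List R} (hrs : ∀ r ∈ rs, r ∈ m)
    (h : RingTheory.Sequence.IsRegular A rs) (t : ℕ) (N : Submodule R (R ⧸ m ^ t)) :
    EV (ModuleCat.of R N) rs.length A :=
  ModuleCat.subsingleton_ext_of_exists_isRegular m (ModuleCat.of R N)
    (support_quotient_pow_subset m t N) A hm rs hrs h

lemma EV.succ_of_localCohomology (hm : m • (⊤ : Submodule R A) < ⊤)
    (h : EV (ModuleCat.of R (R ⧸ m)) (i + 1) A)
    (h' : Subsingleton ((localCohomology m (i + 1)).obj A)) :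
    EV (ModuleCat.of R (R ⧸ m)) (i + 2) A := by
  obtain ⟨rs, hl, hrs, hreg⟩ := h.exists_isRegular m hm
  have h1 := subsingleton_ext_of_localCohomology m A i
    (fun t N => ev_of_isRegular m hm hrs hreg t N i (by omega)) h'
  rw [pow_one] at h1
  intro j hj
  rcases (Nat.lt_succ_iff_lt_or_eq).1 hj with hj | rfl
  · exact h j hj
  · exact h1

lemma smul_top_lt_or_subsingleton [m.IsMaximal] (hA : ∀ s ∉ m, ∀ a : A, s • a = 0 → a = 0) :
    m • (⊤ : Submodule R A) < ⊤ ∨ Subsingleton A := by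
  refine (lt_or_eq_of_le le_top).imp_right fun hm => ?_
  obtain ⟨s, hs, hs0⟩ := Submodule.exists_sub_one_mem_and_smul_eq_zero_of_fg_of_le_smul m
    (⊤ : Submodule R A) Module.Finite.fg_top hm.ge
  have hsm : s ∉ m := fun hsm => (Ideal.ne_top_iff_one m).1 (Ideal.IsMaximal.ne_top ‹_›) (by
    simpa using m.sub_mem hsm hs)
  exact subsingleton_of_forall_eq 0 fun a => hA s hsm a (hs0 a trivial)

lemma exists_isWeaklyRegular_of_localCohomology [m.IsMaximal]
    (hA : ∀ s ∉ m, ∀ a : A, s • a = 0 → a = 0) (h : EV (ModuleCat.of R (R ⧸ m)) 2 A)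
    (h₂ : Subsingleton ((localCohomology m 2).obj A))
    (h₃ : Subsingleton ((localCohomology m 3).obj A)) :
    ∃ rs : List R, rs.length = 4 ∧ (∀ r ∈ rs, r ∈ m) ∧
      RingTheory.Sequence.IsWeaklyRegular A rs := by
  rcases smul_top_lt_or_subsingleton m hA with hm | hm
  · obtain ⟨rs, hl, hrs, hreg⟩ := ((h.succ_of_localCohomology m 1 hm h₂).succ_of_localCohomology
      m 2 hm h₃).exists_isRegular m hm
    exact ⟨rs, hl, hrs, hreg.1⟩
  · exact ⟨List.replicate 4 0, by simp, fun r hr => by simp [List.eq_of_mem_replicate hr],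
      ⟨fun i _ => Function.injective_of_subsingleton _⟩⟩

lemma subsingleton_localCohomology_of_isWeaklyRegular [m.IsMaximal]
    (hA : ∀ s ∉ m, ∀ a : A, s • a = 0 → a = 0) {rs : List R} (hrs : ∀ r ∈ rs, r ∈ m)
    (h : RingTheory.Sequence.IsWeaklyRegular A rs) (hi : i + 1 < rs.length) :
    Subsingleton ((localCohomology m (i + 1)).obj A) := by
  refine subsingleton_localCohomology m A i fun t => ?_
  rcases smul_top_lt_or_subsingleton m hA with hm | hm
  · have hne : (⊤ : Submodule R A) ≠ Ideal.ofList rs • ⊤ := fun htop =>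
      hm.ne (top_unique (htop.le.trans (Submodule.smul_mono_left (Ideal.span_le.2 hrs))))
    exact ModuleCat.subsingleton_ext_of_exists_isRegular m (ModuleCat.of R (R ⧸ m ^ t))
      (by
        rw [← (Submodule.topEquiv (R := R) (M := R ⧸ m ^ t)).support_eq]
        exact support_quotient_pow_subset m t ⊤) A hm rs hrs ⟨h, hne⟩ _ hi
  · refine subsingleton_of_forall_eq 0 fun x => ?_
    have h0 : CategoryTheory.CategoryStruct.id A = 0 :=
      (ModuleCat.isZero_of_subsingleton A).eq_of_src _ _
    rw [← x.comp_mk₀_id, h0, CategoryTheory.Abelian.Ext.mk₀_zero,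
      CategoryTheory.Abelian.Ext.comp_zero]

lemma subsingleton_localCohomology_of_free [m.IsMaximal] [Module.Free R A]
    (hA : ∀ s ∉ m, ∀ a : A, s • a = 0 → a = 0) {rs : List R} (hrs : ∀ r ∈ rs, r ∈ m)
    (h : RingTheory.Sequence.IsWeaklyRegular R rs) (hi : i + 1 < rs.length) :
    Subsingleton ((localCohomology m (i + 1)).obj A) :=
  subsingleton_localCohomology_of_isWeaklyRegular m i hA hrs
    (((TensorProduct.rid R A).isWeaklyRegular_congr rs).1 h.isWeaklyRegular_lTensor) hi

end LocalCohomology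

section RegularSequences

lemma isWeaklyRegular_X (k : Type) [Field k] (n : ℕ) :
    RingTheory.Sequence.IsWeaklyRegular (MvPolynomial (Fin n) k)
      (List.ofFn (MvPolynomial.X : Fin n → MvPolynomial (Fin n) k)) := by
  refine ⟨fun i hi => ?_⟩
  have hi' : i < n := by simpa using hi
  have hS : (Ideal.ofList ((List.ofFn (MvPolynomial.X : Fin n → MvPolynomial (Fin n) k)).take i) •
      ⊤ : Ideal (MvPolynomial (Fin n) k)) = Ideal.span (MvPolynomial.X '' {j : Fin n | (j : ℕ) < i}) := by
    rw [smul_eq_mul, Ideal.mul_top, Ideal.ofList]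
    congr 1
    ext p
    simp only [Set.mem_ofPred_eq, List.mem_take_iff_getElem, List.getElem_ofFn, Set.mem_image,
      List.length_ofFn]
    constructor
    · rintro ⟨j, hj, rfl⟩
      exact ⟨⟨j, by omega⟩, by simp only; omega, rfl⟩
    · rintro ⟨j, hj, rfl⟩
      exact ⟨j, lt_min hj j.2, rfl⟩
  rw [isSMulRegular_iff_right_eq_zero_of_smul]
  intro x hx
  obtain ⟨p, rfl⟩ := Submodule.Quotient.mk_surjective _ x
  rw [← Submodule.Quotient.mk_smul, Submodule.Quotient.mk_eq_zero, hS,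
    MvPolynomial.mem_ideal_span_X_image] at hx
  rw [Submodule.Quotient.mk_eq_zero, hS, MvPolynomial.mem_ideal_span_X_image]
  intro m hm
  obtain ⟨j, hj, hmj⟩ := hx (Finsupp.single ⟨i, hi'⟩ 1 + m) (by
    rw [List.getElem_ofFn, smul_eq_mul, MvPolynomial.mem_support_iff, MvPolynomial.coeff_X_mul]
    exact MvPolynomial.mem_support_iff.1 hm)
  refine ⟨j, hj, ?_⟩
  rwa [Finsupp.add_apply, Finsupp.single_apply_eq_zero.2, zero_add] at hmj
  rintro rfl
  simp at hj

variable {S : Type} [CommRing S]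

lemma EV.quot_ofList {N : ModuleCat.{0} S} {A : Type} [AddCommGroup A] [Module S A] {m : ℕ}
    {rs : List S} (h : EV N (m + rs.length) A) (hreg : RingTheory.Sequence.IsWeaklyRegular A rs) :
    EV N m (A ⧸ (Ideal.ofList rs • ⊤ : Submodule S A)) := by
  induction rs generalizing A with
  | nil =>
    refine h.ofEquiv (Submodule.quotEquivOfEqBot _ ?_).symm
    simp
  | cons r rs ih =>
    rw [RingTheory.Sequence.isWeaklyRegular_cons_iff] at hreg
    refine (ih ?_ hreg.2).ofEquiv (Submodule.quotOfListConsSMulTopEquivQuotSMulTopInner A r rs).symm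
    refine EV.quot (LinearMap.lsmul S A r) (Submodule.mkQ _) hreg.1 (Submodule.mkQ_surjective _) ?_
      (h.mono (by simp)) (h.mono (by simp))
    rw [LinearMap.exact_iff, Submodule.ker_mkQ, LinearMap.range_eq_map]
    rfl

variable {P R : Type} [CommRing P] [CommRing R] [Algebra P R] {m : Ideal R}
  {A : Type} [AddCommGroup A] [Module R A] [Module P A] [IsScalarTower P R A]

lemma ev_comap_of_isWeaklyRegular (hs : Function.Surjective (algebraMap P R)) {rs : List R}
    (hrs : ∀ r ∈ rs, r ∈ m) (h : RingTheory.Sequence.IsWeaklyRegular A rs) :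
    EV (ModuleCat.of P (P ⧸ m.comap (algebraMap P R))) rs.length A := by
  obtain ⟨ps, rfl⟩ := List.map_surjective_iff.2 hs rs
  rw [List.length_map]
  refine EV.ofWeaklyRegular ps (fun p hp => ?_)
    ((RingTheory.Sequence.isWeaklyRegular_map_algebraMap_iff R A ps).1 h)
  rw [Ideal.annihilator_quotient]
  exact hrs _ (List.mem_map_of_mem hp)

end RegularSequences

section PolynomialGrading

variable {k ν R : Type} [Field k] [Fintype ν] [CommRing R] [Algebra k R]
  {𝒜 : ℕ → Submodule k R} [GradedAlgebra 𝒜] [Algebra (MvPolynomial ν k) R]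
  [IsScalarTower k (MvPolynomial ν k) R]
  (h𝒜 : ∀ i, 𝒜 i = (MvPolynomial.homogeneousSubmodule ν k i).map
    (IsScalarTower.toAlgHom k (MvPolynomial ν k) R).toLinearMap)
include h𝒜

lemma proj_algebraMap (i : ℕ) (q : MvPolynomial ν k) :
    GradedRing.proj 𝒜 i (algebraMap _ R q) =
      algebraMap _ R (MvPolynomial.homogeneousComponent i q) := by
  have hmem : ∀ (j : ℕ) (p : MvPolynomial ν k), p.IsHomogeneous j → algebraMap _ R p ∈ 𝒜 j :=
    fun j p hp => by
      rw [h𝒜]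
      exact ⟨p, hp, rfl⟩
  induction q using MvPolynomial.induction_on' with
  | monomial u a =>
    have hu := MvPolynomial.isHomogeneous_monomial (d := u) a (n := u.degree) rfl
    rw [MvPolynomial.homogeneousComponent_of_mem hu, GradedRing.proj_apply]
    split_ifs with h
    · subst h
      exact DirectSum.decompose_of_mem_same _ (hmem _ _ hu)
    · rw [map_zero]
      exact DirectSum.decompose_of_mem_ne _ (hmem _ _ hu) (Ne.symm h)
  | add p q hp hq => simp only [map_add, hp, hq]

lemma isUnit_of_mem_zero {u : R} (hu : u ∈ 𝒜 0) (h : u ≠ 0) : IsUnit u := by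
  rw [h𝒜] at hu
  obtain ⟨p, hp, rfl⟩ := hu
  have hp' := MvPolynomial.totalDegree_eq_zero_iff_eq_C.1
    ((MvPolynomial.totalDegree_zero_iff_isHomogeneous ν).2 hp)
  rw [hp'] at h ⊢
  refine RingHom.isUnit_map _ (RingHom.isUnit_map _ (isUnit_iff_ne_zero.2 fun h0 => h ?_))
  rw [h0]
  simp

lemma isUnit_proj_zero {u : R} (hu : u ∉ (HomogeneousIdeal.irrelevant 𝒜).toIdeal) :
    IsUnit (GradedRing.proj 𝒜 0 u) :=
  isUnit_of_mem_zero h𝒜 (by simp [GradedRing.proj_apply]) fun h =>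
    hu ((HomogeneousIdeal.mem_irrelevant_iff 𝒜 u).2 h)

lemma irrelevant_isMaximal [hm : (HomogeneousIdeal.irrelevant 𝒜).toIdeal.IsPrime] :
    (HomogeneousIdeal.irrelevant 𝒜).toIdeal.IsMaximal := by
  refine Ideal.isMaximal_iff.2 ⟨fun h => hm.ne_top ((Ideal.eq_top_iff_one _).2 h),
    fun J s hJ hs hsJ => ?_⟩
  obtain ⟨v, hv⟩ := (isUnit_proj_zero h𝒜 hs).exists_right_inv
  have h0 : (1 - s * v) ∈ (HomogeneousIdeal.irrelevant 𝒜).toIdeal := by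
    have hsp : s - GradedRing.proj 𝒜 0 s ∈ (HomogeneousIdeal.irrelevant 𝒜).toIdeal := by
      refine (HomogeneousIdeal.mem_irrelevant_iff 𝒜 _).2 ?_
      rw [map_sub, sub_eq_zero]
      simp [GradedRing.proj_apply]
    have := Ideal.mul_mem_right (-v) _ hsp
    convert this using 1
    linear_combination -hv
  have := J.add_mem (hJ h0) (J.mul_mem_right v hsJ)
  simpa using this

lemma algebraMap_mem_irrelevant_iff [Nontrivial R] (p : MvPolynomial ν k) :
    algebraMap _ R p ∈ (HomogeneousIdeal.irrelevant 𝒜).toIdeal ↔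
      MvPolynomial.constantCoeff p = 0 := by
  refine (HomogeneousIdeal.mem_irrelevant_iff 𝒜 _).trans ?_
  rw [proj_algebraMap h𝒜, MvPolynomial.homogeneousComponent_zero, ← MvPolynomial.algebraMap_eq,
    ← IsScalarTower.algebraMap_apply, map_eq_zero, MvPolynomial.constantCoeff_eq]

lemma algebraMap_eq_zero_of_forall_mem_pow {I : Ideal (MvPolynomial ν k)}
    (hker : ∀ p, algebraMap (MvPolynomial ν k) R p = 0 ↔ p ∈ I) (p : MvPolynomial ν k)
    (hp : ∀ J, p ∈ I ⊔ MvPolynomial.idealOfVars ν k ^ J) : p ∈ I := by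
  classical
  rw [← hker]
  refine (DirectSum.decompose 𝒜).injective (DFinsupp.ext fun i => Subtype.ext ?_)
  obtain ⟨a, ha, q, hq, rfl⟩ := Submodule.mem_sup.1 (hp (i + 1))
  have := proj_algebraMap h𝒜 i q
  rw [GradedRing.proj_apply] at this
  rw [map_add, (hker a).2 ha, zero_add, this, DirectSum.decompose_zero]
  suffices MvPolynomial.homogeneousComponent i q = 0 by simp [this]
  ext u
  rw [MvPolynomial.coeff_homogeneousComponent, MvPolynomial.coeff_zero]
  split_ifs with h
  · rw [MvPolynomial.mem_pow_idealOfVars_iff'] at hq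
    exact hq u (by omega)
  · rfl

end PolynomialGrading

section CompleteIntersection

lemma Cover.eq_zero_of_torsion {P R ι A : Type} [CommRing P] [CommRing R] [Algebra P R]
    [AddCommGroup A] [Module R A] [Module P A] [IsScalarTower P R A] {g : ι → P} {I 𝔪 : Ideal P}
    (C : Cover R g I 𝔪) (h : EV (ModuleCat.of P (P ⧸ 𝔪)) 1 A) {x : A}
    (hx : ∀ a, ∃ n : ℕ, algebraMap P R (g a) ^ n • x = 0) : x = 0 := by
  refine h.eq_zero_of_torsion C.fg fun p hp => ?_
  have hle : I ⊔ Ideal.span (Set.range g) ≤ (Ideal.torsionOf P A x).radical := by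
    refine sup_le (fun q hq => Ideal.le_radical ?_) (Ideal.span_le.2 ?_)
    · rw [Ideal.mem_torsionOf_iff, ← algebraMap_smul R, (C.ker q).2 hq, zero_smul]
    · rintro _ ⟨a, rfl⟩
      obtain ⟨n, hn⟩ := hx a
      exact ⟨n, by rw [Ideal.mem_torsionOf_iff, ← algebraMap_smul R, map_pow, hn]⟩
  obtain ⟨n, hn⟩ := (Ideal.radical_le_radical_iff.2 hle) (C.rad hp)
  exact ⟨n, (Ideal.mem_torsionOf_iff _ _).1 hn⟩

lemma exists_isWeaklyRegular_of_completeIntersection {k R : Type} [Field k] [CommRing R]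
    [IsNoetherianRing R] {N c : ℕ} {f : Fin c → MvPolynomial (Fin N) k} {j : ℕ} (hj : N = j + c)
    [Algebra (MvPolynomial (Fin N) k) R]
    (hs : Function.Surjective (algebraMap (MvPolynomial (Fin N) k) R))
    (hker : ∀ p, algebraMap (MvPolynomial (Fin N) k) R p = 0 ↔ p ∈ Ideal.span (Set.range f))
    (hreg : RingTheory.Sequence.IsWeaklyRegular (MvPolynomial (Fin N) k) (List.ofFn f))
    {m : Ideal R} (hm : m ≠ ⊤) (hX : ∀ i, algebraMap (MvPolynomial (Fin N) k) R (MvPolynomial.X i) ∈ m) :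
    ∃ rs : List R, rs.length = j ∧ (∀ r ∈ rs, r ∈ m) ∧
      RingTheory.Sequence.IsWeaklyRegular R rs := by
  let P := MvPolynomial (Fin N) k
  let 𝔪 : Ideal P := m.comap (algebraMap P R)
  have h1 : EV (ModuleCat.of P (P ⧸ 𝔪)) (j + (List.ofFn f).length) P := by
    refine (EV.ofWeaklyRegular _ (fun p hp => ?_) (isWeaklyRegular_X k N)).mono (by simp [hj])
    rw [Ideal.annihilator_quotient]
    obtain ⟨i, rfl⟩ := (List.mem_ofFn' _ _).1 hp
    exact hX i
  have e : (P ⧸ (Ideal.ofList (List.ofFn f) • ⊤ : Submodule P P)) ≃ₗ[P] R := by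
    refine (Submodule.quotEquivOfEq _ _ ?_).trans
      ((Algebra.linearMap P R).quotKerEquivOfSurjective hs)
    ext p
    rw [LinearMap.mem_ker, Algebra.linearMap_apply, hker, smul_eq_mul, Ideal.mul_top, Ideal.ofList]
    simp [List.mem_ofFn', Set.range]
  have h2 := (h1.quot_ofList hreg).ofEquiv e
  have : Module.Finite P R := Module.Finite.of_surjective (Algebra.linearMap P R) hs
  have hlt : 𝔪 • (⊤ : Submodule P (ModuleCat.of P R)) < ⊤ := by
    refine lt_of_le_of_ne le_top fun htop => hm ((Ideal.eq_top_iff_one m).2 ?_)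
    have hle : 𝔪 • (⊤ : Submodule P R) ≤ m.restrictScalars P := by
      refine Submodule.smul_le.2 fun p hp x _ => ?_
      rw [Algebra.smul_def]
      exact m.mul_mem_right _ hp
    exact hle (htop.ge (Submodule.mem_top (x := (1 : R))))
  obtain ⟨rs, hl, hrs, h⟩ := EV.exists_isRegular (A := ModuleCat.of P R) 𝔪 hlt h2
  refine ⟨rs.map (algebraMap P R), by simpa using hl, fun r hr => ?_,
    (RingTheory.Sequence.isWeaklyRegular_map_algebraMap_iff R R rs).2 h.1⟩
  obtain ⟨p, hp, rfl⟩ := List.mem_map.1 hr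
  exact hrs p hp

end CompleteIntersection

section Splitting

variable {k R M : Type} [Field k] [CommRing R] [IsNoetherianRing R] [Algebra k R]
  {𝒜 : ℕ → Submodule k R} [GradedAlgebra 𝒜] {n c : ℕ} {f : Fin c → MvPolynomial (Fin n) k}
  [Algebra (MvPolynomial (Fin n) k) R] [IsScalarTower k (MvPolynomial (Fin n) k) R]
  [AddCommGroup M] [Module k M] [Module R M] [IsScalarTower k R M] [Module.Finite R M]
  [Module (MvPolynomial (Fin n) k) M] [IsScalarTower (MvPolynomial (Fin n) k) R M]
  {ℳ : ℤ → Submodule k M} [DirectSum.Decomposition ℳ]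

theorem splits_iff (hn : 4 + c ≤ n) {d : Fin c → ℕ} (hd : ∀ i, 0 < d i)
    (hhom : ∀ i, (f i).IsHomogeneous (d i))
    (hreg : RingTheory.Sequence.IsWeaklyRegular (MvPolynomial (Fin n) k) (List.ofFn f))
    (hs : Function.Surjective (algebraMap (MvPolynomial (Fin n) k) R))
    (hker : ∀ p, algebraMap (MvPolynomial (Fin n) k) R p = 0 ↔ p ∈ Ideal.span (Set.range f))
    (h𝒜 : ∀ i, 𝒜 i = (MvPolynomial.homogeneousSubmodule (Fin n) k i).map
      (IsScalarTower.toAlgHom k (MvPolynomial (Fin n) k) R).toLinearMap)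
    [hm : (HomogeneousIdeal.irrelevant 𝒜).toIdeal.IsPrime]
    (hsmul : ∀ (i : ℕ) (j : ℤ) (r : R) (x : M), r ∈ 𝒜 i → x ∈ ℳ j → r • x ∈ ℳ (i + j))
    (hlocfree : ∀ p : PrimeSpectrum R, p.asIdeal ≠ (HomogeneousIdeal.irrelevant 𝒜).toIdeal →
      Module.Free (Localization.AtPrime p.asIdeal) (LocalizedModule p.asIdeal.primeCompl M))
    (hsat : depthGE (Localization.AtPrime (HomogeneousIdeal.irrelevant 𝒜).toIdeal)
      (LocalizedModule (HomogeneousIdeal.irrelevant 𝒜).toIdeal.primeCompl M) 2) :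
    (∃ (r : ℕ) (δ : Fin r → ℤ) (e : M ≃ₗ[R] (Fin r → R)),
        ∀ (j : ℤ) (x : M), x ∈ ℳ j → ∀ i : Fin r,
          if h : 0 ≤ j + δ i then (e x) i ∈ 𝒜 ((j + δ i).toNat) else (e x) i = 0) ↔
      (Subsingleton ((localCohomology ((HomogeneousIdeal.irrelevant 𝒜).toIdeal) 2).obj
          (ModuleCat.of R (M →ₗ[R] M))) ∧
       Subsingleton ((localCohomology ((HomogeneousIdeal.irrelevant 𝒜).toIdeal) 3).obj
          (ModuleCat.of R (M →ₗ[R] M)))) := by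
  classical
  have hmax := irrelevant_isMaximal h𝒜
  have hR : Nontrivial R := nontrivial_of_ne 0 1 fun h =>
    hm.ne_top ((Ideal.eq_top_iff_one _).2 (h ▸ Ideal.zero_mem _))
  have hmem := algebraMap_mem_irrelevant_iff h𝒜
  have hgM : ∀ s ∉ (HomogeneousIdeal.irrelevant 𝒜).toIdeal, ∀ z : M, s • z = 0 → z = 0 :=
    fun s hs z => eq_zero_of_smul_eq_zero (𝒜 := 𝒜) (ℳ := ℳ) (fun i j => (i : ℤ) + j) (by simp)
      (fun i j _ => by omega) hsmul (isUnit_proj_zero h𝒜 hs)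
  have hgE : ∀ s ∉ (HomogeneousIdeal.irrelevant 𝒜).toIdeal, ∀ z : M →ₗ[R] M, s • z = 0 → z = 0 :=
    fun s hs z hz => LinearMap.ext fun x => hgM s hs _ (LinearMap.congr_fun hz x)
  generalize hmdef : (HomogeneousIdeal.irrelevant 𝒜).toIdeal = m at *
  obtain ⟨rs, hl, hrs, hrsR⟩ := exists_isWeaklyRegular_of_completeIntersection (j := n - c)
    (by omega) hs hker hreg hm.ne_top fun i => (hmem _).2 (MvPolynomial.constantCoeff_X k i)
  constructor
  · rintro ⟨r, δ, e, -⟩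
    have : Module.Free R M := Module.Free.of_equiv e.symm
    have hfin : Module.Finite R (M →ₗ[R] M) := inferInstance
    have hfree : Module.Free R (M →ₗ[R] M) := inferInstance
    exact ⟨subsingleton_localCohomology_of_free (A := ModuleCat.of R (M →ₗ[R] M)) m 1 hgE hrs hrsR
      (by omega), subsingleton_localCohomology_of_free (A := ModuleCat.of R (M →ₗ[R] M)) m 2 hgE hrs
      hrsR (by omega)⟩
  · rintro ⟨h₂, h₃⟩
    have hI : Ideal.span (Set.range f) ≤
        RingHom.ker (MvPolynomial.constantCoeff (σ := Fin n) (R := k)) := by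
      refine Ideal.span_le.2 ?_
      rintro _ ⟨i, rfl⟩
      rw [SetLike.mem_coe, RingHom.mem_ker, MvPolynomial.constantCoeff_eq]
      exact (hhom i).coeff_eq_zero (by simpa using (hd i).ne)
    obtain ⟨T, r, ⟨F⟩, C⟩ := exists_cover (M := M) (m := m) hs hker hlocfree
    have hSM := SectionsExtend.of_depthGE (m := m) hs hgM hsat
    have hEVR := ev_comap_of_isWeaklyRegular hs hrs hrsR
    have hSR : SectionsExtend (m.comap (algebraMap (MvPolynomial (Fin n) k) R)) R := by
      obtain ⟨ps, rfl⟩ := List.map_surjective_iff.2 hs rs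
      rw [List.length_map] at hl
      exact .of_isWeaklyRegular (rs := ps) (fun p hp => hrs _ (List.mem_map_of_mem hp)) (by omega)
        ((RingTheory.Sequence.isWeaklyRegular_map_algebraMap_iff R R ps).1 hrsR)
    have hSE : EV (ModuleCat.of R (R ⧸ m)) 2 (M →ₗ[R] M) :=
      ((SectionsExtend.of_depthGE (P := R) (m := m) Function.surjective_id hgM hsat).hom M).ev
    obtain ⟨rs', hl', hrs', hreg'⟩ := exists_isWeaklyRegular_of_localCohomology
      (A := ModuleCat.of R (M →ₗ[R] M)) m hgE hSE h₂ h₃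
    have hMM := ev_comap_of_isWeaklyRegular (A := M →ₗ[R] M) hs hrs' hreg'
    rw [hl'] at hMM
    obtain ⟨N, x, y, p, hdet, hp, hy⟩ := exists_dual_pairing hreg C F hI
      (algebraMap_eq_zero_of_forall_mem_pow h𝒜 hker)
      (fun z => C.eq_zero_of_torsion (hSR.ev.mono (by simp)))
      (fun z => C.eq_zero_of_torsion (hSM.ev.mono (by simp)))
      ((hEVR.mono (by omega)).ofEquiv
        ((LinearMap.ringLmapEquivSelf R R R).symm.restrictScalars (MvPolynomial (Fin n) k)))
      (hSR.hom M).ev (hSM.hom R).ev hMM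
    refine exists_graded_basis hsmul (fun u hu => isUnit_of_mem_zero h𝒜 hu) x y ?_ ?_
    · rw [hdet, hmdef, hmem]
      exact hp
    · rwa [hdet]

end Splitting

end VB

/-- **Splitting of vector bundles on complete intersections.** Let
`X = Proj (k[x₀,…,xₙ]/(f₁,…,f_c)) ⊂ ℙⁿ_k` be a global complete intersection of dimension
`n - c ≥ 3` and let `V` be a vector bundle on `X`. Encode `V` by the finitely generated
graded module `M = ⊕ᵢ Γ(X, V(i))` over the homogeneous coordinate ring
`R = k[x₀,…,xₙ]/(f₁,…,f_c)` : a graded `R`-module, locally free away from the irrelevant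
maximal ideal `m`, of depth `≥ 2` at `m`. Via `⊕ᵢ Hⱼ(X, End(V)(i)) ≅ H^{j+1}_m(End_R M)`,
the condition `H¹(X, End(V)(i)) = H²(X, End(V)(i)) = 0` for all `i ∈ ℤ` becomes
`H²_m(End_R M) = H³_m(End_R M) = 0`, and the conclusion that `V` is a direct sum of powers
of `O(1)` becomes: `M` is a free graded module, `M ≅ ⊕ᵢ R(dᵢ)`. -/
theorem vector_bundle_splits_iff_cohomology_vanishes
    (k : Type) [Field k] (n c : ℕ) (hc : c ≤ n) (hdim : 3 ≤ n - c)
    (f : Fin c → MvPolynomial (Fin (n + 1)) k) (d : Fin c → ℕ) (hd : ∀ i, 0 < d i)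
    (hhom : ∀ i, MvPolynomial.IsHomogeneous (f i) (d i))
    (hreg : RingTheory.Sequence.IsRegular (MvPolynomial (Fin (n + 1)) k) (List.ofFn f))
    (R : Type) [CommRing R] [Algebra k R] [IsNoetherianRing R]
    (ρ : (MvPolynomial (Fin (n + 1)) k ⧸ Ideal.span (Set.range f)) ≃ₐ[k] R)
    (𝒜 : ℕ → Submodule k R) [GradedAlgebra 𝒜]
    (h𝒜 : ∀ i, 𝒜 i = (MvPolynomial.homogeneousSubmodule (Fin (n + 1)) k i).map
      ((ρ.toAlgHom.comp (Ideal.Quotient.mkₐ k (Ideal.span (Set.range f)))).toLinearMap))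
    (hm : ((HomogeneousIdeal.irrelevant 𝒜).toIdeal).IsPrime)
    (M : Type) [AddCommGroup M] [Module k M] [Module R M] [IsScalarTower k R M]
    [Module.Finite R M]
    (ℳ : ℤ → Submodule k M) [DirectSum.Decomposition ℳ]
    (hsmul : ∀ (i : ℕ) (j : ℤ) (r : R) (x : M), r ∈ 𝒜 i → x ∈ ℳ j → r • x ∈ ℳ (i + j)) :
    haveI := hm
    ∀ (_hlocfree : ∀ p : PrimeSpectrum R,
        p.asIdeal ≠ (HomogeneousIdeal.irrelevant 𝒜).toIdeal →
        Module.Free (Localization.AtPrime p.asIdeal)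
          (LocalizedModule p.asIdeal.primeCompl M))
      (_hsat : depthGE (Localization.AtPrime (HomogeneousIdeal.irrelevant 𝒜).toIdeal)
        (LocalizedModule ((HomogeneousIdeal.irrelevant 𝒜).toIdeal).primeCompl M) 2),
    ((∃ (r : ℕ) (δ : Fin r → ℤ) (e : M ≃ₗ[R] (Fin r → R)),
        ∀ (j : ℤ) (x : M), x ∈ ℳ j → ∀ i : Fin r,
          if h : 0 ≤ j + δ i then (e x) i ∈ 𝒜 ((j + δ i).toNat) else (e x) i = 0) ↔
      (Subsingleton ((localCohomology ((HomogeneousIdeal.irrelevant 𝒜).toIdeal) 2).obj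
          (ModuleCat.of R (M →ₗ[R] M))) ∧
       Subsingleton ((localCohomology ((HomogeneousIdeal.irrelevant 𝒜).toIdeal) 3).obj
          (ModuleCat.of R (M →ₗ[R] M))))) := by
  intro hlocfree hsat
  let φ := ρ.toAlgHom.comp (Ideal.Quotient.mkₐ k (Ideal.span (Set.range f)))
  let _ : Algebra (MvPolynomial (Fin (n + 1)) k) R := φ.toRingHom.toAlgebra
  let _ : Module (MvPolynomial (Fin (n + 1)) k) M := Module.compHom M φ.toRingHom
  have : IsScalarTower (MvPolynomial (Fin (n + 1)) k) R M :=
    ⟨fun p r x => mul_smul (φ p) r x⟩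
  have : IsScalarTower k (MvPolynomial (Fin (n + 1)) k) R :=
    IsScalarTower.of_algebraMap_eq fun a => (φ.commutes a).symm
  refine VB.splits_iff (f := f) (by omega) hd hhom hreg.1
    (ρ.surjective.comp Ideal.Quotient.mk_surjective) (fun p => ?_) h𝒜 hsmul hlocfree hsat
  exact (map_eq_zero_iff ρ ρ.injective).trans Ideal.Quotient.eq_zero_iff_mem
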